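/- Let n ≥ 2 be an integer, let Γ ∈ 𝒰, and let K be a homogeneous Calderón–Zygmund kernel on ℝ^n. For k ∈ ℤ define the non-oscillatory part H_{k,no}f(x) := p.v. ∫_{ℝ^n} f(x−t) e^{i2^kΓ(|t|)} ( ∑_{l≤k_*} ψ_l(t) ) K(t) dt, where k_* := sup{ m ∈ ℤ : 2^k Γ(2^m) ≤ 1 }. Then for every p ∈ (1,∞) there exists a constant C such that for every Schwartz function f on ℝ^n and every λ > 0 one has ‖ λ · √(N_λ(H_{k,no}f(x) : k ∈ ℤ)) ‖_{L^p(ℝ^n, dx)} ≤ C ‖f‖_{L^p(ℝ^n)}, with C independent of λ. -/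

import Mathlib

open MeasureTheory Filter Set
open scoped ENNReal NNReal FourierTransform Topology

noncomputable section

/-- `ℝⁿ` as a Euclidean space. -/
abbrev Rn (n : ℕ) := EuclideanSpace ℝ (Fin n)

/-- The class `𝒰` of phase functions: `Γ` is continuous on `[0,∞)`, smooth on `(0,∞)`,
`Γ(0) = 0`, `Γ′ > 0` on `(0,∞)`, with the bounds `c_{1,j} ≤ |s^j Γ^{(j)}(s)/Γ(s)|` for
`j = 1, 2` and `|s^j Γ^{(j)}(s)/Γ(s)| ≤ c_{2,j}` for all `j ≥ 1`. -/
structure IsGammaU (Γ : ℝ → ℝ) : Prop where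
  continuousOn : ContinuousOn Γ (Set.Ici 0)
  smooth : ContDiffOn ℝ (⊤ : ℕ∞) Γ (Set.Ioi 0)
  map_zero : Γ 0 = 0
  deriv_pos : ∀ s > (0 : ℝ), 0 < deriv Γ s
  lower : ∀ j ∈ ({1, 2} : Set ℕ), ∃ c > (0 : ℝ), ∀ s > (0 : ℝ),
    c ≤ |s ^ j * iteratedDeriv j Γ s / Γ s|
  upper : ∀ j : ℕ, 1 ≤ j → ∃ c > (0 : ℝ), ∀ s > (0 : ℝ),
    |s ^ j * iteratedDeriv j Γ s / Γ s| ≤ c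

/-- `K` is a homogeneous Calderón–Zygmund kernel on `ℝⁿ`: `K(t) = Ω(t)/‖t‖ⁿ` with `Ω` smooth
away from the origin, homogeneous of degree `0`, and of mean value zero on the unit sphere. -/
def IsHomCZKernel (n : ℕ) (K : Rn n → ℝ) : Prop :=
  ∃ Ω : Rn n → ℝ,
    ContDiffOn ℝ (⊤ : ℕ∞) Ω {x : Rn n | x ≠ 0} ∧
    (∀ c : ℝ, 0 < c → ∀ t : Rn n, Ω (c • t) = Ω t) ∧
    (∫ θ : Metric.sphere (0 : Rn n) 1, Ω θ ∂((volume : Measure (Rn n)).toSphere) = 0) ∧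
    (∀ t : Rn n, t ≠ 0 → K t = Ω t / ‖t‖ ^ n)

/-- The `r`-variation of a family `(a_u)_{u ∈ 𝒦}`. -/
def variation {ι : Type*} [LinearOrder ι] (r : ℝ) (𝒦 : Set ι) (a : ι → ℂ) : ℝ≥0∞ :=
  ⨆ (J : ℕ) (u : Fin (J + 1) → ι) (_ : StrictMono u) (_ : ∀ i, u i ∈ 𝒦),
    (∑ i : Fin J, (‖a (u i.succ) - a (u i.castSucc)‖₊ : ℝ≥0∞) ^ r) ^ (1 / r)

/-- The `λ`-jump counting function of a family `(a_u)_{u ∈ 𝒦}`. -/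
def jumpCount {ι : Type*} [LinearOrder ι] (lam : ℝ) (𝒦 : Set ι) (a : ι → ℂ) : ℝ≥0∞ :=
  ⨆ (J : ℕ) (s : Fin J → ι) (t : Fin J → ι) (_ : ∀ i, s i ∈ 𝒦) (_ : ∀ i, t i ∈ 𝒦)
    (_ : ∀ i, s i < t i) (_ : ∀ i j : Fin J, i < j → t i < s j)
    (_ : ∀ i, lam < ‖a (t i) - a (s i)‖), (J : ℝ≥0∞)

/-- The `L^p` norm of an `ℝ≥0∞`-valued function. -/
def lpNormENN {α : Type*} [MeasurableSpace α] (p : ℝ) (g : α → ℝ≥0∞) (μ : Measure α) : ℝ≥0∞ :=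
  (∫⁻ x, g x ^ p ∂μ) ^ (1 / p)

/-- The fixed Littlewood–Paley cutoff `ψ : ℝ → [0,1]`, supported in `{1/2 ≤ |s| ≤ 2}`,
with `∑_{l ∈ ℤ} ψ(2^{-l} s) = 1` for `s ≠ 0`. -/
def IsLPCutoff (ψ : ℝ → ℝ) : Prop :=
  ContDiff ℝ (⊤ : ℕ∞) ψ ∧ (∀ s, ψ s ∈ Set.Icc (0 : ℝ) 1) ∧
    (∀ s, ψ s ≠ 0 → |s| ∈ Set.Icc (1/2 : ℝ) 2) ∧
    (∀ s : ℝ, s ≠ 0 → HasSum (fun l : ℤ => ψ ((2 : ℝ) ^ (-l) * s)) 1)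

/-- `k_* = sup{ m ∈ ℤ : 2^k Γ(2^m) ≤ 1 }`. -/
def kstar (Γ : ℝ → ℝ) (k : ℤ) : ℤ :=
  sSup {m : ℤ | (2 : ℝ) ^ k * Γ ((2 : ℝ) ^ m) ≤ 1}

/-- The non-oscillatory part `H_{k,no} f`. -/
def Hkno {n : ℕ} (Γ : ℝ → ℝ) (K : Rn n → ℝ) (ψ : ℝ → ℝ) (k : ℤ)
    (f : Rn n → ℂ) (x : Rn n) : ℂ :=
  limUnder (𝓝[>] (0 : ℝ)) fun ε =>
    ∫ t in {t : Rn n | ε < ‖t‖ ∧ ‖t‖ < ε⁻¹},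
      f (x - t) * Complex.exp (Complex.I * Complex.ofReal ((2 : ℝ) ^ k * Γ ‖t‖)) *
        Complex.ofReal ((∑' l : ℤ, if l ≤ kstar Γ k then ψ ((2 : ℝ) ^ (-l) * ‖t‖) else 0) * K t)

namespace JumpNonosc

/-! ### Almost orthogonality along a chain of projections -/

lemma sum_pow_natAbs_le {r : ℝ} (hr0 : 0 ≤ r) (hr1 : r < 1) (S : Finset ℤ) (m : ℤ) :
    ∑ j ∈ S, r ^ (j - m).natAbs ≤ 2 / (1 - r) := by
  classical
  have hgeo : ∀ T : Finset ℕ, ∑ k ∈ T, r ^ k ≤ 1 / (1 - r) := by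
    intro T
    have := (summable_geometric_of_lt_one hr0 hr1).sum_le_tsum T (fun _ _ => by positivity)
    rwa [tsum_geometric_of_lt_one hr0 hr1, inv_eq_one_div] at this
  have h1 : ∑ j ∈ S.filter (fun j => m ≤ j), r ^ (j - m).natAbs ≤ 1 / (1 - r) := by
    rw [← Finset.sum_image (f := fun k : ℕ => r ^ k) (g := fun j : ℤ => (j - m).natAbs)]
    · exact hgeo _
    · intro a ha b hb h
      simp only [Finset.coe_filter, mem_ofPred_eq] at ha hb
      have : (a - m).natAbs = (b - m).natAbs := h
      omega
  have h2 : ∑ j ∈ S.filter (fun j => ¬ m ≤ j), r ^ (j - m).natAbs ≤ 1 / (1 - r) := by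
    rw [← Finset.sum_image (f := fun k : ℕ => r ^ k) (g := fun j : ℤ => (j - m).natAbs)]
    · exact hgeo _
    · intro a ha b hb h
      simp only [Finset.coe_filter, mem_ofPred_eq] at ha hb
      have : (a - m).natAbs = (b - m).natAbs := h
      omega
  rw [← Finset.sum_filter_add_sum_filter_not S (fun j => m ≤ j)]
  calc _ ≤ 1 / (1 - r) + 1 / (1 - r) := add_le_add h1 h2
    _ = _ := by ring

lemma triple_sum_le {r : ℝ} (hr0 : 0 ≤ r) (hr1 : r < 1) (F S : Finset ℤ) (x y : ℤ → ℝ) :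
    ∑ m ∈ F, ∑ j ∈ S, ∑ k ∈ S, r ^ (m - j).natAbs * r ^ (m - k).natAbs * (x j * y k)
      ≤ (2 / (1 - r)) ^ 2 * ((∑ j ∈ S, x j ^ 2 + ∑ k ∈ S, y k ^ 2) / 2) := by
  have hK : 0 ≤ 2 / (1 - r) := div_nonneg (by norm_num) (by linarith)
  have hsym : ∀ a b : ℤ, (a - b).natAbs = (b - a).natAbs := fun a b => by omega
  have key : ∀ z : ℤ → ℝ, ∑ m ∈ F, ∑ j ∈ S, ∑ k ∈ S,
      r ^ (m - j).natAbs * r ^ (m - k).natAbs * (z j ^ 2) ≤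
        (2 / (1 - r)) ^ 2 * ∑ j ∈ S, z j ^ 2 := by
    intro z
    calc ∑ m ∈ F, ∑ j ∈ S, ∑ k ∈ S, r ^ (m - j).natAbs * r ^ (m - k).natAbs * (z j ^ 2)
        = ∑ m ∈ F, ∑ j ∈ S, r ^ (m - j).natAbs * z j ^ 2 * ∑ k ∈ S, r ^ (k - m).natAbs := by
          refine Finset.sum_congr rfl fun m _ => Finset.sum_congr rfl fun j _ => ?_
          rw [Finset.mul_sum]
          refine Finset.sum_congr rfl fun k _ => ?_
          rw [hsym m k]; ring
      _ ≤ ∑ m ∈ F, ∑ j ∈ S, r ^ (m - j).natAbs * z j ^ 2 * (2 / (1 - r)) := by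
          gcongr with m _ j _
          exact sum_pow_natAbs_le hr0 hr1 S m
      _ = ∑ j ∈ S, (2 / (1 - r)) * z j ^ 2 * ∑ m ∈ F, r ^ (m - j).natAbs := by
          rw [Finset.sum_comm]
          refine Finset.sum_congr rfl fun j _ => ?_
          rw [Finset.mul_sum]
          refine Finset.sum_congr rfl fun m _ => ?_
          ring
      _ ≤ ∑ j ∈ S, (2 / (1 - r)) * z j ^ 2 * (2 / (1 - r)) := by
          gcongr with j _
          exact sum_pow_natAbs_le hr0 hr1 F j
      _ = _ := by
          rw [Finset.mul_sum]
          refine Finset.sum_congr rfl fun j _ => ?_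
          ring
  have hcomm : ∑ m ∈ F, ∑ j ∈ S, ∑ k ∈ S, r ^ (m - j).natAbs * r ^ (m - k).natAbs * (y k ^ 2) =
      ∑ m ∈ F, ∑ j ∈ S, ∑ k ∈ S, r ^ (m - j).natAbs * r ^ (m - k).natAbs * (y j ^ 2) := by
    refine Finset.sum_congr rfl fun m _ => ?_
    rw [Finset.sum_comm]
    refine Finset.sum_congr rfl fun j _ => Finset.sum_congr rfl fun k _ => ?_
    ring
  calc ∑ m ∈ F, ∑ j ∈ S, ∑ k ∈ S, r ^ (m - j).natAbs * r ^ (m - k).natAbs * (x j * y k)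
      ≤ ∑ m ∈ F, ∑ j ∈ S, ∑ k ∈ S, (r ^ (m - j).natAbs * r ^ (m - k).natAbs * (x j ^ 2) / 2 +
          r ^ (m - j).natAbs * r ^ (m - k).natAbs * (y k ^ 2) / 2) := by
        gcongr with m _ j _ k _
        have h0 : 0 ≤ r ^ (m - j).natAbs * r ^ (m - k).natAbs := by positivity
        nlinarith [mul_nonneg h0 (sq_nonneg (x j - y k))]
    _ ≤ _ := by
        simp only [Finset.sum_add_distrib, ← Finset.sum_div]
        rw [hcomm]
        have h1 := key x
        have h2 := key y
        linarith

section Hilbert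

variable {H : Type*} [NormedAddCommGroup H] [InnerProductSpace ℂ H]

/-- A decreasing chain of symmetric projections indexed by `ℤ`. -/
structure ProjChain (E : ℤ → H →L[ℂ] H) : Prop where
  symm : ∀ j f g, inner ℂ (E j f) g = inner ℂ f (E j g)
  left : ∀ i j, i ≤ j → ∀ f, E i (E j f) = E j f
  right : ∀ i j, i ≤ j → ∀ f, E j (E i f) = E j f

namespace ProjChain

variable {E : ℤ → H →L[ℂ] H} (hE : ProjChain E)
include hE

lemma diff_idem {i j : ℤ} (hij : i ≤ j) (f : H) :
    E i (E i f - E j f) - E j (E i f - E j f) = E i f - E j f := by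
  simp [map_sub, hE.left i i le_rfl, hE.left i j hij, hE.right i j hij, hE.left j j le_rfl]

lemma inner_diff {i j : ℤ} (hij : i ≤ j) (f : H) :
    inner ℂ (E i f - E j f) f = ((‖E i f - E j f‖ ^ 2 : ℝ) : ℂ) := by
  conv_lhs => rw [← hE.diff_idem hij f]
  rw [inner_sub_left, hE.symm, hE.symm, ← inner_sub_right, inner_self_eq_norm_sq_to_K]
  norm_cast

lemma norm_diff_le {i j : ℤ} (hij : i ≤ j) (f : H) : ‖E i f - E j f‖ ≤ ‖f‖ := by
  have h := hE.inner_diff hij f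
  have h2 := norm_inner_le_norm (𝕜 := ℂ) (E i f - E j f) f
  rw [h, Complex.norm_real, Real.norm_of_nonneg (by positivity)] at h2
  rcases eq_or_lt_of_le (norm_nonneg (E i f - E j f)) with h0 | h0
  · rw [← h0]; positivity
  · nlinarith

lemma sum_sq_le (J : ℕ) (f : H) :
    ∑ j ∈ Finset.Ioc (-(J : ℤ)) J, ‖E (j - 1) f - E j f‖ ^ 2 ≤ ‖f‖ ^ 2 := by
  have hJ : -(J : ℤ) ≤ J := by omega
  have htel := sum_diff_eq E J f
  have h1 : ((∑ j ∈ Finset.Ioc (-(J : ℤ)) J, ‖E (j - 1) f - E j f‖ ^ 2 : ℝ) : ℂ) =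
      ((‖E (-J) f - E J f‖ ^ 2 : ℝ) : ℂ) := by
    rw [← hE.inner_diff hJ, ← htel, sum_inner, Complex.ofReal_sum]
    refine Finset.sum_congr rfl fun j _ => ?_
    rw [hE.inner_diff (by omega)]
  rw [Complex.ofReal_inj] at h1
  rw [h1]
  exact pow_le_pow_left₀ (norm_nonneg _) (hE.norm_diff_le hJ f) 2
where
  sum_diff_eq (E : ℤ → H →L[ℂ] H) (J : ℕ) (f : H) :
      ∑ j ∈ Finset.Ioc (-(J : ℤ)) J, (E (j - 1) f - E j f) = E (-J) f - E J f := by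
    have : ∀ a : ℤ, ∀ N : ℕ, ∑ j ∈ Finset.Ioc a (a + N), (E (j - 1) f - E j f)
        = E a f - E (a + N) f := by
      intro a N
      induction N with
      | zero => simp
      | succ N ih =>
        have : Finset.Ioc a (a + (N + 1 : ℕ)) = insert (a + N + 1) (Finset.Ioc a (a + N)) := by
          ext z; simp; omega
        rw [this, Finset.sum_insert (by simp), ih]
        push_cast
        rw [← add_assoc, show a + N + 1 - 1 = a + N by ring]
        abel
    have h := this (-J) (2 * J)
    have e : -(J : ℤ) + ((2 * J : ℕ) : ℤ) = J := by push_cast; ring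
    rwa [e] at h

end ProjChain

/-- Scale-localized bounds for an operator of scale `m` relative to a chain of projections. -/
def ScaleBound (E : ℤ → H →L[ℂ] H) (q c : ℝ) (m : ℤ) (A : H →L[ℂ] H) : Prop :=
  (∀ j, m ≤ j → ∀ f, ‖A (E j f)‖ ≤ c * q ^ (m - j).natAbs * ‖f‖) ∧
    (∀ j, j ≤ m → ∀ f, ‖A (f - E j f)‖ ≤ c * q ^ (m - j).natAbs * ‖f‖)

lemma ScaleBound.diff {E : ℤ → H →L[ℂ] H} (hE : ProjChain E) {q c : ℝ} (hq0 : 0 < q)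
    (hq1 : q < 1) (hc : 0 ≤ c) {m : ℤ} {A : H →L[ℂ] H} (hA : ScaleBound E q c m A) (j : ℤ)
    (f : H) :
    ‖A (E (j - 1) f - E j f)‖ ≤ c / q * q ^ (m - j).natAbs * ‖E (j - 1) f - E j f‖ := by
  set d := E (j - 1) f - E j f with hd
  have e1 : E (j - 1) d = d := by
    simp [hd, map_sub, hE.left (j - 1) (j - 1) le_rfl, hE.left (j - 1) j (by omega)]
  have e2 : d - E j d = d := by
    simp [hd, map_sub, hE.right (j - 1) j (by omega), hE.left j j le_rfl]
  rcases le_or_gt j m with h | h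
  · have := hA.2 j h d
    rw [e2] at this
    refine this.trans ?_
    gcongr
    rw [le_div_iff₀ hq0]; nlinarith
  · have := hA.1 (j - 1) (by omega) d
    rw [e1] at this
    refine this.trans (le_of_eq ?_)
    have : (m - j).natAbs = (m - (j - 1)).natAbs + 1 := by omega
    rw [this, pow_succ]
    field_simp

lemma ScaleBound.far {E : ℤ → H →L[ℂ] H} {q c : ℝ} {m : ℤ} {A : H →L[ℂ] H}
    (hA : ScaleBound E q c m A) {J : ℕ} (hJ : m.natAbs ≤ J) (f : H) :
    ‖A (f - (E (-J) f - E J f))‖ ≤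
      c * (q ^ (m - (-J)).natAbs + q ^ (m - J).natAbs) * ‖f‖ := by
  have e : f - (E (-J) f - E J f) = (f - E (-J) f) + E J f := by abel
  rw [e, map_add]
  refine (norm_add_le _ _).trans ?_
  have h1 := hA.2 (-J) (by omega) f
  have h2 := hA.1 J (by omega) f
  linarith

variable [CompleteSpace H]

lemma inner_sum_le {E : ℤ → H →L[ℂ] H} (hE : ProjChain E) {r c : ℝ} (hr0 : 0 < r) (hr1 : r < 1)
    (hc : 0 ≤ c) (F : Finset ℤ) (A : ℤ → H →L[ℂ] H)
    (hA : ∀ m ∈ F, ScaleBound E (r ^ 2) c m (A m))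
    (hA' : ∀ m ∈ F, ScaleBound E (r ^ 2) c m (ContinuousLinearMap.adjoint (A m))) (f g : H) :
    ‖inner ℂ (∑ m ∈ F, A m f) g‖ ≤
      c / r ^ 2 * (2 / (1 - r)) ^ 2 * ((‖f‖ ^ 2 + ‖g‖ ^ 2) / 2) := by
  have hq0 : 0 < r ^ 2 := by positivity
  have hq1 : r ^ 2 < 1 := by nlinarith
  have hmain : ∀ J : ℕ, ‖inner ℂ (∑ m ∈ F, A m (E (-J) f - E J f)) (E (-J) g - E J g)‖ ≤
      c / r ^ 2 * (2 / (1 - r)) ^ 2 * ((‖f‖ ^ 2 + ‖g‖ ^ 2) / 2) := by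
    intro J
    rw [← ProjChain.sum_sq_le.sum_diff_eq E J f, ← ProjChain.sum_sq_le.sum_diff_eq E J g]
    set S := Finset.Ioc (-(J : ℤ)) J
    set x : ℤ → ℝ := fun j => ‖E (j - 1) f - E j f‖
    set y : ℤ → ℝ := fun j => ‖E (j - 1) g - E j g‖
    calc ‖inner ℂ (∑ m ∈ F, A m (∑ j ∈ S, (E (j - 1) f - E j f)))
            (∑ k ∈ S, (E (k - 1) g - E k g))‖
        = ‖∑ m ∈ F, ∑ j ∈ S, ∑ k ∈ S,
            inner ℂ (A m (E (j - 1) f - E j f)) (E (k - 1) g - E k g)‖ := by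
          simp only [map_sum, sum_inner, inner_sum]
          rw [Finset.sum_comm]
          refine congrArg _ (Finset.sum_congr rfl fun m _ => ?_)
          rw [Finset.sum_comm]
      _ ≤ ∑ m ∈ F, ∑ j ∈ S, ∑ k ∈ S,
            ‖inner ℂ (A m (E (j - 1) f - E j f)) (E (k - 1) g - E k g)‖ := by
          refine (norm_sum_le _ _).trans (Finset.sum_le_sum fun m _ => ?_)
          refine (norm_sum_le _ _).trans (Finset.sum_le_sum fun j _ => ?_)
          exact norm_sum_le _ _
      _ ≤ ∑ m ∈ F, ∑ j ∈ S, ∑ k ∈ S,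
            c / r ^ 2 * (r ^ (m - j).natAbs * r ^ (m - k).natAbs * (x j * y k)) := by
          refine Finset.sum_le_sum fun m hm => Finset.sum_le_sum fun j _ =>
            Finset.sum_le_sum fun k _ => ?_
          have b1 : ‖inner ℂ (A m (E (j - 1) f - E j f)) (E (k - 1) g - E k g)‖ ≤
              c / r ^ 2 * (x j * y k) * (r ^ (m - j).natAbs) ^ 2 := by
            refine (norm_inner_le_norm _ _).trans ?_
            have := (hA m hm).diff hE hq0 hq1 hc j f
            calc _ ≤ (c / r ^ 2 * (r ^ 2) ^ (m - j).natAbs * x j) * y k := by gcongr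
              _ = _ := by rw [← pow_mul, ← pow_mul, mul_comm 2]; ring
          have b2 : ‖inner ℂ (A m (E (j - 1) f - E j f)) (E (k - 1) g - E k g)‖ ≤
              c / r ^ 2 * (x j * y k) * (r ^ (m - k).natAbs) ^ 2 := by
            rw [← ContinuousLinearMap.adjoint_inner_right]
            refine (norm_inner_le_norm _ _).trans ?_
            have := (hA' m hm).diff hE hq0 hq1 hc k g
            calc _ ≤ x j * (c / r ^ 2 * (r ^ 2) ^ (m - k).natAbs * y k) := by gcongr
              _ = _ := by rw [← pow_mul, ← pow_mul, mul_comm 2]; ring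
          have hD : 0 ≤ c / r ^ 2 * (x j * y k) := by positivity
          have ha : 0 ≤ r ^ (m - j).natAbs := by positivity
          have hb : 0 ≤ r ^ (m - k).natAbs := by positivity
          rcases le_total (r ^ (m - j).natAbs) (r ^ (m - k).natAbs) with h | h
          · refine b1.trans ?_
            calc _ ≤ c / r ^ 2 * (x j * y k) * (r ^ (m - j).natAbs * r ^ (m - k).natAbs) := by
                  gcongr; nlinarith
              _ = _ := by ring
          · refine b2.trans ?_
            calc _ ≤ c / r ^ 2 * (x j * y k) * (r ^ (m - j).natAbs * r ^ (m - k).natAbs) := by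
                  gcongr; nlinarith
              _ = _ := by ring
      _ = c / r ^ 2 * ∑ m ∈ F, ∑ j ∈ S, ∑ k ∈ S,
            (r ^ (m - j).natAbs * r ^ (m - k).natAbs * (x j * y k)) := by
          simp only [Finset.mul_sum]
      _ ≤ c / r ^ 2 * ((2 / (1 - r)) ^ 2 * ((∑ j ∈ S, x j ^ 2 + ∑ k ∈ S, y k ^ 2) / 2)) := by
          gcongr
          exact triple_sum_le hr0.le hr1 F S x y
      _ ≤ c / r ^ 2 * ((2 / (1 - r)) ^ 2 * ((‖f‖ ^ 2 + ‖g‖ ^ 2) / 2)) := by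
          have h1 := hE.sum_sq_le J f
          have h2 := hE.sum_sq_le J g
          gcongr
      _ = _ := by ring
  set B := c / r ^ 2 * (2 / (1 - r)) ^ 2 * ((‖f‖ ^ 2 + ‖g‖ ^ 2) / 2)
  let err : ℕ → ℝ := fun J => ∑ m ∈ F,
    c * ((r ^ 2) ^ (m - (-J)).natAbs + (r ^ 2) ^ (m - J).natAbs) * ‖f‖ * ‖g‖
  have herr : Tendsto (fun J => B + 2 * err J) atTop (𝓝 (B + 2 * 0)) := by
    refine Tendsto.const_add _ (Tendsto.const_mul _ ?_)
    rw [show (0 : ℝ) = ∑ m ∈ F, c * (0 + 0) * ‖f‖ * ‖g‖ by simp]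
    refine tendsto_finsetSum _ fun m _ => ?_
    refine Tendsto.mul_const _ (Tendsto.mul_const _ (Tendsto.const_mul _ (Tendsto.add ?_ ?_)))
    · refine (tendsto_pow_atTop_nhds_zero_of_lt_one hq0.le hq1).comp ?_
      refine tendsto_atTop.2 fun b => ?_
      filter_upwards [eventually_ge_atTop (b + m.natAbs)] with J hJ
      omega
    · refine (tendsto_pow_atTop_nhds_zero_of_lt_one hq0.le hq1).comp ?_
      refine tendsto_atTop.2 fun b => ?_
      filter_upwards [eventually_ge_atTop (b + m.natAbs)] with J hJ
      omega
  rw [mul_zero, add_zero] at herr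
  refine ge_of_tendsto herr ?_
  filter_upwards [eventually_ge_atTop (∑ m ∈ F, m.natAbs)] with J hJ
  have hmJ : ∀ m ∈ F, m.natAbs ≤ J := fun m hm =>
    (Finset.single_le_sum (f := fun m : ℤ => m.natAbs) (fun _ _ => Nat.zero_le _) hm).trans hJ
  set P := E (-J) f - E J f
  set Q := E (-J) g - E J g
  have hsplit : inner ℂ (∑ m ∈ F, A m f) g = inner ℂ (∑ m ∈ F, A m P) Q +
      ∑ m ∈ F, inner ℂ (A m (f - P)) g + ∑ m ∈ F, inner ℂ (A m P) (g - Q) := by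
    simp only [sum_inner, map_sub, inner_sub_left, inner_sub_right, Finset.sum_sub_distrib]
    ring
  rw [hsplit]
  have e1 : ‖∑ m ∈ F, inner ℂ (A m (f - P)) g‖ ≤ err J := by
    refine (norm_sum_le _ _).trans (Finset.sum_le_sum fun m hm => ?_)
    refine (norm_inner_le_norm _ _).trans ?_
    have := (hA m hm).far (hmJ m hm) f
    gcongr
  have e2 : ‖∑ m ∈ F, inner ℂ (A m P) (g - Q)‖ ≤ err J := by
    refine (norm_sum_le _ _).trans (Finset.sum_le_sum fun m hm => ?_)
    rw [← ContinuousLinearMap.adjoint_inner_right]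
    refine (norm_inner_le_norm _ _).trans ?_
    have := (hA' m hm).far (hmJ m hm) g
    have hP : ‖P‖ ≤ ‖f‖ := hE.norm_diff_le (by omega) f
    calc _ ≤ ‖f‖ * (c * ((r ^ 2) ^ (m - (-J)).natAbs + (r ^ 2) ^ (m - J).natAbs) * ‖g‖) := by
          gcongr
      _ = _ := by ring
  calc _ ≤ ‖inner ℂ (∑ m ∈ F, A m P) Q‖ + ‖∑ m ∈ F, inner ℂ (A m (f - P)) g‖ +
        ‖∑ m ∈ F, inner ℂ (A m P) (g - Q)‖ := norm_add₃_le
    _ ≤ B + err J + err J := add_le_add (add_le_add (hmain J) e1) e2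
    _ = _ := by ring

/-- Almost orthogonality: a finite sum of operators, each localized at its own scale relative to
a chain of projections, is bounded uniformly in the number of summands. -/
theorem norm_sum_le_of_scaleBound {E : ℤ → H →L[ℂ] H} (hE : ProjChain E) {r c : ℝ} (hr0 : 0 < r)
    (hr1 : r < 1) (hc : 0 ≤ c) (F : Finset ℤ) (A : ℤ → H →L[ℂ] H)
    (hA : ∀ m ∈ F, ScaleBound E (r ^ 2) c m (A m))
    (hA' : ∀ m ∈ F, ScaleBound E (r ^ 2) c m (ContinuousLinearMap.adjoint (A m))) (f : H) :
    ‖∑ m ∈ F, A m f‖ ≤ (2 / (1 - r)) ^ 2 / r ^ 2 * c * ‖f‖ := by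
  set u := ∑ m ∈ F, A m f with hu
  rcases eq_or_ne f 0 with rfl | hf
  · simp [hu]
  rcases eq_or_ne u 0 with h0 | h0
  · rw [h0, norm_zero]; positivity
  have hfn : 0 < ‖f‖ := norm_pos_iff.2 hf
  have hun : 0 < ‖u‖ := norm_pos_iff.2 h0
  have h := inner_sum_le hE hr0 hr1 hc F A hA hA' f (((‖f‖ / ‖u‖ : ℝ) : ℂ) • u)
  rw [← hu, inner_smul_right, inner_self_eq_norm_sq_to_K, norm_smul, norm_mul, norm_pow,
    Complex.norm_real, Real.norm_of_nonneg (by positivity)] at h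
  simp only [Complex.coe_algebraMap, Complex.norm_real, norm_norm] at h
  rw [show ‖f‖ / ‖u‖ * ‖u‖ ^ 2 = ‖u‖ * ‖f‖ by field_simp,
    show ‖f‖ / ‖u‖ * ‖u‖ = ‖f‖ by field_simp] at h
  have : ‖u‖ * ‖f‖ ≤ (2 / (1 - r)) ^ 2 / r ^ 2 * c * ‖f‖ * ‖f‖ := by
    refine h.trans (le_of_eq ?_); ring
  exact le_of_mul_le_mul_right this hfn

end Hilbert

/-! ### Integral operators with bounded kernels of finite range -/

section Kernel

variable {n : ℕ}

/-- The integral operator with kernel `a`. -/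
def kop (a : Rn n → Rn n → ℂ) (f : Rn n → ℂ) (x : Rn n) : ℂ := ∫ y, a x y * f y

/-- The adjoint kernel. -/
def adj (a : Rn n → Rn n → ℂ) (x y : Rn n) : ℂ := (starRingEnd ℂ) (a y x)

/-- Bounded measurable kernels supported near the diagonal. -/
structure FinRange (a : Rn n → Rn n → ℂ) : Prop where
  meas : Measurable (Function.uncurry a)
  bdd : ∃ M R : ℝ, ∀ x y, ‖a x y‖ ≤ M ∧ (R < ‖x - y‖ → a x y = 0)

lemma adj_adj (a : Rn n → Rn n → ℂ) : adj (adj a) = a := by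
  funext x y; simp [adj]

lemma FinRange.adj {a : Rn n → Rn n → ℂ} (ha : FinRange a) : FinRange (adj a) := by
  refine ⟨?_, ?_⟩
  · exact Complex.continuous_conj.measurable.comp (ha.meas.comp measurable_swap)
  · obtain ⟨M, R, h⟩ := ha.bdd
    refine ⟨M, R, fun x y => ⟨by simpa [JumpNonosc.adj] using (h y x).1, fun hxy => ?_⟩⟩
    rw [norm_sub_rev] at hxy
    simp [JumpNonosc.adj, (h y x).2 hxy]

lemma FinRange.zero : FinRange (fun _ _ : Rn n => (0 : ℂ)) :=
  ⟨measurable_const, 0, 0, by simp⟩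

lemma FinRange.add {a b : Rn n → Rn n → ℂ} (ha : FinRange a) (hb : FinRange b) :
    FinRange (fun x y => a x y + b x y) := by
  refine ⟨ha.meas.add hb.meas, ?_⟩
  obtain ⟨M, R, h⟩ := ha.bdd
  obtain ⟨M', R', h'⟩ := hb.bdd
  refine ⟨M + M', max R R', fun x y => ⟨(norm_add_le _ _).trans (add_le_add (h x y).1 (h' x y).1),
    fun hxy => ?_⟩⟩
  rw [(h x y).2 ((le_max_left _ _).trans_lt hxy), (h' x y).2 ((le_max_right _ _).trans_lt hxy),
    add_zero]

lemma FinRange.mul_left {a : Rn n → Rn n → ℂ} (ha : FinRange a) {v : Rn n → ℂ}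
    (hv : Measurable v) {B : ℝ} (hB : ∀ x, ‖v x‖ ≤ B) :
    FinRange (fun x y => v x * a x y) := by
  refine ⟨(hv.comp measurable_fst).mul ha.meas, ?_⟩
  obtain ⟨M, R, h⟩ := ha.bdd
  refine ⟨B * M, R, fun x y => ⟨?_, fun hxy => by rw [(h x y).2 hxy, mul_zero]⟩⟩
  rw [norm_mul]
  exact mul_le_mul (hB x) (h x y).1 (norm_nonneg _) ((norm_nonneg _).trans (hB x))

lemma FinRange.const_mul {a : Rn n → Rn n → ℂ} (ha : FinRange a) (c : ℂ) :
    FinRange (fun x y => c * a x y) :=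
  ha.mul_left (v := fun _ => c) measurable_const (B := ‖c‖) fun _ => le_rfl

lemma FinRange.sum {ι : Type*} (F : Finset ι) {a : ι → Rn n → Rn n → ℂ}
    (ha : ∀ i ∈ F, FinRange (a i)) : FinRange (fun x y => ∑ i ∈ F, a i x y) := by
  classical
  induction F using Finset.induction_on with
  | empty => simpa using FinRange.zero
  | insert i F hi ih =>
    simp only [Finset.sum_insert hi]
    exact (ha i (by simp)).add (ih fun j hj => ha j (by simp [hj]))

lemma FinRange.measurable_right {a : Rn n → Rn n → ℂ} (ha : FinRange a) (x : Rn n) :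
    Measurable (a x) := ha.meas.comp measurable_prodMk_left

lemma FinRange.integrable_mul {a : Rn n → Rn n → ℂ} (ha : FinRange a) {f : Rn n → ℂ}
    (hf : LocallyIntegrable f volume) (x : Rn n) : Integrable (fun y => a x y * f y) := by
  obtain ⟨M, R, h⟩ := ha.bdd
  have h1 : IntegrableOn f (Metric.closedBall x R) :=
    hf.integrableOn_isCompact (isCompact_closedBall x R)
  have h2 : IntegrableOn (fun y => a x y * f y) (Metric.closedBall x R) :=
    Integrable.bdd_mul (c := M) h1 (ha.measurable_right x).aestronglyMeasurable
      (Eventually.of_forall fun y => (h x y).1)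
  refine (integrableOn_iff_integrable_of_support_subset fun y hy => ?_).1 h2
  rw [Metric.mem_closedBall, dist_comm, dist_eq_norm]
  by_contra hc
  exact hy (by simp [(h x y).2 (not_le.1 hc)])

lemma locInt {f : Rn n → ℂ} (hf : MemLp f 2 volume) : LocallyIntegrable f volume :=
  hf.locallyIntegrable (by norm_num)

lemma kop_add {a : Rn n → Rn n → ℂ} (ha : FinRange a) {f g : Rn n → ℂ}
    (hf : LocallyIntegrable f volume) (hg : LocallyIntegrable g volume) (x : Rn n) :
    kop a (fun y => f y + g y) x = kop a f x + kop a g x := by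
  simp only [kop, mul_add]
  exact integral_add (ha.integrable_mul hf x) (ha.integrable_mul hg x)

lemma kop_sub {a : Rn n → Rn n → ℂ} (ha : FinRange a) {f g : Rn n → ℂ}
    (hf : LocallyIntegrable f volume) (hg : LocallyIntegrable g volume) (x : Rn n) :
    kop a (fun y => f y - g y) x = kop a f x - kop a g x := by
  simp only [kop, mul_sub]
  exact integral_sub (ha.integrable_mul hf x) (ha.integrable_mul hg x)

lemma kop_smul (a : Rn n → Rn n → ℂ) (c : ℂ) (f : Rn n → ℂ) (x : Rn n) :
    kop a (fun y => c * f y) x = c * kop a f x := by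
  simp only [kop, ← integral_const_mul]
  congr 1; funext y; ring

lemma kop_finset_sum_fun {ι : Type*} (F : Finset ι) {a : Rn n → Rn n → ℂ} (ha : FinRange a)
    {f : ι → Rn n → ℂ} (hf : ∀ i ∈ F, LocallyIntegrable (f i) volume) (x : Rn n) :
    kop a (fun y => ∑ i ∈ F, f i y) x = ∑ i ∈ F, kop a (f i) x := by
  simp only [kop, Finset.mul_sum]
  exact integral_finsetSum _ fun i hi => ha.integrable_mul (hf i hi) x

lemma kop_finset_sum {ι : Type*} (F : Finset ι) {a : ι → Rn n → Rn n → ℂ}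
    (ha : ∀ i ∈ F, FinRange (a i)) {f : Rn n → ℂ} (hf : LocallyIntegrable f volume) (x : Rn n) :
    kop (fun x y => ∑ i ∈ F, a i x y) f x = ∑ i ∈ F, kop (a i) f x := by
  simp only [kop, Finset.sum_mul]
  exact integral_finsetSum _ fun i hi => (ha i hi).integrable_mul hf x

lemma kop_mul_left (a : Rn n → Rn n → ℂ) (v : Rn n → ℂ) (f : Rn n → ℂ) (x : Rn n) :
    kop (fun x y => v x * a x y) f x = v x * kop a f x := by
  simp only [kop, ← integral_const_mul]
  congr 1; funext y; ring

lemma kop_congr {a : Rn n → Rn n → ℂ} {f g : Rn n → ℂ} (h : f =ᵐ[volume] g) :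
    kop a f = kop a g := by
  funext x
  refine integral_congr_ae ?_
  filter_upwards [h] with y hy
  rw [hy]

lemma aestronglyMeasurable_kop {a : Rn n → Rn n → ℂ} (ha : FinRange a) {f : Rn n → ℂ}
    (hf : AEStronglyMeasurable f volume) : AEStronglyMeasurable (kop a f) volume := by
  have : AEStronglyMeasurable (fun z : Rn n × Rn n => a z.1 z.2 * f z.2)
      ((volume : Measure (Rn n)).prod volume) :=
    ha.meas.aestronglyMeasurable.mul hf.comp_snd
  exact this.integral_prod_right'

/-- Weighted Jensen inequality for `lintegral`. -/
lemma lintegral_mul_rpow_le {α : Type*} [MeasurableSpace α] {μ : Measure α} {k u : α → ℝ≥0∞}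
    (hk : AEMeasurable k μ) (hu : AEMeasurable u μ) {q : ℝ} (hq : 1 ≤ q) :
    (∫⁻ y, k y * u y ∂μ) ^ q ≤ (∫⁻ y, k y ∂μ) ^ (q - 1) * ∫⁻ y, k y * u y ^ q ∂μ := by
  rcases eq_or_lt_of_le hq with rfl | hq1
  · simp
  have hq0 : 0 < q := by linarith
  have hc : (q / (q - 1)).HolderConjugate q :=
    (Real.HolderConjugate.conjExponent hq1).symm
  have h := ENNReal.lintegral_mul_le_Lp_mul_Lq μ hc (f := fun y => k y ^ (1 / (q / (q - 1))))
    (g := fun y => k y ^ (1 / q) * u y) (hk.pow_const _) ((hk.pow_const _).mul hu)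
  have hs : 1 / (q / (q - 1)) + 1 / q = 1 := by
    field_simp
    ring
  have hp0 : 0 < q / (q - 1) := div_pos hq0 (by linarith)
  have e1 : ∀ y, ((fun y => k y ^ (1 / (q / (q - 1)))) * fun y => k y ^ (1 / q) * u y) y
      = k y * u y := by
    intro y
    simp only [Pi.mul_apply]
    rw [← mul_assoc, ← ENNReal.rpow_add_of_nonneg _ _ (by positivity) (by positivity), hs,
      ENNReal.rpow_one]
  have e2 : ∀ y, (k y ^ (1 / (q / (q - 1)))) ^ (q / (q - 1)) = k y := by
    intro y
    rw [← ENNReal.rpow_mul, one_div_mul_cancel hp0.ne', ENNReal.rpow_one]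
  have e3 : ∀ y, (k y ^ (1 / q) * u y) ^ q = k y * u y ^ q := by
    intro y
    rw [ENNReal.mul_rpow_of_nonneg _ _ hq0.le, ← ENNReal.rpow_mul, one_div_mul_cancel hq0.ne',
      ENNReal.rpow_one]
  simp only [e1, e2, e3] at h
  calc _ ≤ ((∫⁻ y, k y ∂μ) ^ (1 / (q / (q - 1))) * (∫⁻ y, k y * u y ^ q ∂μ) ^ (1 / q)) ^ q := by
        gcongr
    _ = _ := by
        rw [ENNReal.mul_rpow_of_nonneg _ _ hq0.le, ← ENNReal.rpow_mul, ← ENNReal.rpow_mul,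
          one_div_mul_cancel hq0.ne', ENNReal.rpow_one]
        congr 2
        field_simp

/-- Schur's test on `ℝ≥0∞`-valued functions. -/
lemma schur_lintegral {k : Rn n → Rn n → ℝ≥0∞} (hk : Measurable (Function.uncurry k))
    {u : Rn n → ℝ≥0∞} (hu : AEMeasurable u volume) {q : ℝ} (hq : 1 ≤ q) {B : ℝ≥0∞}
    (hrow : ∀ x, ∫⁻ y, k x y ≤ B) (hcol : ∀ y, ∫⁻ x, k x y ≤ B) :
    ∫⁻ x, (∫⁻ y, k x y * u y) ^ q ≤ B ^ q * ∫⁻ y, u y ^ q := by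
  have hkx : ∀ x, Measurable (k x) := fun x => hk.comp measurable_prodMk_left
  have hq1 : 0 ≤ q - 1 := by linarith
  calc ∫⁻ x, (∫⁻ y, k x y * u y) ^ q
      ≤ ∫⁻ x, B ^ (q - 1) * ∫⁻ y, k x y * u y ^ q := by
        refine lintegral_mono fun x => ?_
        refine (lintegral_mul_rpow_le (hkx x).aemeasurable hu hq).trans ?_
        gcongr
        exact hrow x
    _ = B ^ (q - 1) * ∫⁻ x, ∫⁻ y, k x y * u y ^ q := by
        rw [lintegral_const_mul'']
        have : AEMeasurable (fun z : Rn n × Rn n => k z.1 z.2 * u z.2 ^ q)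
          ((volume : Measure (Rn n)).prod volume) :=
          hk.aemeasurable.mul ((hu.pow_const q).comp_snd)
        exact this.lintegral_prod_right'
    _ = B ^ (q - 1) * ∫⁻ y, ∫⁻ x, k x y * u y ^ q := by
        rw [lintegral_lintegral_swap]
        exact hk.aemeasurable.mul ((hu.pow_const q).comp_snd)
    _ = B ^ (q - 1) * ∫⁻ y, (∫⁻ x, k x y) * u y ^ q := by
        congr 1
        refine lintegral_congr fun y => ?_
        rw [lintegral_mul_const]
        exact hk.comp measurable_prodMk_right
    _ ≤ B ^ (q - 1) * ∫⁻ y, B * u y ^ q := by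
        gcongr with y
        exact hcol y
    _ = B ^ q * ∫⁻ y, u y ^ q := by
        rw [lintegral_const_mul'' _ (hu.pow_const q), ← mul_assoc]
        congr 1
        nth_rewrite 2 [← ENNReal.rpow_one B]
        rw [← ENNReal.rpow_add_of_nonneg _ _ hq1 zero_le_one, sub_add_cancel]

lemma enorm_kop_le (a : Rn n → Rn n → ℂ) (f : Rn n → ℂ) (x : Rn n) :
    ‖kop a f x‖ₑ ≤ ∫⁻ y, ‖a x y‖ₑ * ‖f y‖ₑ := by
  refine (enorm_integral_le_lintegral_enorm _).trans (le_of_eq ?_)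
  simp only [enorm_mul]

/-- Schur's test for integral operators. -/
lemma eLpNorm_kop_le {a : Rn n → Rn n → ℂ} (ha : Measurable (Function.uncurry a))
    {f : Rn n → ℂ} (hf : AEStronglyMeasurable f volume) {q : ℝ≥0∞} (hq : 1 ≤ q) (hq' : q ≠ ⊤)
    {B : ℝ≥0∞} (hrow : ∀ x, ∫⁻ y, ‖a x y‖ₑ ≤ B) (hcol : ∀ y, ∫⁻ x, ‖a x y‖ₑ ≤ B) :
    eLpNorm (kop a f) q volume ≤ B * eLpNorm f q volume := by
  have hq0 : q ≠ 0 := (zero_lt_one.trans_le hq).ne'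
  have hr : 1 ≤ q.toReal := by
    rw [← ENNReal.toReal_one]; exact ENNReal.toReal_mono hq' hq
  have hr0 : 0 < q.toReal := by linarith
  rw [eLpNorm_eq_lintegral_rpow_enorm_toReal hq0 hq', eLpNorm_eq_lintegral_rpow_enorm_toReal hq0 hq']
  calc (∫⁻ x, ‖kop a f x‖ₑ ^ q.toReal) ^ (1 / q.toReal)
      ≤ (B ^ q.toReal * ∫⁻ y, ‖f y‖ₑ ^ q.toReal) ^ (1 / q.toReal) := by
        gcongr
        refine le_trans (lintegral_mono fun x => ?_)
          (schur_lintegral (k := fun x y => ‖a x y‖ₑ) ha.enorm hf.enorm hr hrow hcol)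
        gcongr
        exact enorm_kop_le a f x
    _ = _ := by
        rw [ENNReal.mul_rpow_of_nonneg _ _ (by positivity), ← ENNReal.rpow_mul,
          mul_one_div_cancel hr0.ne', ENNReal.rpow_one]

lemma FinRange.exists_bound {a : Rn n → Rn n → ℂ} (ha : FinRange a) :
    ∃ B : ℝ≥0∞, B ≠ ⊤ ∧ (∀ x, ∫⁻ y, ‖a x y‖ₑ ≤ B) ∧ (∀ y, ∫⁻ x, ‖a x y‖ₑ ≤ B) := by
  obtain ⟨M, R, h⟩ := ha.bdd
  have hvol : ∀ x : Rn n, volume (Metric.closedBall x R) = volume (Metric.closedBall (0 : Rn n) R) :=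
    fun x => Measure.addHaar_closedBall_center _ _ _
  have key : ∀ (b : Rn n → ℂ) (x : Rn n), (∀ y, ‖b y‖ ≤ M ∧ (R < ‖x - y‖ → b y = 0)) →
      ∫⁻ y, ‖b y‖ₑ ≤ ENNReal.ofReal M * volume (Metric.closedBall (0 : Rn n) R) := by
    intro b x hb
    rw [← hvol x, ← lintegral_indicator_const measurableSet_closedBall]
    refine lintegral_mono fun y => ?_
    by_cases hy : y ∈ Metric.closedBall x R
    · rw [indicator_of_mem hy, ← ofReal_norm]
      exact ENNReal.ofReal_le_ofReal (hb y).1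
    · rw [Metric.mem_closedBall, dist_comm, dist_eq_norm, not_le] at hy
      simp [(hb y).2 hy]
  refine ⟨ENNReal.ofReal M * volume (Metric.closedBall (0 : Rn n) R),
    ENNReal.mul_ne_top ENNReal.ofReal_ne_top measure_closedBall_lt_top.ne,
    fun x => key (a x) x (h x), fun y => key (fun x => a x y) y fun x => ?_⟩
  rw [norm_sub_rev]
  exact h x y

lemma memLp_kop {a : Rn n → Rn n → ℂ} (ha : FinRange a) {f : Rn n → ℂ} {q : ℝ≥0∞} (hq : 1 ≤ q)
    (hq' : q ≠ ⊤) (hf : MemLp f q volume) : MemLp (kop a f) q volume := by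
  obtain ⟨B, hB, hrow, hcol⟩ := ha.exists_bound
  refine ⟨aestronglyMeasurable_kop ha hf.1, ?_⟩
  exact (eLpNorm_kop_le ha.meas hf.1 hq hq' hrow hcol).trans_lt
    (ENNReal.mul_lt_top hB.lt_top hf.2)

/-- Fubini: the bilinear pairing of `kop a f` with `g`. -/
lemma integral_kop_mul {a : Rn n → Rn n → ℂ} (ha : FinRange a) {f g : Rn n → ℂ}
    (hf : MemLp f 2 volume) (hg : MemLp g 2 volume) :
    ∫ x, kop a f x * g x = ∫ y, f y * ∫ x, a x y * g x := by
  have hmeas : AEStronglyMeasurable (fun z : Rn n × Rn n => a z.1 z.2 * f z.2 * g z.1)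
      ((volume : Measure (Rn n)).prod volume) :=
    (ha.meas.aestronglyMeasurable.mul hf.1.comp_snd).mul hg.1.comp_fst
  obtain ⟨B, hB, hrow, hcol⟩ := ha.exists_bound
  have hint : Integrable (Function.uncurry fun x y => a x y * f y * g x)
      ((volume : Measure (Rn n)).prod volume) := by
    refine ⟨hmeas, ?_⟩
    rw [hasFiniteIntegral_iff_enorm]
    change ∫⁻ z : Rn n × Rn n, ‖a z.1 z.2 * f z.2 * g z.1‖ₑ ∂_ < ⊤
    rw [lintegral_prod _ hmeas.enorm]
    simp only [enorm_mul]
    calc ∫⁻ x, ∫⁻ y, ‖a x y‖ₑ * ‖f y‖ₑ * ‖g x‖ₑ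
        = ∫⁻ x, (∫⁻ y, ‖a x y‖ₑ * ‖f y‖ₑ) * ‖g x‖ₑ := by
          refine lintegral_congr fun x => ?_
          exact lintegral_mul_const'' _ ((ha.measurable_right x).enorm.aemeasurable.mul hf.1.enorm)
      _ ≤ (∫⁻ x, (∫⁻ y, ‖a x y‖ₑ * ‖f y‖ₑ) ^ (2 : ℝ)) ^ (1 / (2 : ℝ)) *
            (∫⁻ x, ‖g x‖ₑ ^ (2 : ℝ)) ^ (1 / (2 : ℝ)) := by
          refine ENNReal.lintegral_mul_le_Lp_mul_Lq volume Real.HolderConjugate.two_two ?_ hg.1.enorm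
          have : AEMeasurable (fun z : Rn n × Rn n => ‖a z.1 z.2‖ₑ * ‖f z.2‖ₑ)
            ((volume : Measure (Rn n)).prod volume) :=
            ha.meas.enorm.aemeasurable.mul hf.1.comp_snd.enorm
          exact this.lintegral_prod_right'
      _ ≤ (B ^ (2 : ℝ) * ∫⁻ y, ‖f y‖ₑ ^ (2 : ℝ)) ^ (1 / (2 : ℝ)) *
            (∫⁻ x, ‖g x‖ₑ ^ (2 : ℝ)) ^ (1 / (2 : ℝ)) := by
          gcongr
          exact schur_lintegral (k := fun x y => ‖a x y‖ₑ) ha.meas.enorm hf.1.enorm (by norm_num)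
            hrow hcol
      _ < ⊤ := by
          have h1 := lintegral_rpow_enorm_lt_top_of_eLpNorm_lt_top (by norm_num) (by norm_num) hf.2
          have h2 := lintegral_rpow_enorm_lt_top_of_eLpNorm_lt_top (by norm_num) (by norm_num) hg.2
          simp only [ENNReal.toReal_ofNat] at h1 h2
          refine ENNReal.mul_lt_top (ENNReal.rpow_lt_top_of_nonneg (by norm_num) ?_)
            (ENNReal.rpow_lt_top_of_nonneg (by norm_num) h2.ne)
          exact (ENNReal.mul_lt_top (ENNReal.rpow_lt_top_of_nonneg (by norm_num) hB) h1).ne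
  calc ∫ x, kop a f x * g x = ∫ x, ∫ y, a x y * f y * g x := by
        congr 1; funext x; rw [kop, integral_mul_const]
    _ = ∫ y, ∫ x, a x y * f y * g x := integral_integral_swap hint
    _ = _ := by
        congr 1; funext y
        rw [← integral_const_mul]
        congr 1; funext x; ring

lemma integral_kop_mul_conj {a : Rn n → Rn n → ℂ} (ha : FinRange a) {f g : Rn n → ℂ}
    (hf : MemLp f 2 volume) (hg : MemLp g 2 volume) :
    ∫ x, kop a f x * (starRingEnd ℂ) (g x) = ∫ y, f y * (starRingEnd ℂ) (kop (adj a) g y) := by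
  rw [integral_kop_mul ha hf (g := fun x => (starRingEnd ℂ) (g x)) hg.star]
  congr 1; funext y
  rw [kop, ← integral_conj]
  simp [adj]

/-- Composition of integral operators. -/
lemma kop_kop {a b : Rn n → Rn n → ℂ} (ha : FinRange a) (hb : FinRange b) {f : Rn n → ℂ}
    (hf : MemLp f 2 volume) (x : Rn n) :
    kop a (kop b f) x = kop (fun x y => ∫ z, b z y * a x z) f x := by
  have hax : MemLp (a x) 2 volume := by
    obtain ⟨M, R, h⟩ := ha.bdd
    have h1 : MemLp (a x) 2 (volume.restrict (Metric.closedBall x R)) := by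
      have : IsFiniteMeasure (volume.restrict (Metric.closedBall x R)) :=
        ⟨by simpa using measure_closedBall_lt_top⟩
      exact MemLp.of_bound (ha.measurable_right x).aestronglyMeasurable M
        (Eventually.of_forall fun y => (h x y).1)
    have h2 := (memLp_indicator_iff_restrict (f := a x) (p := 2) (μ := volume)
      (measurableSet_closedBall (x := x) (ε := R))).2 h1
    rwa [indicator_eq_self.2] at h2
    intro y hy
    rw [Metric.mem_closedBall, dist_comm, dist_eq_norm]
    by_contra hc
    exact hy ((h x y).2 (not_le.1 hc))
  have := integral_kop_mul hb hf hax
  rw [kop]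
  simp only [mul_comm (a x _)]
  rw [this, kop]
  congr 1; funext y
  ring

/-- The bounded operator on `L²` given by a kernel of finite range. -/
def kopL2 (a : Rn n → Rn n → ℂ) (ha : FinRange a) :
    Lp ℂ 2 (volume : Measure (Rn n)) →L[ℂ] Lp ℂ 2 (volume : Measure (Rn n)) :=
  LinearMap.mkContinuous
    { toFun := fun f => (memLp_kop ha (q := 2) (by norm_num) (by norm_num) (Lp.memLp f)).toLp
      map_add' := fun f g => by
        rw [← MemLp.toLp_add]
        refine MemLp.toLp_congr _ _ (Eventually.of_forall fun x => ?_)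
        rw [kop_congr (Lp.coeFn_add f g)]
        exact kop_add ha (locInt (Lp.memLp f)) (locInt (Lp.memLp g)) x
      map_smul' := fun c f => by
        rw [RingHom.id_apply, ← MemLp.toLp_const_smul]
        refine MemLp.toLp_congr _ _ (Eventually.of_forall fun x => ?_)
        rw [kop_congr (Lp.coeFn_smul c f)]
        exact kop_smul a c _ x }
    ha.exists_bound.choose.toReal
    (fun f => by
      obtain ⟨hB, hrow, hcol⟩ := ha.exists_bound.choose_spec
      simp only [LinearMap.coe_mk, AddHom.coe_mk]
      rw [Lp.norm_toLp, Lp.norm_def, ← ENNReal.toReal_mul]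
      refine ENNReal.toReal_mono (ENNReal.mul_ne_top hB (Lp.eLpNorm_ne_top f)) ?_
      exact eLpNorm_kop_le ha.meas (Lp.memLp f).1 (by norm_num) (by norm_num) hrow hcol)

lemma coeFn_kopL2 (a : Rn n → Rn n → ℂ) (ha : FinRange a)
    (f : Lp ℂ 2 (volume : Measure (Rn n))) : kopL2 a ha f =ᵐ[volume] kop a f :=
  MemLp.coeFn_toLp (memLp_kop ha (q := 2) (by norm_num) (by norm_num) (Lp.memLp f))

lemma inner_kopL2 (a : Rn n → Rn n → ℂ) (ha : FinRange a)
    (f g : Lp ℂ 2 (volume : Measure (Rn n))) :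
    inner ℂ (kopL2 (adj a) ha.adj f) g = inner ℂ f (kopL2 a ha g) := by
  rw [L2.inner_def, L2.inner_def]
  have h := integral_kop_mul_conj ha (Lp.memLp g) (Lp.memLp f)
  calc _ = ∫ x, g x * (starRingEnd ℂ) (kop (adj a) f x) := by
        refine integral_congr_ae ?_
        filter_upwards [coeFn_kopL2 (adj a) ha.adj f] with x hx
        rw [RCLike.inner_apply, hx]
    _ = ∫ x, kop a g x * (starRingEnd ℂ) (f x) := h.symm
    _ = _ := by
        refine integral_congr_ae ?_
        filter_upwards [coeFn_kopL2 a ha g] with x hx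
        rw [RCLike.inner_apply, hx]

lemma adjoint_kopL2 (a : Rn n → Rn n → ℂ) (ha : FinRange a) :
    ContinuousLinearMap.adjoint (kopL2 a ha) = kopL2 (adj a) ha.adj :=
  ((ContinuousLinearMap.eq_adjoint_iff _ _).2 (inner_kopL2 a ha)).symm

end Kernel

/-! ### Dyadic cubes and averaging operators -/

section Cubes

variable {n : ℕ}

/-- The index of the dyadic cube of side `2 ^ j` containing `x`. -/
def idx (j : ℤ) (x : Rn n) : Fin n → ℤ := fun i => ⌊x i / (2 : ℝ) ^ j⌋

/-- The volume of a dyadic cube of side `2 ^ j`. -/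
def cubeVol (n : ℕ) (j : ℤ) : ℝ := ((2 : ℝ) ^ j) ^ n

/-- The kernel of the averaging operator over dyadic cubes of side `2 ^ j`. -/
def avgKer (j : ℤ) (x y : Rn n) : ℂ :=
  if idx j y = idx j x then (((cubeVol n j)⁻¹ : ℝ) : ℂ) else 0

/-- Functions constant on the dyadic cubes of side `2 ^ j`. -/
def CubeConst {β : Type*} (j : ℤ) (g : Rn n → β) : Prop := ∀ x y, idx j x = idx j y → g x = g y

lemma cubeVol_pos (j : ℤ) : 0 < cubeVol n j := by unfold cubeVol; positivity

lemma cubeVol_succ (j : ℤ) : cubeVol n (j + 1) = 2 ^ n * cubeVol n j := by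
  unfold cubeVol
  rw [zpow_add_one₀ (by norm_num), mul_pow, mul_comm]

lemma idx_of_le {i j : ℤ} (hij : i ≤ j) {x y : Rn n} (h : idx i x = idx i y) :
    idx j x = idx j y := by
  obtain ⟨k, rfl⟩ := Int.le.dest hij
  have key : ∀ z : Rn n, ∀ l, idx (i + k) z l = idx i z l / ((2 ^ k : ℕ) : ℤ) := by
    intro z l
    rw [idx, idx, ← Int.floor_div_natCast]
    congr 1
    rw [zpow_add₀ (by norm_num), div_div]
    simp
  funext l
  rw [key, key, h]

lemma CubeConst.mono {β : Type*} {i j : ℤ} (hij : i ≤ j) {g : Rn n → β} (h : CubeConst j g) :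
    CubeConst i g := fun x y hxy => h x y (idx_of_le hij hxy)

lemma measurable_coord (i : Fin n) : Measurable fun x : Rn n => x i :=
  (PiLp.continuous_apply 2 (fun _ : Fin n => ℝ) i).measurable

lemma measurable_idx (j : ℤ) : Measurable (idx (n := n) j) :=
  measurable_pi_lambda _ fun i => Int.measurable_floor.comp ((measurable_coord i).div_const _)

lemma CubeConst.measurable {β : Type*} [MeasurableSpace β] {j : ℤ} {g : Rn n → β}
    (h : CubeConst j g) : Measurable g := by
  have : g = (fun q => g (Classical.epsilon fun x => idx j x = q)) ∘ idx j := by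
    funext x
    exact h _ _ (Classical.epsilon_spec (p := fun z => idx j z = idx j x) ⟨x, rfl⟩).symm
  rw [this]
  exact (Measurable.of_discrete).comp (measurable_idx j)

lemma CubeConst.measurableSet {j : ℤ} {B : Set (Rn n)} (h : CubeConst j (· ∈ B)) :
    MeasurableSet B := by
  have : Measurable (· ∈ B) := h.measurable
  exact measurableSet_setOfPred.2 this

lemma idx_eq_iff (j : ℤ) (x : Rn n) (q : Fin n → ℤ) :
    idx j x = q ↔ ∀ i, x i ∈ Ico ((2 : ℝ) ^ j * q i) ((2 : ℝ) ^ j * q i + (2 : ℝ) ^ j) := by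
  have h2 : (0 : ℝ) < 2 ^ j := by positivity
  rw [funext_iff]
  refine forall_congr' fun i => ?_
  rw [idx, Int.floor_eq_iff, mem_Ico, le_div_iff₀ h2, div_lt_iff₀ h2]
  constructor <;> rintro ⟨h, h'⟩ <;> constructor <;> nlinarith

lemma volume_pi_coord (s : Fin n → Set ℝ) (hs : ∀ i, MeasurableSet (s i)) :
    volume {x : Rn n | ∀ i, x i ∈ s i} = ∏ i, volume (s i) := by
  rw [← volume_pi_pi, ← (PiLp.volume_preserving_ofLp (Fin n)).measure_preimage
    (MeasurableSet.univ_pi hs).nullMeasurableSet]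
  congr 1
  ext x
  simp

lemma volume_cube (j : ℤ) (q : Fin n → ℤ) :
    volume {x : Rn n | idx j x = q} = ENNReal.ofReal (cubeVol n j) := by
  simp only [idx_eq_iff]
  rw [volume_pi_coord _ fun i => measurableSet_Ico]
  simp only [Real.volume_Ico, add_sub_cancel_left, Finset.prod_const, Finset.card_univ,
    Fintype.card_fin, cubeVol]
  rw [ENNReal.ofReal_pow (by positivity)]

lemma measurableSet_cube (j : ℤ) (q : Fin n → ℤ) : MeasurableSet {x : Rn n | idx j x = q} :=
  measurable_idx j (measurableSet_singleton q)

lemma norm_le_of_coord {M : ℝ} (hM : 0 ≤ M) {x : Rn n} (h : ∀ i, |x i| ≤ M) : ‖x‖ ≤ n * M := by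
  rw [EuclideanSpace.norm_eq, Real.sqrt_le_left (by positivity)]
  calc ∑ i, ‖x i‖ ^ 2 ≤ ∑ _i : Fin n, M ^ 2 := by
        gcongr with i
        exact h i
    _ = n * M ^ 2 := by simp
    _ ≤ (n * M) ^ 2 := by
        rw [mul_pow]
        gcongr
        exact_mod_cast Nat.le_self_pow two_ne_zero n

lemma abs_sub_lt_of_idx {j : ℤ} {x y : Rn n} (h : idx j x = idx j y) (i : Fin n) :
    |x i - y i| < (2 : ℝ) ^ j := by
  have h1 := (idx_eq_iff j x _).1 h i
  have h2 := (idx_eq_iff j y _).1 rfl i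
  rw [abs_lt]
  constructor <;> linarith [h1.1, h1.2, h2.1, h2.2]

lemma avgKer_symm (j : ℤ) (x y : Rn n) : avgKer j x y = avgKer j y x := by
  simp only [avgKer, eq_comm]

lemma adj_avgKer (j : ℤ) : adj (avgKer (n := n) j) = avgKer j := by
  funext x y
  rw [adj, avgKer_symm, avgKer]
  split_ifs <;> simp

lemma measurable_avgKer (j : ℤ) : Measurable (Function.uncurry (avgKer (n := n) j)) := by
  refine Measurable.ite ?_ measurable_const measurable_const
  exact measurableSet_eq_fun ((measurable_idx j).comp measurable_snd)
    ((measurable_idx j).comp measurable_fst)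

lemma norm_avgKer_le (j : ℤ) (x y : Rn n) : ‖avgKer j x y‖ ≤ (cubeVol n j)⁻¹ := by
  have := cubeVol_pos (n := n) j
  rw [avgKer]
  split_ifs
  · rw [Complex.norm_real, Real.norm_of_nonneg (by positivity)]
  · simp [this.le]

lemma finRange_of_coord {a : Rn n → Rn n → ℂ} (ha : Measurable (Function.uncurry a)) {M w : ℝ}
    (hw : 0 ≤ w) (hM : ∀ x y, ‖a x y‖ ≤ M) (hs : ∀ x y, a x y ≠ 0 → ∀ i, |x i - y i| ≤ w) :
    FinRange a := by
  refine ⟨ha, M, n * w, fun x y => ⟨hM x y, fun hxy => ?_⟩⟩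
  by_contra hc
  exact absurd (norm_le_of_coord hw fun i => by simpa using hs x y hc i) (not_le.2 hxy)

lemma finRange_avgKer (j : ℤ) : FinRange (avgKer (n := n) j) := by
  refine finRange_of_coord (measurable_avgKer j) (w := 2 ^ j) (by positivity) (norm_avgKer_le j)
    fun x y hxy i => ?_
  have : idx j y = idx j x := by
    by_contra hc
    exact hxy (by simp [avgKer, hc])
  exact (abs_sub_lt_of_idx this.symm i).le

lemma enorm_avgKer (j : ℤ) (x y : Rn n) : ‖avgKer j x y‖ₑ =
    {y | idx j y = idx j x}.indicator (fun _ => (ENNReal.ofReal (cubeVol n j))⁻¹) y := by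
  have := cubeVol_pos (n := n) j
  simp only [avgKer, indicator, mem_ofPred_eq]
  split_ifs with h
  · rw [← ofReal_norm, Complex.norm_real, Real.norm_of_nonneg (by positivity),
      ENNReal.ofReal_inv_of_pos this]
  · simp

lemma lintegral_enorm_avgKer (j : ℤ) (x : Rn n) : ∫⁻ y, ‖avgKer j x y‖ₑ = 1 := by
  simp only [enorm_avgKer]
  rw [lintegral_indicator_const (measurableSet_cube j _), volume_cube, ENNReal.inv_mul_cancel]
  · simpa using cubeVol_pos j
  · simp

lemma integral_avgKer (j : ℤ) (x : Rn n) : ∫ y, avgKer j x y = 1 := by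
  have h : ∀ y, avgKer j x y =
      {y | idx j y = idx j x}.indicator (fun _ => (((cubeVol n j)⁻¹ : ℝ) : ℂ)) y := by
    intro y; simp [avgKer, indicator]
  simp only [h]
  rw [integral_indicator_const _ (measurableSet_cube j _), Measure.real, volume_cube,
    ENNReal.toReal_ofReal (cubeVol_pos j).le, Complex.real_smul, ← Complex.ofReal_mul,
    mul_inv_cancel₀ (cubeVol_pos j).ne', Complex.ofReal_one]

/-- The averaging operator over dyadic cubes of side `2 ^ j`. -/
abbrev cavg (j : ℤ) (f : Rn n → ℂ) : Rn n → ℂ := kop (avgKer j) f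

lemma cubeConst_cavg (j : ℤ) (f : Rn n → ℂ) : CubeConst j (cavg j f) := by
  intro x y h
  simp only [cavg, kop, avgKer, h]

lemma cavg_of_cubeConst {j : ℤ} {g : Rn n → ℂ} (hg : CubeConst j g) : cavg j g = g := by
  funext x
  have : ∀ y, avgKer j x y * g y = avgKer j x y * g x := by
    intro y
    by_cases h : idx j y = idx j x
    · rw [hg y x h]
    · simp [avgKer, h]
  rw [cavg, kop]
  simp only [this]
  rw [integral_mul_const, integral_avgKer, one_mul]

lemma cavg_cavg_left {i j : ℤ} (hij : i ≤ j) (f : Rn n → ℂ) : cavg i (cavg j f) = cavg j f :=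
  cavg_of_cubeConst ((cubeConst_cavg j f).mono hij)

lemma cavg_cavg_right {i j : ℤ} (hij : i ≤ j) {f : Rn n → ℂ} (hf : MemLp f 2 volume) :
    cavg j (cavg i f) = cavg j f := by
  funext x
  rw [cavg, cavg, kop_kop (finRange_avgKer j) (finRange_avgKer i) hf]
  congr 1
  funext x y
  have : ∀ z, avgKer i z y * avgKer j x z = avgKer i y z * avgKer j x y := by
    intro z
    by_cases h : idx i y = idx i z
    · rw [avgKer_symm i z y, avgKer_symm j x z, avgKer_symm j x y]
      simp only [avgKer, idx_of_le hij h]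
    · simp [avgKer, h, eq_comm]
  simp only [this]
  rw [integral_mul_const, integral_avgKer, one_mul]

lemma eLpNorm_cavg_le (j : ℤ) {f : Rn n → ℂ} (hf : AEStronglyMeasurable f volume) {q : ℝ≥0∞}
    (hq : 1 ≤ q) (hq' : q ≠ ⊤) : eLpNorm (cavg j f) q volume ≤ eLpNorm f q volume := by
  have := eLpNorm_kop_le (measurable_avgKer j) hf hq hq' (B := 1)
    (fun x => (lintegral_enorm_avgKer j x).le)
    (fun y => by simp only [avgKer_symm j _ y]; exact (lintegral_enorm_avgKer j y).le)
  simpa using this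

lemma memLp_cavg (j : ℤ) {f : Rn n → ℂ} {q : ℝ≥0∞} (hq : 1 ≤ q) (hq' : q ≠ ⊤)
    (hf : MemLp f q volume) : MemLp (cavg j f) q volume :=
  memLp_kop (finRange_avgKer j) hq hq' hf

/-- The dyadic averages of a nonnegative function. -/
def eavg (j : ℤ) (u : Rn n → ℝ≥0∞) (x : Rn n) : ℝ≥0∞ := ∫⁻ y, ‖avgKer j x y‖ₑ * u y

lemma cubeConst_eavg (j : ℤ) (u : Rn n → ℝ≥0∞) : CubeConst j (eavg j u) := by
  intro x y h
  simp only [eavg, avgKer, h]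

lemma enorm_cavg_le (j : ℤ) (f : Rn n → ℂ) (x : Rn n) :
    ‖cavg j f x‖ₑ ≤ eavg j (fun y => ‖f y‖ₑ) x := enorm_kop_le _ f x

lemma eavg_of_cubeConst {j : ℤ} {u : Rn n → ℝ≥0∞} (hu : CubeConst j u) : eavg j u = u := by
  funext x
  have : ∀ y, ‖avgKer j x y‖ₑ * u y = ‖avgKer j x y‖ₑ * u x := by
    intro y
    by_cases h : idx j y = idx j x
    · rw [hu y x h]
    · simp [avgKer, h]
  have hm : Measurable fun y => ‖avgKer j x y‖ₑ :=
    ((measurable_avgKer j).comp measurable_prodMk_left).enorm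
  calc eavg j u x = ∫⁻ y, ‖avgKer j x y‖ₑ * u x := lintegral_congr this
    _ = (∫⁻ y, ‖avgKer j x y‖ₑ) * u x := lintegral_mul_const _ hm
    _ = u x := by rw [lintegral_enorm_avgKer, one_mul]

lemma eavg_le_succ (j : ℤ) (u : Rn n → ℝ≥0∞) (x : Rn n) :
    eavg j u x ≤ 2 ^ n * eavg (j + 1) u x := by
  rw [eavg, eavg, ← lintegral_const_mul' _ _ (by simp)]
  refine lintegral_mono fun y => ?_
  simp only [enorm_avgKer, indicator, mem_ofPred_eq, ← mul_assoc]
  gcongr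
  by_cases h : idx j y = idx j x
  · rw [if_pos h, if_pos (idx_of_le (by lia) h), cubeVol_succ, ENNReal.ofReal_mul (by positivity),
      ENNReal.mul_inv (by left; positivity) (by left; simp), ← mul_assoc]
    simp only [Nat.ofNat_nonneg, ENNReal.ofReal_pow, ENNReal.ofReal_ofNat]
    rw [ENNReal.mul_inv_cancel (by simp) (by simp), one_mul]
  · simp [h]

lemma eavg_le (j : ℤ) (u : Rn n → ℝ≥0∞) (x : Rn n) :
    eavg j u x ≤ (ENNReal.ofReal (cubeVol n j))⁻¹ * ∫⁻ y, u y := by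
  rw [eavg, ← lintegral_const_mul' _ _ (by simpa using cubeVol_pos j)]
  refine lintegral_mono fun y => ?_
  simp only [enorm_avgKer]
  gcongr
  exact indicator_le_self _ _ y

/-- Averaging is self-adjoint. -/
lemma lintegral_mul_eavg (j : ℤ) {u v : Rn n → ℝ≥0∞} (hu : AEMeasurable u volume)
    (hv : AEMeasurable v volume) : ∫⁻ x, v x * eavg j u x = ∫⁻ x, eavg j v x * u x := by
  have hk := (measurable_avgKer (n := n) j).enorm
  calc ∫⁻ x, v x * eavg j u x = ∫⁻ x, ∫⁻ y, v x * (‖avgKer j x y‖ₑ * u y) := by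
        refine lintegral_congr fun x => ?_
        rw [eavg, lintegral_const_mul'']
        exact (hk.comp measurable_prodMk_left).aemeasurable.mul hu
    _ = ∫⁻ y, ∫⁻ x, v x * (‖avgKer j x y‖ₑ * u y) := by
        rw [lintegral_lintegral_swap]
        exact hv.comp_fst.mul (hk.aemeasurable.mul hu.comp_snd)
    _ = _ := by
        refine lintegral_congr fun y => ?_
        rw [eavg, ← lintegral_mul_const'']
        · refine lintegral_congr fun x => ?_
          rw [avgKer_symm j x y]; ring
        · exact (hk.comp measurable_prodMk_left).aemeasurable.mul hv

lemma lintegral_indicator_eavg {j : ℤ} {B : Set (Rn n)} (hB : CubeConst j (· ∈ B))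
    {u : Rn n → ℝ≥0∞} (hu : AEMeasurable u volume) : ∫⁻ x in B, eavg j u x = ∫⁻ x in B, u x := by
  have hm := hB.measurableSet
  rw [← lintegral_indicator hm, ← lintegral_indicator hm]
  have h1 := lintegral_mul_eavg j hu (v := B.indicator 1)
    ((measurable_const.indicator hm).aemeasurable)
  rw [eavg_of_cubeConst (u := B.indicator 1)] at h1
  · calc _ = ∫⁻ x, B.indicator 1 x * eavg j u x := by
          refine lintegral_congr fun x => ?_
          by_cases hx : x ∈ B <;> simp [hx]
      _ = _ := h1
      _ = _ := by
          refine lintegral_congr fun x => ?_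
          by_cases hx : x ∈ B <;> simp [hx]
  · intro x y h
    have : x ∈ B ↔ y ∈ B := eq_iff_iff.1 (hB x y h)
    by_cases hx : x ∈ B
    · simp [hx, this.1 hx]
    · simp [hx, mt this.2 hx]

/-- Averaging operators on `L²` form a chain of projections. -/
lemma projChain_cavg : ProjChain fun j => kopL2 (avgKer (n := n) j) (finRange_avgKer j) where
  symm j f g := by
    have := inner_kopL2 (avgKer (n := n) j) (finRange_avgKer j) f g
    simpa only [adj_avgKer] using this
  left i j hij f := by
    refine Lp.ext ?_
    refine (coeFn_kopL2 _ _ _).trans ?_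
    rw [kop_congr (coeFn_kopL2 (avgKer j) (finRange_avgKer j) f)]
    rw [show kop (avgKer i) (kop (avgKer j) f) = kop (avgKer j) f from cavg_cavg_left hij _]
    exact (coeFn_kopL2 _ _ _).symm
  right i j hij f := by
    refine Lp.ext ?_
    refine (coeFn_kopL2 _ _ _).trans ?_
    rw [kop_congr (coeFn_kopL2 (avgKer i) (finRange_avgKer i) f)]
    rw [show kop (avgKer j) (kop (avgKer i) f) = kop (avgKer j) f from
      cavg_cavg_right hij (Lp.memLp f)]
    exact (coeFn_kopL2 _ _ _).symm

end Cubes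

/-! ### Kernels adapted to a dyadic scale -/

section Good

variable {n : ℕ}

/-- The decay rate: `rho ^ 4 = 1 / 2`. -/
def rho : ℝ := (2 : ℝ) ^ (-(1 / 4) : ℝ)

/-- The decay factor `2 ^ (-|k| / 2)`. -/
def dec (k : ℤ) : ℝ := (rho ^ 2) ^ k.natAbs

lemma rho_pos : 0 < rho := by unfold rho; positivity

lemma rho_lt_one : rho < 1 := Real.rpow_lt_one_of_one_lt_of_neg (by norm_num) (by norm_num)

lemma rho_pow_four : rho ^ 4 = 1 / 2 := by
  rw [rho, ← Real.rpow_natCast, ← Real.rpow_mul (by norm_num)]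
  norm_num [Real.rpow_neg_one]

lemma dec_pos (k : ℤ) : 0 < dec k := by have := rho_pos; unfold dec; positivity

lemma dec_sq (k : ℤ) : dec k ^ 2 = (1 / 2 : ℝ) ^ k.natAbs := by
  rw [dec, ← rho_pow_four]; ring

lemma dec_zero : dec 0 = 1 := by simp [dec]

lemma dec_neg (k : ℤ) : dec (-k) = dec k := by simp [dec]

lemma two_zpow_sub {j m : ℤ} (h : m ≤ j) : (2 : ℝ) ^ m / 2 ^ j = dec (m - j) ^ 2 := by
  rw [dec_sq, ← zpow_sub₀ (by norm_num)]
  have : m - j = -((m - j).natAbs : ℤ) := by lia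
  rw [one_div, inv_pow, ← zpow_natCast, ← zpow_neg, ← this]

/-- Kernels adapted to scale `2 ^ m`: bounded by `c 2 ^ (-mn)`, supported in
`|x_i - y_i| ≤ w 2 ^ m`, with vanishing integral and dyadic Hölder regularity in `y`. -/
structure GoodKer (w : ℕ) (m : ℤ) (c : ℝ) (a : Rn n → Rn n → ℂ) : Prop where
  meas : Measurable (Function.uncurry a)
  bound : ∀ x y, ‖a x y‖ ≤ c * (cubeVol n m)⁻¹
  supp : ∀ x y, a x y ≠ 0 → ∀ i, |x i - y i| ≤ w * (2 : ℝ) ^ m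
  int_zero : ∀ x, ∫ y, a x y = 0
  osc : ∀ j ≤ m, ∀ x y z, idx j y = idx j z →
    ‖a x y - a x z‖ ≤ c * dec (m - j) * (cubeVol n m)⁻¹

/-- The constant function on the box `|x_i - y_i| ≤ W 2 ^ m`. -/
def boxKer (W : ℕ) (m : ℤ) (B : ℝ) (x y : Rn n) : ℝ≥0∞ :=
  {y | ∀ i, |x i - y i| ≤ W * (2 : ℝ) ^ m}.indicator
    (fun _ => ENNReal.ofReal (B * (cubeVol n m)⁻¹)) y

lemma measurableSet_box (W : ℕ) (m : ℤ) (x : Rn n) :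
    MeasurableSet {y : Rn n | ∀ i, |x i - y i| ≤ W * (2 : ℝ) ^ m} := by
  rw [show {y : Rn n | ∀ i, |x i - y i| ≤ W * (2 : ℝ) ^ m} =
    ⋂ i, {y : Rn n | |x i - y i| ≤ W * (2 : ℝ) ^ m} by ext; simp]
  exact MeasurableSet.iInter fun i =>
    measurableSet_le (measurable_const.sub (measurable_coord i)).abs measurable_const

lemma measurable_boxKer (W : ℕ) (m : ℤ) (B : ℝ) :
    Measurable (Function.uncurry (boxKer (n := n) W m B)) := by
  have hs : MeasurableSet {z : Rn n × Rn n | ∀ i, |z.1 i - z.2 i| ≤ W * (2 : ℝ) ^ m} := by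
    rw [show {z : Rn n × Rn n | ∀ i, |z.1 i - z.2 i| ≤ W * (2 : ℝ) ^ m} =
      ⋂ i, {z : Rn n × Rn n | |z.1 i - z.2 i| ≤ W * (2 : ℝ) ^ m} by ext; simp]
    exact MeasurableSet.iInter fun i => measurableSet_le
      (((measurable_coord i).comp measurable_fst).sub
        ((measurable_coord i).comp measurable_snd)).abs measurable_const
  exact (measurable_const (a := ENNReal.ofReal (B * (cubeVol n m)⁻¹))).indicator hs

lemma boxKer_symm (W : ℕ) (m : ℤ) (B : ℝ) (x y : Rn n) :
    boxKer W m B x y = boxKer W m B y x := by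
  simp only [boxKer, indicator, mem_ofPred_eq, abs_sub_comm]

lemma volume_box (W : ℕ) (m : ℤ) (x : Rn n) :
    volume {y : Rn n | ∀ i, |x i - y i| ≤ W * (2 : ℝ) ^ m} =
      ENNReal.ofReal ((2 * W) ^ n * cubeVol n m) := by
  have : {y : Rn n | ∀ i, |x i - y i| ≤ W * (2 : ℝ) ^ m} =
      {y | ∀ i, y i ∈ Icc (x i - W * (2 : ℝ) ^ m) (x i + W * (2 : ℝ) ^ m)} := by
    ext y
    simp only [mem_ofPred_eq, mem_Icc, abs_le]
    refine forall_congr' fun i => ?_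
    constructor <;> rintro ⟨h, h'⟩ <;> constructor <;> linarith
  rw [this, volume_pi_coord _ fun i => measurableSet_Icc]
  have h2 : ∀ i, x i + W * (2 : ℝ) ^ m - (x i - W * (2 : ℝ) ^ m) = 2 * W * 2 ^ m :=
    fun i => by ring
  simp only [Real.volume_Icc, h2, Finset.prod_const, Finset.card_univ, Fintype.card_fin, cubeVol]
  rw [← ENNReal.ofReal_pow (by positivity), ← mul_pow]

lemma lintegral_boxKer (W : ℕ) (m : ℤ) {B : ℝ} (hB : 0 ≤ B) (x : Rn n) :
    ∫⁻ y, boxKer W m B x y = ENNReal.ofReal (B * (2 * W) ^ n) := by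
  have h0 := cubeVol_pos (n := n) m
  simp only [boxKer]
  rw [lintegral_indicator_const (measurableSet_box W m x), volume_box,
    ← ENNReal.ofReal_mul (by positivity)]
  congr 1
  field_simp

lemma eLpNorm_le_of_boxKer (W : ℕ) (m : ℤ) {B : ℝ} (hB : 0 ≤ B) {f g : Rn n → ℂ}
    (hf : AEStronglyMeasurable f volume) {q : ℝ≥0∞} (hq : 1 ≤ q) (hq' : q ≠ ⊤)
    (h : ∀ x, ‖g x‖ₑ ≤ ∫⁻ y, boxKer W m B x y * ‖f y‖ₑ) :
    eLpNorm g q volume ≤ ENNReal.ofReal (B * (2 * W) ^ n) * eLpNorm f q volume := by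
  have hq0 : q ≠ 0 := (zero_lt_one.trans_le hq).ne'
  have hr : 1 ≤ q.toReal := by
    rw [← ENNReal.toReal_one]; exact ENNReal.toReal_mono hq' hq
  have hr0 : 0 < q.toReal := by linarith
  rw [eLpNorm_eq_lintegral_rpow_enorm_toReal hq0 hq', eLpNorm_eq_lintegral_rpow_enorm_toReal hq0 hq']
  calc (∫⁻ x, ‖g x‖ₑ ^ q.toReal) ^ (1 / q.toReal)
      ≤ (ENNReal.ofReal (B * (2 * W) ^ n) ^ q.toReal * ∫⁻ y, ‖f y‖ₑ ^ q.toReal) ^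
          (1 / q.toReal) := by
        gcongr
        refine le_trans (lintegral_mono fun x => ?_)
          (schur_lintegral (measurable_boxKer W m B) hf.enorm hr
            (fun x => (lintegral_boxKer W m hB x).le)
            (fun y => by
              simp only [boxKer_symm W m B _ y]; exact (lintegral_boxKer W m hB y).le))
        gcongr
        exact h x
    _ = _ := by
        rw [ENNReal.mul_rpow_of_nonneg _ _ (by positivity), ← ENNReal.rpow_mul,
          mul_one_div_cancel hr0.ne', ENNReal.rpow_one]

lemma enorm_le_boxKer {W : ℕ} {m : ℤ} {B : ℝ} {x y : Rn n} {z : ℂ}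
    (hb : ‖z‖ ≤ B * (cubeVol n m)⁻¹) (hs : z ≠ 0 → ∀ i, |x i - y i| ≤ W * (2 : ℝ) ^ m) :
    ‖z‖ₑ ≤ boxKer W m B x y := by
  by_cases hz : z = 0
  · simp [hz]
  · have hy : y ∈ {y : Rn n | ∀ i, |x i - y i| ≤ W * (2 : ℝ) ^ m} := hs hz
    rw [boxKer, indicator_of_mem hy, ← ofReal_norm]
    exact ENNReal.ofReal_le_ofReal hb

lemma norm_cavg_le_of_forall {j : ℤ} {g : Rn n → ℂ} {y : Rn n} {B : ℝ} (hB : 0 ≤ B)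
    (hg : ∀ z, idx j z = idx j y → ‖g z‖ ≤ B) : ‖cavg j g y‖ ≤ B := by
  have hb : ∀ z, ‖avgKer j y z * g z‖ₑ ≤ ‖avgKer j y z‖ₑ * ENNReal.ofReal B := by
    intro z
    rw [enorm_mul, ← ofReal_norm (g z)]
    by_cases hz : idx j z = idx j y
    · gcongr
      exact hg z hz
    · simp [avgKer, hz]
  have hm : Measurable fun z => ‖avgKer j y z‖ₑ :=
    ((measurable_avgKer j).comp measurable_prodMk_left).enorm
  have h : ‖cavg j g y‖ₑ ≤ _ :=
    (enorm_integral_le_lintegral_enorm fun z => avgKer j y z * g z).trans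
      ((lintegral_mono hb).trans_eq (lintegral_mul_const _ hm))
  rw [lintegral_enorm_avgKer, one_mul, ← ofReal_norm] at h
  exact (ENNReal.ofReal_le_ofReal_iff hB).1 h

namespace GoodKer

variable {w : ℕ} {m : ℤ} {c : ℝ} {a : Rn n → Rn n → ℂ}

lemma finRange (h : GoodKer w m c a) : FinRange a :=
  finRange_of_coord h.meas (w := w * 2 ^ m) (by positivity) h.bound h.supp

lemma nonneg (h : GoodKer w m c a) : 0 ≤ c := by
  have h1 := (norm_nonneg _).trans (h.bound 0 0)
  have := cubeVol_pos (n := n) m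
  exact nonneg_of_mul_nonneg_left h1 (by positivity)

lemma enorm_le (h : GoodKer w m c a) (x y : Rn n) : ‖a x y‖ₑ ≤ boxKer w m c x y :=
  enorm_le_boxKer (h.bound x y) (h.supp x y)

lemma const_mul (h : GoodKer w m c a) (z : ℂ) : GoodKer w m (‖z‖ * c) fun x y => z * a x y where
  meas := measurable_const.mul h.meas
  bound x y := by
    rw [norm_mul, mul_assoc]; exact mul_le_mul_of_nonneg_left (h.bound x y) (norm_nonneg _)
  supp x y hxy := h.supp x y (right_ne_zero_of_mul hxy)
  int_zero x := by rw [integral_const_mul, h.int_zero, mul_zero]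
  osc j hj x y z hyz := by
    rw [← mul_sub, norm_mul, mul_assoc, mul_assoc, ← mul_assoc c]
    exact mul_le_mul_of_nonneg_left (h.osc j hj x y z hyz) (norm_nonneg _)

lemma mono (h : GoodKer w m c a) {w' : ℕ} {c' : ℝ} (hw : w ≤ w') (hc : c ≤ c') :
    GoodKer w' m c' a where
  meas := h.meas
  bound x y := (h.bound x y).trans (by have := cubeVol_pos (n := n) m; gcongr)
  supp x y hxy i := (h.supp x y hxy i).trans (by gcongr)
  int_zero := h.int_zero
  osc j hj x y z hyz := (h.osc j hj x y z hyz).trans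
    (by have := cubeVol_pos (n := n) m; have := dec_pos (m - j); gcongr)

lemma add {c' : ℝ} {b : Rn n → Rn n → ℂ} (ha : GoodKer w m c a) (hb : GoodKer w m c' b) :
    GoodKer w m (c + c') fun x y => a x y + b x y where
  meas := ha.meas.add hb.meas
  bound x y := by
    rw [add_mul]
    exact (norm_add_le _ _).trans (add_le_add (ha.bound x y) (hb.bound x y))
  supp x y hxy := by
    by_cases h : a x y = 0
    · exact hb.supp x y (by simpa [h] using hxy)
    · exact ha.supp x y h
  int_zero x := by
    have hl : LocallyIntegrable (fun _ : Rn n => (1 : ℂ)) volume := locallyIntegrable_const _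
    rw [integral_add, ha.int_zero, hb.int_zero, add_zero]
    · simpa using ha.finRange.integrable_mul hl x
    · simpa using hb.finRange.integrable_mul hl x
  osc j hj x y z hyz := by
    rw [add_mul, add_mul, add_sub_add_comm]
    exact (norm_add_le _ _).trans (add_le_add (ha.osc j hj x y z hyz) (hb.osc j hj x y z hyz))

lemma zero : GoodKer w m 0 (fun _ _ : Rn n => (0 : ℂ)) where
  meas := measurable_const
  bound := by simp
  supp := by simp
  int_zero := by simp
  osc := by simp

lemma sum {ι : Type*} (F : Finset ι) {c : ι → ℝ} {a : ι → Rn n → Rn n → ℂ}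
    (h : ∀ i ∈ F, GoodKer w m (c i) (a i)) :
    GoodKer w m (∑ i ∈ F, c i) fun x y => ∑ i ∈ F, a i x y := by
  classical
  induction F using Finset.induction_on with
  | empty => simpa using zero
  | insert i F hi ih =>
    simp only [Finset.sum_insert hi]
    exact (h i (by simp)).add (ih fun j hj => h j (by simp [hj]))

/-- Gain on functions with vanishing averages over small cubes. -/
lemma fine (h : GoodKer w m c a) {j : ℤ} (hj : j ≤ m) {f : Rn n → ℂ} (hf : MemLp f 2 volume)
    {q : ℝ≥0∞} (hq : 1 ≤ q) (hq' : q ≠ ⊤) :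
    eLpNorm (kop a fun y => f y - cavg j f y) q volume ≤
      ENNReal.ofReal (c * dec (m - j) * (2 * (w + 1 : ℕ)) ^ n) * eLpNorm f q volume := by
  have hc := h.nonneg
  have hd := dec_pos (m - j)
  refine eLpNorm_le_of_boxKer (w + 1) m (by positivity) hf.1 hq hq' fun x => ?_
  have hl := locInt hf
  have hE := finRange_avgKer (n := n) j
  have hla : LocallyIntegrable (a x) volume := by
    have := h.finRange.integrable_mul (locallyIntegrable_const (1 : ℂ)) x
    simpa using this.locallyIntegrable
  have h1 : (kop a fun y => f y - cavg j f y) x =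
      kop a f x - kop (fun x y => ∫ z, avgKer j z y * a x z) f x := by
    rw [kop_sub h.finRange hl (locInt (memLp_cavg j (by norm_num) (by norm_num) hf)),
      cavg, kop_kop h.finRange hE hf]
  have h2 : ∀ y, a x y - ∫ z, avgKer j z y * a x z = ∫ z, avgKer j y z * (a x y - a x z) := by
    intro y
    simp only [avgKer_symm j _ y, mul_sub]
    rw [integral_sub, integral_mul_const, integral_avgKer, one_mul]
    · simpa using (hE.integrable_mul (locallyIntegrable_const (1 : ℂ)) y).mul_const (a x y)
    · exact hE.integrable_mul hla y
  have h3 : ∀ y, ‖a x y - ∫ z, avgKer j z y * a x z‖ ≤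
      c * dec (m - j) * (cubeVol n m)⁻¹ := by
    intro y
    rw [h2]
    have hv := cubeVol_pos (n := n) m
    exact norm_cavg_le_of_forall (by positivity) fun z hz => h.osc j hj x y z hz.symm
  have h4 : ∀ y, a x y - (∫ z, avgKer j z y * a x z) ≠ 0 →
      ∀ i, |x i - y i| ≤ (w + 1 : ℕ) * (2 : ℝ) ^ m := by
    intro y hy
    by_contra! hc
    obtain ⟨i, hi⟩ := hc
    have hjm : (2 : ℝ) ^ j ≤ 2 ^ m := zpow_le_zpow_right₀ (by norm_num) hj
    have hpm : (0 : ℝ) < 2 ^ m := by positivity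
    push_cast at hi
    refine hy ?_
    rw [h2]
    refine integral_eq_zero_of_ae (Eventually.of_forall fun z => ?_)
    by_cases hz : idx j z = idx j y
    · have hzi := abs_lt.1 (abs_sub_lt_of_idx hz i)
      have e1 : a x y = 0 := by
        by_contra hne
        have := h.supp x y hne i
        linarith
      have e2 : a x z = 0 := by
        by_contra hne
        have h5 := abs_le.1 (h.supp x z hne i)
        have : |x i - y i| ≤ (w + 1) * 2 ^ m := by
          rw [abs_le]; constructor <;> linarith [h5.1, h5.2, hzi.1, hzi.2]
        linarith
      simp [e1, e2]
    · simp [avgKer, hz]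
  have h5 : kop a f x - kop (fun x y => ∫ z, avgKer j z y * a x z) f x =
      ∫ y, (a x y - ∫ z, avgKer j z y * a x z) * f y := by
    simp only [kop, sub_mul]
    rw [integral_sub (h.finRange.integrable_mul hl x)]
    have hi : Integrable (fun y => (∫ z, avgKer j y z * a x z) * f y) := by
      have hfr : FinRange fun x' y : Rn n => (if ‖x' - y‖ ≤ n * ((w + 1 : ℕ) * (2 : ℝ) ^ m) then
          cavg j (a x) y else 0) := by
        refine ⟨Measurable.ite ?_ ((cubeConst_cavg j _).measurable.comp measurable_snd)
          measurable_const, c * (cubeVol n m)⁻¹, _, fun x' y => ⟨?_, fun hxy => if_neg hxy.not_ge⟩⟩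
        · exact measurableSet_le (measurable_fst.sub measurable_snd).norm measurable_const
        · have hv := cubeVol_pos (n := n) m
          split_ifs
          · exact norm_cavg_le_of_forall (by positivity) fun z _ => h.bound x z
          · simp only [norm_zero]; positivity
      refine (hfr.integrable_mul hl x).congr (Eventually.of_forall fun y => ?_)
      dsimp only
      split_ifs with hxy
      · rfl
      · have hbox : ¬ ∀ i, |x i - y i| ≤ (w + 1 : ℕ) * (2 : ℝ) ^ m := fun hb =>
          hxy (norm_le_of_coord (by positivity) fun i => by simpa using hb i)
        have e1 : a x y = 0 := by
          by_contra hne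
          refine hbox fun i => (h.supp x y hne i).trans ?_
          gcongr
          simp
        have e2 := mt (h4 y) hbox
        rw [e1, not_not, zero_sub, neg_eq_zero] at e2
        simp only [avgKer_symm j _ y] at e2
        rw [e2]
    simpa only [avgKer_symm j _ _] using hi
  rw [h1, h5]
  refine (enorm_integral_le_lintegral_enorm _).trans (lintegral_mono fun y => ?_)
  rw [enorm_mul]
  gcongr
  exact enorm_le_boxKer (h3 y) (h4 y)

end GoodKer

end Good

/-! ### Gain on functions constant on large cubes, and the `L²` bound -/

section Coarse

variable {n : ℕ}

/-- Points within `δ` of the boundary of their dyadic cube of side `2 ^ j`. -/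
def nearBdry (n : ℕ) (j : ℤ) (δ : ℝ) : Set (Rn n) :=
  {x | ∃ i, x i ≤ (2 : ℝ) ^ j * idx j x i + δ ∨ (2 : ℝ) ^ j * idx j x i + 2 ^ j - δ ≤ x i}

lemma measurableSet_nearBdry (j : ℤ) (δ : ℝ) : MeasurableSet (nearBdry n j δ) := by
  have h1 : ∀ i, Measurable fun x : Rn n => (2 : ℝ) ^ j * (idx j x i : ℝ) := fun i =>
    (((measurable_from_top (f := fun k : ℤ => (k : ℝ))).comp
      ((measurable_pi_apply i).comp (measurable_idx j))).const_mul _)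
  rw [show nearBdry n j δ = ⋃ i, ({x | x i ≤ (2 : ℝ) ^ j * idx j x i + δ} ∪
    {x | (2 : ℝ) ^ j * idx j x i + 2 ^ j - δ ≤ x i}) by ext; simp [nearBdry]]
  exact MeasurableSet.iUnion fun i =>
    (measurableSet_le (measurable_coord i) ((h1 i).add_const _)).union
      (measurableSet_le (((h1 i).add_const _).sub_const _) (measurable_coord i))

lemma mem_nearBdry {j : ℤ} {δ : ℝ} {x y : Rn n} (hxy : ∀ i, |x i - y i| ≤ δ)
    (h : idx j x ≠ idx j y) : x ∈ nearBdry n j δ := by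
  by_contra hc
  simp only [nearBdry, mem_ofPred_eq, not_exists, not_or, not_le] at hc
  refine h ((idx_eq_iff j y _).2 fun i => ?_).symm
  have h1 := abs_le.1 (hxy i)
  have h2 := hc i
  constructor <;> linarith [h1.1, h1.2, h2.1, h2.2]

lemma volume_nearBdry_le {j : ℤ} {δ : ℝ} (hδ : 0 ≤ δ) (q : Fin n → ℤ) :
    volume (nearBdry n j δ ∩ {x | idx j x = q}) ≤
      ENNReal.ofReal (n * (2 * δ / 2 ^ j) * cubeVol n j) := by
  classical
  set b : Fin n → ℝ := fun i => (2 : ℝ) ^ j * q i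
  set s : Fin n → Fin n → Set ℝ := fun i l => if l = i then
    Icc (b l) (b l + δ) ∪ Icc (b l + 2 ^ j - δ) (b l + 2 ^ j) else Ico (b l) (b l + 2 ^ j)
  have hs : ∀ i l, MeasurableSet (s i l) := fun i l => by
    dsimp only [s]; split_ifs
    · exact measurableSet_Icc.union measurableSet_Icc
    · exact measurableSet_Ico
  have hsub : nearBdry n j δ ∩ {x | idx j x = q} ⊆ ⋃ i, {x | ∀ l, x l ∈ s i l} := by
    rintro x ⟨⟨i, hi⟩, hx : idx j x = q⟩
    have hq := (idx_eq_iff j x q).1 hx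
    rw [hx] at hi
    refine mem_iUnion.2 ⟨i, fun l => ?_⟩
    dsimp only [s]
    split_ifs with hl
    · subst hl
      rcases hi with hi | hi
      · exact Or.inl ⟨(hq l).1, hi⟩
      · exact Or.inr ⟨hi, (hq l).2.le⟩
    · exact hq l
  have hone : ∀ i, volume {x : Rn n | ∀ l, x l ∈ s i l} ≤
      ENNReal.ofReal (2 * δ / 2 ^ j * cubeVol n j) := by
    intro i
    rw [volume_pi_coord _ (hs i)]
    have : ∀ l, volume (s i l) ≤ ENNReal.ofReal (2 ^ j * if l = i then 2 * δ / 2 ^ j else 1) := by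
      intro l
      dsimp only [s]
      split_ifs
      · refine (measure_union_le _ _).trans ?_
        rw [Real.volume_Icc, Real.volume_Icc, ← ENNReal.ofReal_add (by linarith) (by linarith)]
        refine ENNReal.ofReal_le_ofReal ?_
        field_simp
        linarith
      · rw [Real.volume_Ico]
        refine ENNReal.ofReal_le_ofReal ?_
        linarith
    refine (Finset.prod_le_prod' fun l _ => this l).trans ?_
    rw [← ENNReal.ofReal_prod_of_nonneg]
    · refine ENNReal.ofReal_le_ofReal ?_
      rw [Finset.prod_mul_distrib, Finset.prod_ite_eq' Finset.univ i, if_pos (Finset.mem_univ i)]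
      simp [cubeVol, mul_comm]
    · intro l _
      have : (0 : ℝ) < 2 ^ j := by positivity
      split_ifs <;> positivity
  calc _ ≤ volume (⋃ i, {x : Rn n | ∀ l, x l ∈ s i l}) := measure_mono hsub
    _ ≤ ∑ i, volume {x : Rn n | ∀ l, x l ∈ s i l} := measure_iUnion_fintype_le _ _
    _ ≤ ∑ _i : Fin n, ENNReal.ofReal (2 * δ / 2 ^ j * cubeVol n j) := by
        gcongr with i; exact hone i
    _ = _ := by
        rw [Finset.sum_const, Finset.card_univ, Fintype.card_fin, nsmul_eq_mul, mul_assoc,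
          ENNReal.ofReal_mul (by positivity) (p := (n : ℝ)), ENNReal.ofReal_natCast]

lemma eavg_indicator_nearBdry_le {j : ℤ} {δ : ℝ} (hδ : 0 ≤ δ) (x : Rn n) :
    eavg j ((nearBdry n j δ).indicator 1) x ≤ ENNReal.ofReal (n * (2 * δ / 2 ^ j)) := by
  have hv := cubeVol_pos (n := n) j
  have h1 : ∀ y, ‖avgKer j x y‖ₑ * (nearBdry n j δ).indicator 1 y =
      (nearBdry n j δ ∩ {y | idx j y = idx j x}).indicator
        (fun _ => (ENNReal.ofReal (cubeVol n j))⁻¹) y := by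
    intro y
    rw [enorm_avgKer]
    simp only [indicator, mem_inter_iff]
    by_cases hy : y ∈ nearBdry n j δ <;> by_cases hz : idx j y = idx j x <;> simp [hy, hz]
  rw [eavg]
  simp only [h1]
  rw [lintegral_indicator_const ((measurableSet_nearBdry j δ).inter (measurableSet_cube j _))]
  calc _ ≤ (ENNReal.ofReal (cubeVol n j))⁻¹ *
        ENNReal.ofReal (n * (2 * δ / 2 ^ j) * cubeVol n j) := by
        gcongr; exact volume_nearBdry_le hδ _
    _ = _ := by
        rw [← ENNReal.ofReal_inv_of_pos hv, ← ENNReal.ofReal_mul (by positivity)]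
        congr 1
        field_simp

lemma eLpNorm_indicator_nearBdry_le {j : ℤ} {δ : ℝ} (hδ : 0 ≤ δ) {g : Rn n → ℂ}
    (hg : CubeConst j g) : eLpNorm ((nearBdry n j δ).indicator g) 2 volume ≤
      ENNReal.ofReal (√(n * (2 * δ / 2 ^ j))) * eLpNorm g 2 volume := by
  have hm := measurableSet_nearBdry (n := n) j δ
  have hu : CubeConst j fun x => ‖g x‖ₑ ^ (2 : ℝ) := fun x y h => by simp only [hg x y h]
  have key : ∫⁻ x, ‖(nearBdry n j δ).indicator g x‖ₑ ^ (2 : ℝ) ≤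
      ENNReal.ofReal (n * (2 * δ / 2 ^ j)) * ∫⁻ x, ‖g x‖ₑ ^ (2 : ℝ) := by
    calc _ = ∫⁻ x, (nearBdry n j δ).indicator 1 x * eavg j (fun x => ‖g x‖ₑ ^ (2 : ℝ)) x := by
          rw [eavg_of_cubeConst hu]
          refine lintegral_congr fun x => ?_
          by_cases hx : x ∈ nearBdry n j δ <;> simp [hx]
      _ = ∫⁻ x, eavg j ((nearBdry n j δ).indicator 1) x * ‖g x‖ₑ ^ (2 : ℝ) :=
          lintegral_mul_eavg j hu.measurable.aemeasurable
            ((measurable_const.indicator hm).aemeasurable)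
      _ ≤ ∫⁻ x, ENNReal.ofReal (n * (2 * δ / 2 ^ j)) * ‖g x‖ₑ ^ (2 : ℝ) := by
          gcongr with x
          exact eavg_indicator_nearBdry_le hδ x
      _ = _ := lintegral_const_mul _ hu.measurable
  rw [eLpNorm_eq_lintegral_rpow_enorm_toReal (by norm_num) (by norm_num),
    eLpNorm_eq_lintegral_rpow_enorm_toReal (by norm_num) (by norm_num)]
  simp only [ENNReal.toReal_ofNat]
  refine (ENNReal.rpow_le_rpow key (by norm_num)).trans_eq ?_
  rw [ENNReal.mul_rpow_of_nonneg _ _ (by norm_num), ENNReal.ofReal_rpow_of_nonneg (by positivity)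
    (by norm_num), Real.sqrt_eq_rpow]

lemma GoodKer.coarse {w : ℕ} {m : ℤ} {c : ℝ} {a : Rn n → Rn n → ℂ} (h : GoodKer w m c a) {j : ℤ}
    (hj : m ≤ j) {f : Rn n → ℂ} (hf : MemLp f 2 volume) :
    eLpNorm (kop a (cavg j f)) 2 volume ≤
      ENNReal.ofReal (2 * (c * (2 * w) ^ n) * √(2 * n * w) * dec (m - j)) *
        eLpNorm f 2 volume := by
  have hc := h.nonneg
  set g := cavg j f with hgdef
  have hg : CubeConst j g := cubeConst_cavg j f
  have hg2 : MemLp g 2 volume := memLp_cavg j (by norm_num) (by norm_num) hf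
  set δ : ℝ := w * 2 ^ m with hδ
  have hδ0 : 0 ≤ δ := by positivity
  set N := nearBdry n j δ
  have hN : MeasurableSet N := measurableSet_nearBdry j δ
  have hgm : Measurable fun y => ‖N.indicator g y‖ₑ := (hg.measurable.indicator hN).enorm
  have hkm : ∀ x, Measurable (boxKer (n := n) w m c x) := fun x =>
    (measurable_boxKer w m c).comp measurable_prodMk_left
  have h1 : ∀ x, ‖kop a g x‖ₑ ≤ (∫⁻ y, boxKer w m c x y * ‖N.indicator g y‖ₑ) +
      (ENNReal.ofReal (c * (2 * w) ^ n)) * ‖N.indicator g x‖ₑ := by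
    intro x
    have e1 : kop a g x = ∫ y, a x y * (g y - g x) := by
      have hi : Integrable (a x) := by
        have := h.finRange.integrable_mul (locallyIntegrable_const (1 : ℂ)) x
        simpa using this
      simp only [kop, mul_sub]
      rw [integral_sub (h.finRange.integrable_mul (locInt hg2) x) (hi.mul_const _),
        integral_mul_const, h.int_zero, zero_mul, sub_zero]
    have e2 : ∀ y, ‖a x y * (g y - g x)‖ₑ ≤ boxKer w m c x y * ‖N.indicator g y‖ₑ +
        boxKer w m c x y * ‖N.indicator g x‖ₑ := by
      intro y
      by_cases hz : a x y = 0
      · simp [hz]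
      by_cases hxy : idx j x = idx j y
      · simp [hg x y hxy]
      have hs := h.supp x y hz
      have m1 : x ∈ N := mem_nearBdry hs hxy
      have m2 : y ∈ N := mem_nearBdry (fun i => by rw [abs_sub_comm]; exact hs i) (Ne.symm hxy)
      rw [indicator_of_mem m1, indicator_of_mem m2, ← mul_add, enorm_mul]
      gcongr
      · exact h.enorm_le x y
      · exact enorm_sub_le
    rw [e1]
    refine (enorm_integral_le_lintegral_enorm _).trans ((lintegral_mono e2).trans_eq ?_)
    calc _ = (∫⁻ y, boxKer w m c x y * ‖N.indicator g y‖ₑ) +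
          ∫⁻ y, boxKer w m c x y * ‖N.indicator g x‖ₑ := lintegral_add_left ((hkm x).mul hgm) _
      _ = _ := by rw [lintegral_mul_const _ (hkm x), lintegral_boxKer w m hc]
  set V : Rn n → ℂ := fun x => ((∫⁻ y, boxKer w m c x y * ‖N.indicator g y‖ₑ).toReal : ℂ)
  have hNg : MemLp (N.indicator g) 2 volume := hg2.indicator hN
  have hfin : ∀ x, ∫⁻ y, boxKer w m c x y * ‖N.indicator g y‖ₑ ≠ ⊤ := by
    intro x
    have hfr : FinRange fun x y : Rn n => ((boxKer w m c x y).toReal : ℂ) := by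
      refine finRange_of_coord (Complex.measurable_ofReal.comp
        (measurable_boxKer w m c).ennreal_toReal) (w := w * 2 ^ m) (M := c * (cubeVol n m)⁻¹)
        (by positivity) (fun x y => ?_) fun x y hxy => ?_
      · have := cubeVol_pos (n := n) m
        rw [Complex.norm_real, Real.norm_of_nonneg ENNReal.toReal_nonneg]
        refine ENNReal.toReal_le_of_le_ofReal (by positivity) ?_
        exact indicator_le_self _ (fun _ => ENNReal.ofReal (c * (cubeVol n m)⁻¹)) y
      · by_contra hn
        have hy : y ∉ {y : Rn n | ∀ i, |x i - y i| ≤ w * (2 : ℝ) ^ m} := hn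
        refine hxy ?_
        rw [boxKer, indicator_of_notMem hy]
        simp
    have := (hfr.integrable_mul (locInt hNg) x).2
    rw [hasFiniteIntegral_iff_enorm] at this
    refine (lt_of_le_of_lt (le_of_eq ?_) this).ne
    refine lintegral_congr fun y => ?_
    rw [enorm_mul, ← ofReal_norm (((boxKer w m c x y).toReal : ℝ) : ℂ), Complex.norm_real, Real.norm_of_nonneg
      ENNReal.toReal_nonneg, ENNReal.ofReal_toReal]
    have : boxKer w m c x y ≤ _ :=
      indicator_le_self _ (fun _ => ENNReal.ofReal (c * (cubeVol n m)⁻¹)) y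
    exact (this.trans_lt ENNReal.ofReal_lt_top).ne
  have hVe : ∀ x, ‖V x‖ₑ = ∫⁻ y, boxKer w m c x y * ‖N.indicator g y‖ₑ := by
    intro x
    rw [← ofReal_norm, Complex.norm_real, Real.norm_of_nonneg ENNReal.toReal_nonneg,
      ENNReal.ofReal_toReal (hfin x)]
  have hV : AEStronglyMeasurable V volume := by
    refine (Complex.measurable_ofReal.comp (Measurable.ennreal_toReal ?_)).aestronglyMeasurable
    exact Measurable.lintegral_prod_right
      ((measurable_boxKer w m c).mul (hgm.comp measurable_snd))
  set b : ℝ := c * (2 * w) ^ n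
  have hb : 0 ≤ b := by positivity
  set W : Rn n → ℂ := fun x => ((b * ‖N.indicator g x‖ : ℝ) : ℂ)
  have hW : AEStronglyMeasurable W volume :=
    (Complex.measurable_ofReal.comp
      ((hg.measurable.indicator hN).norm.const_mul b)).aestronglyMeasurable
  have hWe : ∀ x, ‖W x‖ₑ = ENNReal.ofReal b * ‖N.indicator g x‖ₑ := by
    intro x
    rw [← ofReal_norm, Complex.norm_real, Real.norm_of_nonneg (by positivity),
      ENNReal.ofReal_mul hb, ofReal_norm]
  have hsum : eLpNorm (kop a g) 2 volume ≤
      eLpNorm (fun x => (‖V x‖ + ‖W x‖ : ℝ)) 2 volume := by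
    refine eLpNorm_mono_enorm fun x => (h1 x).trans ?_
    rw [Real.enorm_of_nonneg (by positivity), ENNReal.ofReal_add (norm_nonneg _) (norm_nonneg _),
      ofReal_norm, ofReal_norm, hVe, hWe]
  have hVb : eLpNorm V 2 volume ≤ ENNReal.ofReal b * eLpNorm (N.indicator g) 2 volume :=
    eLpNorm_le_of_boxKer w m hc hNg.1 (by norm_num) (by norm_num) fun x => (hVe x).le
  have hWb : eLpNorm W 2 volume ≤ ENNReal.ofReal b * eLpNorm (N.indicator g) 2 volume := by
    have := eLpNorm_le_mul_eLpNorm_of_ae_le_mul (f := W) (g := N.indicator g) (c := b) (p := 2)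
      (μ := volume) (Eventually.of_forall fun x => by
        change ‖((b * ‖N.indicator g x‖ : ℝ) : ℂ)‖ ≤ _
        rw [Complex.norm_real, Real.norm_of_nonneg (by positivity)])
    exact this
  have hsq : √(n * (2 * δ / 2 ^ j)) = √(2 * n * w) * dec (m - j) := by
    have : n * (2 * δ / 2 ^ j) = 2 * n * w * dec (m - j) ^ 2 := by
      rw [← two_zpow_sub hj, hδ]; ring
    rw [this, Real.sqrt_mul (by positivity), Real.sqrt_sq (dec_pos _).le]
  calc eLpNorm (kop a g) 2 volume
      ≤ eLpNorm (fun x => ‖V x‖) 2 volume + eLpNorm (fun x => ‖W x‖) 2 volume :=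
        hsum.trans (eLpNorm_add_le hV.norm hW.norm (by norm_num))
    _ ≤ ENNReal.ofReal b * eLpNorm (N.indicator g) 2 volume +
        ENNReal.ofReal b * eLpNorm (N.indicator g) 2 volume := by
        rw [eLpNorm_norm, eLpNorm_norm]; exact add_le_add hVb hWb
    _ = ENNReal.ofReal (2 * b) * eLpNorm (N.indicator g) 2 volume := by
        rw [ENNReal.ofReal_mul (by norm_num : (0 : ℝ) ≤ 2), ← two_mul, mul_assoc,
          ENNReal.ofReal_ofNat]
    _ ≤ ENNReal.ofReal (2 * b) * (ENNReal.ofReal (√(2 * n * w) * dec (m - j)) *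
          eLpNorm f 2 volume) := by
        gcongr
        refine (eLpNorm_indicator_nearBdry_le hδ0 hg).trans ?_
        rw [hsq]
        gcongr
        exact eLpNorm_cavg_le j hf.1 (by norm_num) (by norm_num)
    _ = _ := by
        rw [← mul_assoc, ← ENNReal.ofReal_mul (by positivity), ← mul_assoc]

/-- The constant in the almost orthogonality estimates. -/
def aoConst (n w : ℕ) : ℝ := 2 * (2 * (w + 1 : ℕ)) ^ n * (1 + √(2 * n * w))

lemma aoConst_pos (n w : ℕ) : 0 < aoConst n w := by unfold aoConst; positivity

lemma GoodKer.scaleBound {w : ℕ} {m : ℤ} {c : ℝ} {a : Rn n → Rn n → ℂ} (h : GoodKer w m c a) :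
    ScaleBound (fun j => kopL2 (avgKer (n := n) j) (finRange_avgKer j)) (rho ^ 2)
      (c * aoConst n w) m (kopL2 a h.finRange) := by
  have hc := h.nonneg
  have hs := Real.sqrt_nonneg (2 * n * w : ℝ)
  have key : ∀ {B D : ℝ} {u v : Lp ℂ 2 (volume : Measure (Rn n))}, 0 ≤ B → B ≤ D →
      eLpNorm u 2 volume ≤ ENNReal.ofReal B * eLpNorm v 2 volume → ‖u‖ ≤ D * ‖v‖ := by
    intro B D u v hB hBD huv
    rw [Lp.norm_def, Lp.norm_def]
    have := ENNReal.toReal_mono (ENNReal.mul_ne_top ENNReal.ofReal_ne_top (Lp.eLpNorm_ne_top v)) huv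
    rw [ENNReal.toReal_mul, ENNReal.toReal_ofReal hB] at this
    exact this.trans (by gcongr)
  constructor
  · intro j hj f
    have hd := dec_pos (m - j)
    refine key (by positivity) ?_ (le_trans (eLpNorm_congr_ae ?_).le (h.coarse hj (Lp.memLp f)))
    · change _ ≤ c * aoConst n w * dec (m - j)
      rw [aoConst]
      have e1 : (2 * w : ℝ) ^ n ≤ (2 * (w + 1 : ℕ)) ^ n := by gcongr; simp
      calc _ = c * (2 * (2 * w) ^ n * √(2 * n * w)) * dec (m - j) := by ring
        _ ≤ _ := by gcongr; linarith
    · refine (coeFn_kopL2 _ _ _).trans ?_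
      rw [kop_congr (coeFn_kopL2 (avgKer j) (finRange_avgKer j) f)]
  · intro j hj f
    have hd := dec_pos (m - j)
    refine key (by positivity) ?_ (le_trans (eLpNorm_congr_ae ?_).le
      (h.fine hj (Lp.memLp f) (q := 2) (by norm_num) (by norm_num)))
    · change _ ≤ c * aoConst n w * dec (m - j)
      rw [aoConst]
      have e0 : (0 : ℝ) ≤ (2 * (w + 1 : ℕ)) ^ n := by positivity
      calc _ = c * (2 * (w + 1 : ℕ)) ^ n * dec (m - j) := by ring
        _ ≤ _ := by gcongr; nlinarith
    · refine (coeFn_kopL2 _ _ _).trans ?_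
      rw [kop_congr (g := fun y => f y - cavg j f y)]
      filter_upwards [Lp.coeFn_sub f (kopL2 (avgKer j) (finRange_avgKer j) f),
        coeFn_kopL2 (avgKer j) (finRange_avgKer j) f] with x hx hx'
      rw [hx, Pi.sub_apply, hx']

/-- Two-sided good kernels. -/
def BiGood (w : ℕ) (m : ℤ) (c : ℝ) (a : Rn n → Rn n → ℂ) : Prop :=
  GoodKer w m c a ∧ GoodKer w m c (adj a)

/-- The constant in the `L²` bound. -/
def l2Const (n w : ℕ) : ℝ := (2 / (1 - rho)) ^ 2 / rho ^ 2 * aoConst n w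

lemma l2Const_pos (n w : ℕ) : 0 < l2Const n w := by
  have := aoConst_pos n w
  have := rho_pos
  have : 0 < 1 - rho := by linarith [rho_lt_one]
  unfold l2Const
  positivity

/-- The `L²` bound for sums of good kernels. -/
lemma eLpNorm_two_le {w : ℕ} {c : ℝ} (F : Finset ℤ) {a : ℤ → Rn n → Rn n → ℂ}
    (hc : 0 ≤ c) (ha : ∀ m ∈ F, BiGood w m c (a m)) {f : Rn n → ℂ} (hf : MemLp f 2 volume) :
    eLpNorm (kop (fun x y => ∑ m ∈ F, a m x y) f) 2 volume ≤
      ENNReal.ofReal (l2Const n w * c) * eLpNorm f 2 volume := by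
  classical
  set A : ℤ → Lp ℂ 2 (volume : Measure (Rn n)) →L[ℂ] Lp ℂ 2 (volume : Measure (Rn n)) :=
    fun m => if h : m ∈ F then kopL2 (a m) (ha m h).1.finRange else 0 with hA
  have hAm : ∀ m (h : m ∈ F), A m = kopL2 (a m) (ha m h).1.finRange := fun m h => by simp [hA, h]
  have hao := aoConst_pos n w
  have h1 := norm_sum_le_of_scaleBound (projChain_cavg (n := n)) rho_pos rho_lt_one
    (c := c * aoConst n w) (by positivity) F A
    (fun m hm => by rw [hAm m hm]; exact (ha m hm).1.scaleBound)
    (fun m hm => by rw [hAm m hm, adjoint_kopL2]; exact (ha m hm).2.scaleBound) hf.toLp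
  have h3 : (∑ m ∈ F, A m hf.toLp : Lp ℂ 2 (volume : Measure (Rn n))) =ᵐ[volume]
      kop (fun x y => ∑ m ∈ F, a m x y) f := by
    have hfr : ∀ m ∈ F, FinRange (a m) := fun m hm => (ha m hm).1.finRange
    rw [funext fun x => kop_finset_sum F hfr (locInt hf) x]
    have h4 : ∀ m ∈ F, A m hf.toLp =ᵐ[volume] kop (a m) f := fun m hm => by
      rw [hAm m hm, ← kop_congr hf.coeFn_toLp]
      exact coeFn_kopL2 _ _ _
    have h5 : ∀ᵐ x, ∀ m ∈ F, A m hf.toLp x = kop (a m) f x :=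
      (Finset.eventually_all F).2 h4
    filter_upwards [Lp.coeFn_finsetSum F fun m => A m hf.toLp, h5] with x hx hx5
    rw [hx, Finset.sum_apply]
    exact Finset.sum_congr rfl hx5
  rw [← eLpNorm_congr_ae h3, ← eLpNorm_congr_ae hf.coeFn_toLp]
  rw [Lp.norm_def, Lp.norm_def] at h1
  rw [← ENNReal.ofReal_toReal (Lp.eLpNorm_ne_top hf.toLp), ← ENNReal.ofReal_mul
    (by have := l2Const_pos n w; positivity),
    ← ENNReal.ofReal_toReal (Lp.eLpNorm_ne_top (∑ m ∈ F, A m hf.toLp))]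
  refine ENNReal.ofReal_le_ofReal (h1.trans_eq ?_)
  rw [l2Const]; ring

end Coarse

/-! ### Stopping cubes and the weak type estimate -/

section Stopping

variable {n : ℕ}

/-- The union of the maximal cubes of side `2 ^ j` on which the average of `u` exceeds `α`. -/
def stopSet (u : Rn n → ℝ≥0∞) (α : ℝ≥0∞) (j : ℤ) : Set (Rn n) :=
  {x | α < eavg j u x ∧ ∀ i, j < i → eavg i u x ≤ α}

lemma cubeConst_stopSet (u : Rn n → ℝ≥0∞) (α : ℝ≥0∞) (j : ℤ) :
    CubeConst j (· ∈ stopSet u α j) := by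
  intro x y h
  have : ∀ i, j ≤ i → eavg i u x = eavg i u y := fun i hi =>
    cubeConst_eavg i u x y (idx_of_le hi h)
  refine propext ?_
  simp only [stopSet, mem_ofPred_eq, this j le_rfl]
  exact and_congr_right fun _ => forall₂_congr fun i hi => by rw [this i hi.le]

lemma eq_of_mem_stopSet {u : Rn n → ℝ≥0∞} {α : ℝ≥0∞} {i j : ℤ} {x : Rn n}
    (hi : x ∈ stopSet u α i) (hj : x ∈ stopSet u α j) : i = j := by
  rcases lt_trichotomy i j with h | h | h
  · exact absurd (hi.2 j h) (not_le.2 hj.1)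
  · exact h
  · exact absurd (hj.2 i h) (not_le.2 hi.1)

lemma pairwiseDisjoint_stopSet (u : Rn n → ℝ≥0∞) (α : ℝ≥0∞) (S : Set ℤ) :
    S.PairwiseDisjoint (stopSet u α) := fun _ _ _ _ hij =>
  Set.disjoint_left.2 fun _ hx hy => hij (eq_of_mem_stopSet hx hy)

lemma eavg_le_of_mem_stopSet {u : Rn n → ℝ≥0∞} {α : ℝ≥0∞} {j : ℤ} {x : Rn n}
    (hj : x ∈ stopSet u α j) : eavg j u x ≤ 2 ^ n * α :=
  (eavg_le_succ j u x).trans (by gcongr; exact hj.2 _ (lt_add_one j))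

lemma exists_eavg_le [NeZero n] {u : Rn n → ℝ≥0∞} (hu : ∫⁻ x, u x ≠ ⊤) {α : ℝ≥0∞} (hα : α ≠ 0)
    (hα' : α ≠ ⊤) (j0 : ℤ) : ∃ J, j0 ≤ J ∧ ∀ j, J ≤ j → ∀ x, eavg j u x ≤ α := by
  obtain ⟨N, hN⟩ := pow_unbounded_of_one_lt ((∫⁻ x, u x) / α).toReal (one_lt_two (α := ℝ))
  refine ⟨max j0 N, le_max_left _ _, fun j hj x => (eavg_le j u x).trans ?_⟩
  have hv : (2 : ℝ) ^ N ≤ cubeVol n j := by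
    have h1 : (2 : ℝ) ^ N ≤ 2 ^ j := by
      rw [← zpow_natCast]
      exact zpow_le_zpow_right₀ (by norm_num) ((le_max_right _ _).trans hj)
    have h2 : (1 : ℝ) ≤ 2 ^ j := (one_le_pow₀ (by norm_num)).trans h1
    exact h1.trans (le_self_pow₀ h2 (NeZero.ne n))
  have h3 : (∫⁻ x, u x) / α ≤ ENNReal.ofReal (cubeVol n j) := by
    rw [← ENNReal.ofReal_toReal (ENNReal.div_ne_top hu hα)]
    exact ENNReal.ofReal_le_ofReal (hN.le.trans hv)
  rw [mul_comm, ← div_eq_mul_inv]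
  refine ENNReal.div_le_of_le_mul ?_
  rw [mul_comm]
  exact (ENNReal.div_le_iff_le_mul (Or.inl hα) (Or.inl hα')).1 h3

lemma mul_volume_stopSet_le {u : Rn n → ℝ≥0∞} (hu : AEMeasurable u volume) (α : ℝ≥0∞) (j : ℤ) :
    α * volume (stopSet u α j) ≤ ∫⁻ x in stopSet u α j, u x := by
  rw [← lintegral_indicator_eavg (cubeConst_stopSet u α j) hu, ← setLIntegral_const]
  exact setLIntegral_mono' (cubeConst_stopSet u α j).measurableSet fun x hx => hx.1.le

/-- The part of `f` with mean zero on the stopping cubes of side `2 ^ j`. -/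
def badPart (f : Rn n → ℂ) (α : ℝ≥0∞) (j : ℤ) : Rn n → ℂ :=
  (stopSet (fun x => ‖f x‖ₑ) α j).indicator fun x => f x - cavg j f x

/-- A neighbourhood of `B` of width comparable to `w 2 ^ j`. -/
def enlarge (w : ℕ) (j : ℤ) (B : Set (Rn n)) : Set (Rn n) :=
  ⋃ z ∈ Fintype.piFinset (fun _ : Fin n => Finset.Icc (-w : ℤ) w),
    {x | x - WithLp.toLp 2 (fun i => (2 : ℝ) ^ j * (z i : ℝ)) ∈ B}

lemma volume_enlarge_le (w : ℕ) (j : ℤ) (B : Set (Rn n)) :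
    volume (enlarge w j B) ≤ (2 * w + 1 : ℕ) ^ n * volume B := by
  refine (measure_biUnion_finset_le _ _).trans ?_
  have : ∀ z : Fin n → ℤ,
      volume {x : Rn n | x - WithLp.toLp 2 (fun i => (2 : ℝ) ^ j * (z i : ℝ)) ∈ B} = volume B :=
    fun z => by
      simp only [sub_eq_add_neg]
      exact measure_preimage_add_right volume _ B
  simp only [this, Finset.sum_const, Fintype.card_piFinset, Int.card_Icc, Finset.prod_const,
    Finset.card_univ, Fintype.card_fin, nsmul_eq_mul]
  rw [show ((w : ℤ) + 1 - -w).toNat = 2 * w + 1 by omega]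
  simp

lemma measurableSet_enlarge (w : ℕ) (j : ℤ) {B : Set (Rn n)} (hB : MeasurableSet B) :
    MeasurableSet (enlarge w j B) :=
  Finset.measurableSet_biUnion _ fun _ _ => (measurable_sub_const _) hB

lemma mem_enlarge {w : ℕ} {j : ℤ} {B : Set (Rn n)} (hB : CubeConst j (· ∈ B)) {x y : Rn n}
    (hy : y ∈ B) (hxy : ∀ i, |x i - y i| ≤ w * (2 : ℝ) ^ j) : x ∈ enlarge w j B := by
  have hp : (0 : ℝ) < 2 ^ j := by positivity
  refine mem_iUnion₂.2 ⟨fun i => idx j x i - idx j y i, ?_, ?_⟩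
  · refine Fintype.mem_piFinset.2 fun i => Finset.mem_Icc.2 ?_
    have h1 := abs_le.1 (hxy i)
    have h2 : x i / 2 ^ j ≤ y i / 2 ^ j + (w : ℤ) := by
      rw [div_add' _ _ _ hp.ne']; gcongr; push_cast; linarith
    have h3 : y i / 2 ^ j ≤ x i / 2 ^ j + (w : ℤ) := by
      rw [div_add' _ _ _ hp.ne']; gcongr; push_cast; linarith
    have h4 := Int.floor_le_floor h2
    have h5 := Int.floor_le_floor h3
    rw [Int.floor_add_intCast] at h4 h5
    simp only [idx]
    constructor <;> omega
  · have : idx j (x - WithLp.toLp 2 fun i => (2 : ℝ) ^ j * ((idx j x i - idx j y i : ℤ) : ℝ)) =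
        idx j y := by
      funext i
      have : (x i - (2 : ℝ) ^ j * ((idx j x i - idx j y i : ℤ) : ℝ)) / 2 ^ j =
          x i / 2 ^ j + ((idx j y i - idx j x i : ℤ) : ℝ) := by
        field_simp; push_cast; ring
      simp only [idx, PiLp.sub_apply] at this ⊢
      rw [this, Int.floor_add_intCast]
      ring
    have h2 := hB _ _ this
    simp only [eq_iff_iff] at h2
    exact h2.2 hy

lemma sum_dec_le (F : Finset ℤ) (j : ℤ) : ∑ m ∈ F, dec (m - j) ≤ 2 / (1 - rho ^ 2) :=
  sum_pow_natAbs_le (by positivity)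
    (pow_lt_one₀ rho_pos.le rho_lt_one (by norm_num)) F j

/-- The constant in the Hörmander type estimate. -/
def horConst (n w : ℕ) : ℝ := 2 / (1 - rho ^ 2) * (2 * (w + 1 : ℕ)) ^ n

lemma sum_eLpNorm_fine_le {w : ℕ} (F : Finset ℤ) {c : ℝ} (hc : 0 ≤ c) {a : ℤ → Rn n → Rn n → ℂ}
    (ha : ∀ m ∈ F, GoodKer w m c (a m)) {j : ℤ} (hj : ∀ m ∈ F, j ≤ m) {f : Rn n → ℂ}
    (hf : MemLp f 2 volume) {q : ℝ≥0∞} (hq : 1 ≤ q) (hq' : q ≠ ⊤) :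
    ∑ m ∈ F, eLpNorm (kop (a m) fun y => f y - cavg j f y) q volume ≤
      ENNReal.ofReal (c * horConst n w) * eLpNorm f q volume := by
  calc _ ≤ ∑ m ∈ F, ENNReal.ofReal (c * dec (m - j) * (2 * (w + 1 : ℕ)) ^ n) *
        eLpNorm f q volume := Finset.sum_le_sum fun m hm => (ha m hm).fine (hj m hm) hf hq hq'
    _ = ENNReal.ofReal (∑ m ∈ F, c * dec (m - j) * (2 * (w + 1 : ℕ)) ^ n) *
        eLpNorm f q volume := by
        rw [← Finset.sum_mul, ENNReal.ofReal_sum_of_nonneg]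
        intro m _
        have := dec_pos (m - j)
        positivity
    _ ≤ _ := by
        gcongr
        rw [← Finset.sum_mul, ← Finset.mul_sum, horConst, ← mul_assoc]
        gcongr
        exact sum_dec_le F j

variable {w : ℕ} {F : Finset ℤ} {a : ℤ → Rn n → Rn n → ℂ}

lemma memLp_badPart {f : Rn n → ℂ} {q : ℝ≥0∞} (hq : 1 ≤ q) (hq' : q ≠ ⊤) (hf : MemLp f q volume)
    (α : ℝ≥0∞) (j : ℤ) : MemLp (badPart f α j) q volume :=
  (hf.sub (memLp_cavg j hq hq' hf)).indicator (cubeConst_stopSet _ α j).measurableSet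

lemma cavg_indicator {f : Rn n → ℂ} {j : ℤ} {B : Set (Rn n)} (hB : CubeConst j (· ∈ B)) :
    cavg j (B.indicator f) = B.indicator (cavg j f) := by
  funext x
  have h : ∀ y, avgKer j x y * B.indicator f y = B.indicator 1 x * (avgKer j x y * f y) := by
    intro y
    by_cases hxy : idx j y = idx j x
    · have h2 := hB y x hxy
      simp only [eq_iff_iff] at h2
      by_cases hx : x ∈ B
      · simp [hx, h2.2 hx]
      · have hy : y ∉ B := fun hy => hx (h2.1 hy)
        simp [hx, hy]
    · simp [avgKer, hxy]
  simp only [cavg, kop, h]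
  rw [integral_const_mul]
  by_cases hx : x ∈ B <;> simp [hx, kop]

lemma cavg_badPart {f : Rn n → ℂ} (hf : MemLp f 2 volume) (α : ℝ≥0∞) (j : ℤ) :
    cavg j (badPart f α j) = 0 := by
  rw [badPart, cavg_indicator (cubeConst_stopSet _ α j)]
  have : cavg j (fun x => f x - cavg j f x) = 0 := by
    funext x
    rw [cavg, kop_sub (finRange_avgKer j) (locInt hf)
      (locInt (memLp_cavg j (by norm_num) (by norm_num) hf))]
    have := congrFun (cavg_cavg_left le_rfl f (i := j)) x
    simp only [cavg] at this ⊢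
    rw [this]; simp
  rw [this]; simp

/-- The operator maps mean zero functions to functions small away from their supports. -/
lemma setLIntegral_kop_badPart_le (ha : ∀ m ∈ F, GoodKer w m 1 (a m)) {f : Rn n → ℂ}
    (hf : MemLp f 2 volume) (α : ℝ≥0∞) (j : ℤ) :
    ∫⁻ x in (enlarge w j (stopSet (fun x => ‖f x‖ₑ) α j))ᶜ,
      ‖kop (fun x y => ∑ m ∈ F, a m x y) (badPart f α j) x‖ₑ ≤
      ENNReal.ofReal (horConst n w) * eLpNorm (badPart f α j) 1 volume := by
  set B := stopSet (fun x => ‖f x‖ₑ) α j with hB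
  have hBm : MeasurableSet B := (cubeConst_stopSet _ α j).measurableSet
  set b := badPart f α j
  have hb : MemLp b 2 volume := memLp_badPart (by norm_num) (by norm_num) hf α j
  have hb0 : (fun y => b y - cavg j b y) = b := by
    funext y; rw [cavg_badPart hf]; simp
  set F' := F.filter (j ≤ ·)
  have h1 : ∀ x ∈ (enlarge w j B)ᶜ, ‖kop (fun x y => ∑ m ∈ F, a m x y) b x‖ₑ ≤
      ∑ m ∈ F', ‖kop (a m) b x‖ₑ := by
    intro x hx
    rw [kop_finset_sum F (fun m hm => (ha m hm).finRange) (locInt hb)]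
    have : ∀ m ∈ F, m ∉ F' → kop (a m) b x = 0 := by
      intro m hm hm'
      have hmj : m < j := by
        by_contra h
        exact hm' (Finset.mem_filter.2 ⟨hm, not_lt.1 h⟩)
      rw [kop]
      refine integral_eq_zero_of_ae (Eventually.of_forall fun y => ?_)
      by_contra hne
      have hy1 : a m x y ≠ 0 := left_ne_zero_of_mul hne
      have hy2 : y ∈ B := by
        by_contra hy
        exact right_ne_zero_of_mul hne (indicator_of_notMem hy _)
      refine hx (mem_enlarge (cubeConst_stopSet _ α j) hy2 fun i => ?_)
      refine ((ha m hm).supp x y hy1 i).trans ?_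
      gcongr
      norm_num
    rw [← Finset.sum_subset (Finset.filter_subset _ _) this]
    exact enorm_sum_le _ _
  calc _ ≤ ∫⁻ x in (enlarge w j B)ᶜ, ∑ m ∈ F', ‖kop (a m) b x‖ₑ :=
        setLIntegral_mono' (measurableSet_enlarge w j hBm).compl h1
    _ ≤ ∫⁻ x, ∑ m ∈ F', ‖kop (a m) b x‖ₑ := setLIntegral_le_lintegral _ _
    _ = ∑ m ∈ F', ∫⁻ x, ‖kop (a m) b x‖ₑ := lintegral_finsetSum' _ fun m hm =>
        (aestronglyMeasurable_kop (ha m (Finset.mem_filter.1 hm).1).finRange hb.1).enorm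
    _ = ∑ m ∈ F', eLpNorm (kop (a m) fun y => b y - cavg j b y) 1 volume := by
        rw [hb0]; simp only [eLpNorm_one_eq_lintegral_enorm]
    _ ≤ ENNReal.ofReal (1 * horConst n w) * eLpNorm b 1 volume :=
        sum_eLpNorm_fine_le F' zero_le_one (fun m hm => ha m (Finset.mem_filter.1 hm).1)
          (fun m hm => (Finset.mem_filter.1 hm).2) hb le_rfl (by norm_num)
    _ = _ := by rw [one_mul]

lemma eLpNorm_badPart_le {f : Rn n → ℂ} (hf : AEStronglyMeasurable f volume) (α : ℝ≥0∞) (j : ℤ) :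
    eLpNorm (badPart f α j) 1 volume ≤
      2 * ∫⁻ x in stopSet (fun x => ‖f x‖ₑ) α j, ‖f x‖ₑ := by
  set B := stopSet (fun x => ‖f x‖ₑ) α j with hB
  have hBm : MeasurableSet B := (cubeConst_stopSet _ α j).measurableSet
  rw [eLpNorm_one_eq_lintegral_enorm]
  simp only [badPart, enorm_indicator_eq_indicator_enorm]
  rw [lintegral_indicator hBm]
  calc _ ≤ ∫⁻ x in B, (‖f x‖ₑ + eavg j (fun y => ‖f y‖ₑ) x) := by
        refine lintegral_mono fun x => enorm_sub_le.trans ?_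
        gcongr
        exact enorm_cavg_le j f x
    _ = (∫⁻ x in B, ‖f x‖ₑ) + ∫⁻ x in B, eavg j (fun y => ‖f y‖ₑ) x :=
        lintegral_add_left' hf.enorm.restrict _
    _ = _ := by rw [lintegral_indicator_eavg (cubeConst_stopSet _ α j) hf.enorm, two_mul]

end Stopping

section WeakType

variable {n : ℕ}

lemma exists_mem_stopSet {u : Rn n → ℝ≥0∞} {α : ℝ≥0∞} {j0 J : ℤ} (hJ0 : j0 ≤ J)
    (hJ : ∀ j, J ≤ j → ∀ x, eavg j u x ≤ α) {x : Rn n} (hx : α < eavg j0 u x) :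
    ∃ j ∈ Finset.Ico j0 J, x ∈ stopSet u α j := by
  classical
  set S := (Finset.Ico j0 J).filter fun j => α < eavg j u x
  have hlt : j0 < J := lt_of_le_of_ne hJ0 fun h => (hJ j0 h.ge x).not_gt hx
  have hS : S.Nonempty :=
    ⟨j0, Finset.mem_filter.2 ⟨Finset.mem_Ico.2 ⟨le_rfl, hlt⟩, hx⟩⟩
  have hm := Finset.mem_filter.1 (S.max'_mem hS)
  refine ⟨S.max' hS, hm.1, hm.2, fun i hi => ?_⟩
  by_contra hlt'
  rw [not_le] at hlt'
  have hiJ : i < J := by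
    by_contra h
    exact (hJ i (not_lt.1 h) x).not_gt hlt'
  have : i ∈ S := Finset.mem_filter.2
    ⟨Finset.mem_Ico.2 ⟨(Finset.mem_Ico.1 hm.1).1.trans hi.le, hiJ⟩, hlt'⟩
  exact (S.le_max' i this).not_gt hi

/-- The bounded part of the decomposition at height `α`. -/
def goodPart (f : Rn n → ℂ) (α : ℝ≥0∞) (S : Finset ℤ) (x : Rn n) : ℂ :=
  f x - ∑ j ∈ S, badPart f α j x

lemma goodPart_of_mem {f : Rn n → ℂ} {α : ℝ≥0∞} {S : Finset ℤ} {j : ℤ} (hj : j ∈ S) {x : Rn n}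
    (hx : x ∈ stopSet (fun x => ‖f x‖ₑ) α j) : goodPart f α S x = cavg j f x := by
  have : ∑ i ∈ S, badPart f α i x = f x - cavg j f x := by
    rw [Finset.sum_eq_single_of_mem j hj]
    · exact indicator_of_mem hx _
    · exact fun i _ hij => indicator_of_notMem (fun h => hij (eq_of_mem_stopSet h hx)) _
  rw [goodPart, this]; ring

lemma goodPart_of_notMem {f : Rn n → ℂ} {α : ℝ≥0∞} {S : Finset ℤ} {x : Rn n}
    (hx : ∀ j ∈ S, x ∉ stopSet (fun x => ‖f x‖ₑ) α j) : goodPart f α S x = f x := by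
  have : ∑ i ∈ S, badPart f α i x = 0 :=
    Finset.sum_eq_zero fun i hi => indicator_of_notMem (hx i hi) _
  rw [goodPart, this, sub_zero]

lemma lintegral_goodPart_le {f : Rn n → ℂ} {α : ℝ≥0∞} {j0 J : ℤ} (hf : CubeConst j0 f)
    (hJ0 : j0 ≤ J) (hJ : ∀ j, J ≤ j → ∀ x, eavg j (fun x => ‖f x‖ₑ) x ≤ α) :
    ∫⁻ x, ‖goodPart f α (Finset.Ico j0 J) x‖ₑ ^ (2 : ℝ) ≤
      (∫⁻ x in {x | ‖f x‖ₑ ≤ α}, ‖f x‖ₑ ^ (2 : ℝ)) + (2 ^ n * α) ^ (2 : ℝ) *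
        volume (⋃ j ∈ Finset.Ico j0 J, stopSet (fun x => ‖f x‖ₑ) α j) := by
  set u : Rn n → ℝ≥0∞ := fun x => ‖f x‖ₑ
  have hu : CubeConst j0 u := fun x y h => by simp only [u, hf x y h]
  set O := ⋃ j ∈ Finset.Ico j0 J, stopSet u α j with hO
  have hOm : MeasurableSet O := Finset.measurableSet_biUnion _ fun j _ =>
    (cubeConst_stopSet u α j).measurableSet
  have hsm : MeasurableSet {x | u x ≤ α} := measurableSet_le hu.measurable measurable_const
  rw [← setLIntegral_const, ← lintegral_indicator hOm, ← lintegral_indicator hsm,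
    ← lintegral_add_left ((hu.measurable.pow_const 2).indicator hsm)]
  refine lintegral_mono fun x => ?_
  by_cases hx : x ∈ O
  · obtain ⟨j, hj, hxj⟩ := mem_iUnion₂.1 hx
    refine le_trans ?_ (le_add_left le_rfl)
    rw [indicator_of_mem hx, goodPart_of_mem hj hxj]
    gcongr
    exact (enorm_cavg_le j f x).trans (eavg_le_of_mem_stopSet hxj)
  · have h1 : u x ≤ α := by
      by_contra h
      rw [not_le, ← eavg_of_cubeConst hu] at h
      obtain ⟨j, hj, hxj⟩ := exists_mem_stopSet hJ0 hJ h
      exact hx (mem_iUnion₂.2 ⟨j, hj, hxj⟩)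
    refine le_trans ?_ (le_add_right le_rfl)
    have h2 : x ∈ {x | u x ≤ α} := h1
    rw [indicator_of_mem h2, goodPart_of_notMem fun j hj hxj => hx (mem_iUnion₂.2 ⟨j, hj, hxj⟩)]

lemma setLIntegral_stop_le {u : Rn n → ℝ≥0∞} (hu : Measurable u) (hui : ∫⁻ x, u x ≠ ⊤)
    (α : ℝ≥0∞) (S : Finset ℤ) :
    α * volume (⋃ j ∈ S, stopSet u α j) ≤ (∫⁻ x in ⋃ j ∈ S, stopSet u α j, u x) ∧
    ∫⁻ x in ⋃ j ∈ S, stopSet u α j, u x ≤ 2 * ∫⁻ x in {x | α / 2 < u x}, u x := by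
  set O := ⋃ j ∈ S, stopSet u α j with hO
  have hm : ∀ j ∈ S, MeasurableSet (stopSet u α j) := fun j _ =>
    (cubeConst_stopSet u α j).measurableSet
  have hOm : MeasurableSet O := Finset.measurableSet_biUnion _ hm
  have h1 : α * volume O ≤ ∫⁻ x in O, u x := by
    rw [hO, measure_biUnion_finset (pairwiseDisjoint_stopSet u α _) hm,
      lintegral_biUnion_finset (pairwiseDisjoint_stopSet u α _) hm, Finset.mul_sum]
    exact Finset.sum_le_sum fun j _ => mul_volume_stopSet_le hu.aemeasurable α j
  refine ⟨h1, ?_⟩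
  have hsm : MeasurableSet {x | α / 2 < u x} := measurableSet_lt measurable_const hu
  have hfin : ∫⁻ x in O, u x ≠ ⊤ := (setLIntegral_le_lintegral _ _).trans_lt hui.lt_top |>.ne
  have h2 : ∫⁻ x in O, u x ≤ (∫⁻ x in {x | α / 2 < u x}, u x) + α / 2 * volume O := by
    rw [← setLIntegral_const, ← lintegral_indicator hOm, ← lintegral_indicator hOm,
      ← lintegral_indicator hsm, ← lintegral_add_left (hu.indicator hsm)]
    refine lintegral_mono fun x => ?_
    by_cases hx : x ∈ O
    · rw [indicator_of_mem hx, indicator_of_mem hx]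
      by_cases hx' : α / 2 < u x
      · have : x ∈ {x | α / 2 < u x} := hx'
        rw [indicator_of_mem this]
        exact le_add_right le_rfl
      · exact (not_lt.1 hx').trans (le_add_left le_rfl)
    · rw [indicator_of_notMem hx]; exact zero_le
  have h3 : (∫⁻ x in O, u x) + ∫⁻ x in O, u x ≤
      2 * (∫⁻ x in {x | α / 2 < u x}, u x) + ∫⁻ x in O, u x := by
    calc _ = 2 * ∫⁻ x in O, u x := (two_mul _).symm
      _ ≤ 2 * ((∫⁻ x in {x | α / 2 < u x}, u x) + α / 2 * volume O) := by gcongr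
      _ = 2 * (∫⁻ x in {x | α / 2 < u x}, u x) + α * volume O := by
          rw [mul_add, ← mul_assoc 2 (α / 2), ENNReal.mul_div_cancel two_ne_zero
            ENNReal.ofNat_ne_top]
      _ ≤ _ := by gcongr
  exact (ENNReal.add_le_add_iff_right hfin).1 h3

/-- The constant in the weak type estimate. -/
def weakConst (n w : ℕ) : ℝ≥0∞ :=
  2 * (ENNReal.ofReal (l2Const n w) ^ (2 : ℝ) * (2 ^ n) ^ (2 : ℝ) + (2 * w + 1 : ℕ) ^ n +
    2 * ENNReal.ofReal (horConst n w))

lemma weakConst_ne_top (n w : ℕ) : weakConst n w ≠ ⊤ := by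
  have h1 : ENNReal.ofReal (l2Const n w) ^ (2 : ℝ) ≠ ⊤ :=
    ENNReal.rpow_ne_top_of_nonneg (by norm_num) ENNReal.ofReal_ne_top
  have h2 : ((2 : ℝ≥0∞) ^ n) ^ (2 : ℝ) ≠ ⊤ :=
    ENNReal.rpow_ne_top_of_nonneg (by norm_num) (ENNReal.pow_ne_top ENNReal.ofNat_ne_top)
  have h3 : ((2 * w + 1 : ℕ) : ℝ≥0∞) ^ n ≠ ⊤ := ENNReal.pow_ne_top (ENNReal.natCast_ne_top _)
  exact ENNReal.mul_ne_top ENNReal.ofNat_ne_top (ENNReal.add_ne_top.2 ⟨ENNReal.add_ne_top.2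
    ⟨ENNReal.mul_ne_top h1 h2, h3⟩, ENNReal.mul_ne_top ENNReal.ofNat_ne_top
    ENNReal.ofReal_ne_top⟩)

variable {w : ℕ} {F : Finset ℤ} {a : ℤ → Rn n → Rn n → ℂ}

lemma weak_type [NeZero n] (ha : ∀ m ∈ F, BiGood w m 1 (a m)) {f : Rn n → ℂ} {j0 : ℤ}
    (hf : CubeConst j0 f) (hf1 : MemLp f 1 volume) (hf2 : MemLp f 2 volume) {α : ℝ≥0∞}
    (hα : α ≠ 0) (hα' : α ≠ ⊤) :
    volume {x | 2 * α < ‖kop (fun x y => ∑ m ∈ F, a m x y) f x‖ₑ} ≤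
      weakConst n w * ((∫⁻ x in {x | ‖f x‖ₑ ≤ α}, ‖f x‖ₑ ^ (2 : ℝ)) / α ^ (2 : ℝ) +
        (∫⁻ x in {x | α / 2 < ‖f x‖ₑ}, ‖f x‖ₑ) / α) := by
  set u : Rn n → ℝ≥0∞ := fun x => ‖f x‖ₑ
  have hu : CubeConst j0 u := fun x y h => by simp only [u, hf x y h]
  have hui : ∫⁻ x, u x ≠ ⊤ := by
    have := hf1.2
    rw [eLpNorm_one_eq_lintegral_enorm] at this
    exact this.ne
  obtain ⟨J, hJ0, hJ⟩ := exists_eavg_le hui hα hα' j0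
  set S := Finset.Ico j0 J
  set T : Rn n → Rn n → ℂ := fun x y => ∑ m ∈ F, a m x y with hT
  have hTf : FinRange T := FinRange.sum F fun m hm => (ha m hm).1.finRange
  set B := stopSet u α
  have hBm : ∀ j, MeasurableSet (B j) := fun j => (cubeConst_stopSet u α j).measurableSet
  set O := ⋃ j ∈ S, B j with hO
  set b := badPart f α
  set g := goodPart f α S
  have hb2 : ∀ j, MemLp (b j) 2 volume := fun j =>
    memLp_badPart (by norm_num) (by norm_num) hf2 α j
  have hg2 : MemLp g 2 volume := hf2.sub (memLp_finsetSum S fun j _ => hb2 j)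
  have hsplit : ∀ x, kop T f x = kop T g x + ∑ j ∈ S, kop T (b j) x := by
    intro x
    have h1 : f = fun y => g y + ∑ j ∈ S, b j y := by
      funext y; simp only [g, goodPart, b]; ring
    have h2 : MemLp (fun y => ∑ j ∈ S, b j y) 2 volume := memLp_finsetSum S fun j _ => hb2 j
    conv_lhs => rw [h1]
    rw [kop_add hTf (locInt hg2) (locInt h2), kop_finset_sum_fun S hTf fun j _ => locInt (hb2 j)]
  set X := ∫⁻ x in {x | u x ≤ α}, u x ^ (2 : ℝ)
  set Y := ∫⁻ x in {x | α / 2 < u x}, u x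
  set I := ∫⁻ x in O, u x with hI
  set L := ENNReal.ofReal (l2Const n w)
  set H := ENNReal.ofReal (horConst n w)
  obtain ⟨hV, hIY⟩ := setLIntegral_stop_le hu.measurable hui α S
  have hVI : volume O ≤ I / α := by
    rw [ENNReal.le_div_iff_mul_le (Or.inl hα) (Or.inl hα'), mul_comm]; exact hV
  set G : Rn n → ℝ≥0∞ := fun x =>
    ∑ j ∈ S, (enlarge w j (B j))ᶜ.indicator (fun x => ‖kop T (b j) x‖ₑ) x
  have hEm : ∀ j, MeasurableSet (enlarge w j (B j))ᶜ := fun j =>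
    (measurableSet_enlarge w j (hBm j)).compl
  have hGm : ∀ j ∈ S, AEMeasurable
      ((enlarge w j (B j))ᶜ.indicator (fun x => ‖kop T (b j) x‖ₑ)) volume := fun j _ =>
    (aestronglyMeasurable_kop hTf (hb2 j).1).enorm.indicator (hEm j)
  have hGi : ∫⁻ x, G x ≤ H * (2 * I) := by
    calc _ = ∑ j ∈ S, ∫⁻ x in (enlarge w j (B j))ᶜ, ‖kop T (b j) x‖ₑ := by
          rw [lintegral_finsetSum' S hGm]
          exact Finset.sum_congr rfl fun j _ => lintegral_indicator (hEm j) _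
      _ ≤ ∑ j ∈ S, H * (2 * ∫⁻ x in B j, u x) := by
          refine Finset.sum_le_sum fun j _ => (setLIntegral_kop_badPart_le
            (fun m hm => (ha m hm).1) hf2 α j).trans ?_
          gcongr
          exact eLpNorm_badPart_le hf2.1 α j
      _ = _ := by
          rw [← Finset.mul_sum, ← Finset.mul_sum, hI, hO,
            lintegral_biUnion_finset (pairwiseDisjoint_stopSet u α _) fun j _ => hBm j]
  have hsub : {x | 2 * α < ‖kop T f x‖ₑ} ⊆
      ({x | α ≤ ‖kop T g x‖ₑ} ∪ ⋃ j ∈ S, enlarge w j (B j)) ∪ {x | α ≤ G x} := by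
    intro x hx
    by_contra hc
    simp only [mem_union, not_or, mem_iUnion, not_exists, mem_ofPred_eq, not_le] at hc
    obtain ⟨⟨h1, h2⟩, h3⟩ := hc
    refine lt_irrefl (2 * α) (lt_of_lt_of_le hx ?_)
    rw [hsplit, two_mul]
    refine (enorm_add_le _ _).trans (add_le_add h1.le ((enorm_sum_le _ _).trans ?_))
    refine (Finset.sum_le_sum fun j hj => ?_).trans h3.le
    rw [indicator_of_mem (h2 j hj)]
  have e1 : volume {x | α ≤ ‖kop T g x‖ₑ} ≤ L ^ (2 : ℝ) *
      (X + (2 ^ n * α) ^ (2 : ℝ) * volume O) / α ^ (2 : ℝ) := by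
    have h1 : ∫⁻ x, ‖kop T g x‖ₑ ^ (2 : ℝ) ≤ L ^ (2 : ℝ) * ∫⁻ x, ‖g x‖ₑ ^ (2 : ℝ) := by
      have := eLpNorm_two_le F zero_le_one ha hg2
      rw [eLpNorm_eq_lintegral_rpow_enorm_toReal (by norm_num) (by norm_num),
        eLpNorm_eq_lintegral_rpow_enorm_toReal (by norm_num) (by norm_num), mul_one] at this
      simp only [ENNReal.toReal_ofNat] at this
      have h2 := ENNReal.rpow_le_rpow this (z := 2) (by norm_num)
      rwa [ENNReal.mul_rpow_of_nonneg _ _ (by norm_num), ← ENNReal.rpow_mul, ← ENNReal.rpow_mul,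
        one_div, inv_mul_cancel₀ (by norm_num), ENNReal.rpow_one, ENNReal.rpow_one] at h2
    have h2 : {x | α ≤ ‖kop T g x‖ₑ} = {x | α ^ (2 : ℝ) ≤ ‖kop T g x‖ₑ ^ (2 : ℝ)} := by
      ext x
      simp only [mem_ofPred_eq]
      rw [ENNReal.rpow_le_rpow_iff (by norm_num)]
    rw [h2]
    refine (meas_ge_le_lintegral_div
      ((aestronglyMeasurable_kop hTf hg2.1).enorm.pow_const 2) ?_ ?_).trans ?_
    · simp [hα]
    · simp [hα']
    · gcongr
      refine h1.trans ?_
      gcongr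
      exact lintegral_goodPart_le hf hJ0 hJ
  have e2 : volume (⋃ j ∈ S, enlarge w j (B j)) ≤ (2 * w + 1 : ℕ) ^ n * volume O := by
    rw [hO, measure_biUnion_finset (pairwiseDisjoint_stopSet u α _) fun j _ => hBm j,
      Finset.mul_sum]
    exact (measure_biUnion_finset_le _ _).trans
      (Finset.sum_le_sum fun j _ => volume_enlarge_le w j (B j))
  have e3 : volume {x | α ≤ G x} ≤ H * (2 * I) / α :=
    (meas_ge_le_lintegral_div (Finset.aemeasurable_fun_sum S hGm) hα hα').trans (by gcongr)
  have e4 : L ^ (2 : ℝ) * (X + (2 ^ n * α) ^ (2 : ℝ) * volume O) / α ^ (2 : ℝ) =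
      L ^ (2 : ℝ) * (X / α ^ (2 : ℝ)) + L ^ (2 : ℝ) * (2 ^ n) ^ (2 : ℝ) * volume O := by
    have h0 : α ^ (2 : ℝ) * (α ^ (2 : ℝ))⁻¹ = 1 := ENNReal.mul_inv_cancel (by simp [hα])
      (by simp [hα'])
    rw [ENNReal.mul_rpow_of_nonneg _ _ (by norm_num), div_eq_mul_inv, div_eq_mul_inv]
    calc _ = L ^ (2 : ℝ) * (X * (α ^ (2 : ℝ))⁻¹) + L ^ (2 : ℝ) * (2 ^ n) ^ (2 : ℝ) * volume O *
        (α ^ (2 : ℝ) * (α ^ (2 : ℝ))⁻¹) := by ring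
      _ = _ := by rw [h0, mul_one]
  have hIα : I / α ≤ 2 * (Y / α) := by
    rw [← mul_div_assoc]; gcongr
  have hL : L ^ (2 : ℝ) ≤ weakConst n w := by
    have : (1 : ℝ≥0∞) ≤ 2 * (2 ^ n) ^ (2 : ℝ) := by
      refine one_le_mul one_le_two (ENNReal.one_le_rpow (one_le_pow₀ one_le_two) (by norm_num))
    calc L ^ (2 : ℝ) = L ^ (2 : ℝ) * 1 := (mul_one _).symm
      _ ≤ L ^ (2 : ℝ) * (2 * (2 ^ n) ^ (2 : ℝ)) := by gcongr
      _ = 2 * (L ^ (2 : ℝ) * (2 ^ n) ^ (2 : ℝ)) := by ring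
      _ ≤ _ := by
        rw [weakConst]
        gcongr
        rw [add_assoc]
        exact le_add_right le_rfl
  calc _ ≤ volume {x | α ≤ ‖kop T g x‖ₑ} + volume (⋃ j ∈ S, enlarge w j (B j)) +
        volume {x | α ≤ G x} := (measure_mono hsub).trans ((measure_union_le _ _).trans
          (by gcongr; exact measure_union_le _ _))
    _ ≤ (L ^ (2 : ℝ) * (X / α ^ (2 : ℝ)) + L ^ (2 : ℝ) * (2 ^ n) ^ (2 : ℝ) * (I / α)) +
        (2 * w + 1 : ℕ) ^ n * (I / α) + 2 * H * (I / α) := by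
        refine add_le_add (add_le_add (e1.trans ?_) (e2.trans ?_)) (e3.trans_eq ?_)
        · rw [e4]; gcongr
        · gcongr
        · rw [mul_comm 2 H, mul_assoc, ← mul_div_assoc, ← mul_div_assoc]
    _ = L ^ (2 : ℝ) * (X / α ^ (2 : ℝ)) + (L ^ (2 : ℝ) * (2 ^ n) ^ (2 : ℝ) +
        (2 * w + 1 : ℕ) ^ n + 2 * H) * (I / α) := by ring
    _ ≤ weakConst n w * (X / α ^ (2 : ℝ)) + (L ^ (2 : ℝ) * (2 ^ n) ^ (2 : ℝ) +
        (2 * w + 1 : ℕ) ^ n + 2 * H) * (2 * (Y / α)) := by gcongr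
    _ = _ := by rw [weakConst]; ring

end WeakType

/-! ### Interpolation -/

section Interpolation

/-- The right-hand side of the truncated weak type estimate at height `t`, for the value `s`. -/
def weakIntegrand (t s : ℝ) : ℝ≥0∞ :=
  ENNReal.ofReal (if s ≤ t then s ^ 2 / t ^ 2 else 0) +
    ENNReal.ofReal (if t / 2 < s then s / t else 0)

lemma measurable_weakIntegrand : Measurable (Function.uncurry weakIntegrand) := by
  change Measurable fun q : ℝ × ℝ => ENNReal.ofReal (if q.2 ≤ q.1 then q.2 ^ 2 / q.1 ^ 2 else 0) +
    ENNReal.ofReal (if q.1 / 2 < q.2 then q.2 / q.1 else 0)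
  have h1 : Measurable fun q : ℝ × ℝ => if q.2 ≤ q.1 then q.2 ^ 2 / q.1 ^ 2 else 0 :=
    Measurable.ite (measurableSet_le measurable_snd measurable_fst) (by fun_prop) measurable_const
  have h2 : Measurable fun q : ℝ × ℝ => if q.1 / 2 < q.2 then q.2 / q.1 else 0 :=
    Measurable.ite (measurableSet_lt (measurable_fst.div_const 2) measurable_snd) (by fun_prop)
      measurable_const
  exact h1.ennreal_ofReal.add h2.ennreal_ofReal

/-- The constant in the interpolation estimate. -/
def interpConst (p : ℝ) : ℝ := 1 / (2 - p) + 2 ^ (p - 1) / (p - 1)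

lemma lintegral_weakIntegrand_le {p : ℝ} (hp1 : 1 < p) (hp2 : p < 2) {s : ℝ} (hs : 0 ≤ s) :
    ∫⁻ t in Ioi (0 : ℝ), weakIntegrand t s * ENNReal.ofReal (t ^ (p - 1)) ≤
      ENNReal.ofReal (interpConst p * s ^ p) := by
  rcases hs.eq_or_lt with rfl | hs
  · have : ∀ t ∈ Ioi (0 : ℝ), weakIntegrand t 0 * ENNReal.ofReal (t ^ (p - 1)) = 0 := by
      intro t ht
      simp [weakIntegrand]
    rw [setLIntegral_congr_fun measurableSet_Ioi this]
    simp
  have e1 : ∫⁻ t in Ioi s, ENNReal.ofReal (s ^ 2 * t ^ (p - 3)) =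
      ENNReal.ofReal (s ^ p / (2 - p)) := by
    rw [← ofReal_integral_eq_lintegral_ofReal]
    · rw [integral_const_mul, integral_Ioi_rpow_of_lt (by linarith) hs]
      congr 1
      rw [show p - 3 + 1 = p - 2 by ring, neg_div, ← div_neg, neg_sub, ← mul_div_assoc]
      congr 1
      rw [← Real.rpow_natCast s 2, ← Real.rpow_add hs]
      congr 1; push_cast; ring
    · exact (integrableOn_Ioi_rpow_of_lt (by linarith) hs).const_mul _
    · refine (ae_restrict_mem measurableSet_Ioi).mono fun t ht => ?_
      have : (0 : ℝ) < t := hs.trans ht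
      simp only [Pi.zero_apply]; positivity
  have e2 : ∫⁻ t in Ioc 0 (2 * s), ENNReal.ofReal (s * t ^ (p - 2)) =
      ENNReal.ofReal (2 ^ (p - 1) / (p - 1) * s ^ p) := by
    rw [← ofReal_integral_eq_lintegral_ofReal]
    · rw [integral_const_mul, ← intervalIntegral.integral_of_le (by linarith),
        integral_rpow (Or.inl (by linarith))]
      congr 1
      rw [show p - 2 + 1 = p - 1 by ring, Real.zero_rpow (by linarith), sub_zero,
        Real.mul_rpow (by norm_num) hs.le]
      have : s ^ p = s * s ^ (p - 1) := by
        rw [← Real.rpow_one_add' hs.le (by linarith)]; congr 1; ring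
      rw [this]; ring
    · have := (intervalIntegral.intervalIntegrable_rpow' (a := 0) (b := 2 * s) (r := p - 2)
        (by linarith)).const_mul s
      exact (intervalIntegrable_iff_integrableOn_Ioc_of_le (by linarith)).1 this
    · refine (ae_restrict_mem measurableSet_Ioc).mono fun t ht => ?_
      have : (0 : ℝ) < t := ht.1
      simp only [Pi.zero_apply]; positivity
  have hm1 : Measurable fun t : ℝ => ENNReal.ofReal (s ^ 2 * t ^ (p - 3)) := by fun_prop
  have hm2 : Measurable fun t : ℝ => ENNReal.ofReal (s * t ^ (p - 2)) := by fun_prop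
  calc _ ≤ ∫⁻ t in Ioi (0 : ℝ), ((Ici s).indicator (fun t => ENNReal.ofReal (s ^ 2 * t ^ (p - 3))) t +
        (Ioc 0 (2 * s)).indicator (fun t => ENNReal.ofReal (s * t ^ (p - 2))) t) := by
        refine setLIntegral_mono' measurableSet_Ioi fun t (ht : 0 < t) => ?_
        rw [weakIntegrand, add_mul]
        refine add_le_add ?_ ?_
        · split_ifs with h
          · rw [indicator_of_mem (mem_Ici.2 h), ← ENNReal.ofReal_mul (by positivity)]
            refine (congrArg _ ?_).le
            rw [div_mul_eq_mul_div, mul_div_assoc]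
            congr 1
            rw [← Real.rpow_natCast t 2, ← Real.rpow_sub ht]
            congr 1; push_cast; ring
          · simp
        · split_ifs with h
          · rw [indicator_of_mem (mem_Ioc.2 ⟨ht, by linarith⟩),
              ← ENNReal.ofReal_mul (by positivity)]
            refine (congrArg _ ?_).le
            rw [div_mul_eq_mul_div, mul_div_assoc]
            congr 1
            rw [← Real.rpow_sub_one ht.ne']
            congr 1; ring
          · simp
    _ ≤ ∫⁻ t, ((Ici s).indicator (fun t => ENNReal.ofReal (s ^ 2 * t ^ (p - 3))) t +
        (Ioc 0 (2 * s)).indicator (fun t => ENNReal.ofReal (s * t ^ (p - 2))) t) :=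
        setLIntegral_le_lintegral _ _
    _ = ENNReal.ofReal (s ^ p / (2 - p)) + ENNReal.ofReal (2 ^ (p - 1) / (p - 1) * s ^ p) := by
        rw [lintegral_add_left (hm1.indicator measurableSet_Ici),
          lintegral_indicator measurableSet_Ici, lintegral_indicator measurableSet_Ioc, e2,
          setLIntegral_congr Ioi_ae_eq_Ici.symm, e1]
    _ = _ := by
        have : 0 < 2 - p := by linarith
        have : 0 < p - 1 := by linarith
        rw [← ENNReal.ofReal_add (by positivity) (by positivity), interpConst]
        congr 1; ring

lemma lintegral_rpow_le_of_weak {X : Type*} [MeasurableSpace X] {μ : Measure X} [SFinite μ]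
    {U V : X → ℝ} (hU : AEMeasurable U μ) (hV : AEMeasurable V μ) (hU0 : ∀ x, 0 ≤ U x)
    (hV0 : ∀ x, 0 ≤ V x) {p : ℝ} (hp1 : 1 < p) (hp2 : p < 2) {K : ℝ≥0∞}
    (h : ∀ t > 0, μ {x | t < V x} ≤ K * ∫⁻ x, weakIntegrand t (U x) ∂μ) :
    ∫⁻ x, ENNReal.ofReal (V x ^ p) ∂μ ≤
      ENNReal.ofReal p * K * ENNReal.ofReal (interpConst p) * ∫⁻ x, ENNReal.ofReal (U x ^ p) ∂μ := by
  rw [lintegral_rpow_eq_lintegral_meas_lt_mul μ (Eventually.of_forall hV0) hV (by linarith)]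
  have hint : 0 ≤ interpConst p := by
    have : 0 < 2 - p := by linarith
    have : 0 < p - 1 := by linarith
    unfold interpConst; positivity
  have hUe : AEMeasurable (fun q : ℝ × X => (q.1, U q.2)) ((volume.restrict (Ioi 0)).prod μ) :=
    measurable_fst.aemeasurable.prodMk hU.comp_snd
  have hm : AEMeasurable (Function.uncurry fun (t : ℝ) (x : X) =>
      weakIntegrand t (U x) * ENNReal.ofReal (t ^ (p - 1))) ((volume.restrict (Ioi 0)).prod μ) :=
    AEMeasurable.mul (measurable_weakIntegrand.comp_aemeasurable hUe)
      (by fun_prop)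
  have hmt : ∀ t : ℝ, AEMeasurable (fun x => weakIntegrand t (U x)) μ := fun t =>
    (measurable_weakIntegrand.comp measurable_prodMk_left).comp_aemeasurable hU
  calc _ ≤ ENNReal.ofReal p * ∫⁻ t in Ioi 0, K * ∫⁻ x,
        weakIntegrand t (U x) * ENNReal.ofReal (t ^ (p - 1)) ∂μ := by
        gcongr ENNReal.ofReal p * ?_
        refine setLIntegral_mono' measurableSet_Ioi fun t ht => ?_
        rw [lintegral_mul_const'' _ (hmt t), ← mul_assoc]
        gcongr
        exact h t ht
    _ = ENNReal.ofReal p * (K * ∫⁻ x, (∫⁻ t in Ioi 0,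
        weakIntegrand t (U x) * ENNReal.ofReal (t ^ (p - 1))) ∂μ) := by
        rw [← lintegral_lintegral_swap hm]
        congr 1
        exact lintegral_const_mul'' _ hm.lintegral_prod_right'
    _ ≤ ENNReal.ofReal p * (K * ∫⁻ x, ENNReal.ofReal (interpConst p) *
        ENNReal.ofReal (U x ^ p) ∂μ) := by
        gcongr with x
        rw [← ENNReal.ofReal_mul hint]
        exact lintegral_weakIntegrand_le hp1 hp2 (hU0 x)
    _ = _ := by
        rw [lintegral_const_mul'' _ (by fun_prop)]
        ring

end Interpolation

/-! ### The `L^p` bound for sums of good kernels -/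

section LpBound

variable {n : ℕ}

/-- Functions in all `L^q`, `1 ≤ q < ∞`. -/
def AllLp (f : Rn n → ℂ) : Prop := ∀ q : ℝ≥0∞, 1 ≤ q → q ≠ ⊤ → MemLp f q volume

lemma AllLp.two {f : Rn n → ℂ} (hf : AllLp f) : MemLp f 2 volume :=
  hf 2 (by norm_num) (by norm_num)

lemma AllLp.locInt {f : Rn n → ℂ} (hf : AllLp f) : LocallyIntegrable f volume :=
  JumpNonosc.locInt hf.two

lemma AllLp.kop {f : Rn n → ℂ} (hf : AllLp f) {a : Rn n → Rn n → ℂ} (ha : FinRange a) :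
    AllLp (kop a f) := fun q h1 h2 => memLp_kop ha h1 h2 (hf q h1 h2)

lemma AllLp.sub {f g : Rn n → ℂ} (hf : AllLp f) (hg : AllLp g) : AllLp fun x => f x - g x :=
  fun q h1 h2 => (hf q h1 h2).sub (hg q h1 h2)

lemma BiGood.finRange_sum {w : ℕ} {c : ℝ} {F : Finset ℤ} {a : ℤ → Rn n → Rn n → ℂ}
    (ha : ∀ m ∈ F, BiGood w m c (a m)) : FinRange fun x y => ∑ m ∈ F, a m x y :=
  FinRange.sum F fun m hm => (ha m hm).1.finRange

lemma BiGood.symm {w : ℕ} {m : ℤ} {c : ℝ} {a : Rn n → Rn n → ℂ} (ha : BiGood w m c a) :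
    BiGood w m c (adj a) := ⟨ha.2, by rw [adj_adj]; exact ha.1⟩

lemma one_le_ofReal {p : ℝ} (hp : 1 < p) : 1 ≤ ENNReal.ofReal p :=
  ENNReal.one_le_ofReal.2 hp.le

lemma eLpNorm_ofReal {p : ℝ} (hp : 0 < p) (f : Rn n → ℂ) :
    eLpNorm f (ENNReal.ofReal p) volume = (∫⁻ x, ‖f x‖ₑ ^ p) ^ (1 / p) := by
  rw [eLpNorm_eq_lintegral_rpow_enorm_toReal (by simpa using hp) ENNReal.ofReal_ne_top,
    ENNReal.toReal_ofReal hp.le]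

lemma eLpNorm_ofReal_le {p : ℝ} (hp : 0 < p) {f g : Rn n → ℂ} {C : ℝ≥0∞}
    (h : ∫⁻ x, ‖f x‖ₑ ^ p ≤ C * ∫⁻ x, ‖g x‖ₑ ^ p) :
    eLpNorm f (ENNReal.ofReal p) volume ≤ C ^ (1 / p) * eLpNorm g (ENNReal.ofReal p) volume := by
  rw [eLpNorm_ofReal hp, eLpNorm_ofReal hp, ← ENNReal.mul_rpow_of_nonneg _ _ (by positivity)]
  exact ENNReal.rpow_le_rpow h (by positivity)

lemma exists_bound_cubeConst [NeZero n] (w : ℕ) {p : ℝ} (hp1 : 1 < p) (hp2 : p < 2) :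
    ∃ C : ℝ≥0∞, C ≠ ⊤ ∧ ∀ (F : Finset ℤ) (a : ℤ → Rn n → Rn n → ℂ),
      (∀ m ∈ F, BiGood w m 1 (a m)) → ∀ (f : Rn n → ℂ) (j : ℤ), CubeConst j f → AllLp f →
        eLpNorm (kop (fun x y => ∑ m ∈ F, a m x y) f) (ENNReal.ofReal p) volume ≤
          C * eLpNorm f (ENNReal.ofReal p) volume := by
  have hp0 : 0 < p := by linarith
  refine ⟨(ENNReal.ofReal (2 ^ p) * (ENNReal.ofReal p * weakConst n w *
    ENNReal.ofReal (interpConst p))) ^ (1 / p), ?_, fun F a ha f j hj hf => ?_⟩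
  · refine ENNReal.rpow_ne_top_of_nonneg (by positivity) ?_
    exact ENNReal.mul_ne_top ENNReal.ofReal_ne_top (ENNReal.mul_ne_top
      (ENNReal.mul_ne_top ENNReal.ofReal_ne_top (weakConst_ne_top n w)) ENNReal.ofReal_ne_top)
  refine eLpNorm_ofReal_le hp0 ?_
  set T : Rn n → Rn n → ℂ := fun x y => ∑ m ∈ F, a m x y
  have hT : FinRange T := BiGood.finRange_sum ha
  have hg := hf.kop hT
  have hfm : Measurable f := hj.measurable
  have key := lintegral_rpow_le_of_weak (μ := volume) (U := fun x => ‖f x‖)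
    (V := fun x => ‖kop T f x‖ / 2) (K := weakConst n w) hfm.norm.aemeasurable
    (hg.two.1.norm.aemeasurable.div_const 2) (fun _ => norm_nonneg _) (fun _ => by positivity)
    hp1 hp2 (fun t ht => ?_)
  · have e1 : ∀ x, ‖kop T f x‖ₑ ^ p =
        ENNReal.ofReal (2 ^ p) * ENNReal.ofReal ((‖kop T f x‖ / 2) ^ p) := by
      intro x
      rw [← ENNReal.ofReal_mul (by positivity), ← Real.mul_rpow (by norm_num) (by positivity),
        mul_div_cancel₀ _ two_ne_zero, ← ofReal_norm,
        ENNReal.ofReal_rpow_of_nonneg (norm_nonneg _) hp0.le]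
    have e2 : ∀ x, ‖f x‖ₑ ^ p = ENNReal.ofReal (‖f x‖ ^ p) := by
      intro x
      rw [← ofReal_norm, ENNReal.ofReal_rpow_of_nonneg (norm_nonneg _) hp0.le]
    simp only [e1, e2]
    rw [lintegral_const_mul' _ _ ENNReal.ofReal_ne_top, mul_assoc]
    gcongr
  · have hα : ENNReal.ofReal t ≠ 0 := by simpa using ht
    have := weak_type ha hj (hf 1 le_rfl (by norm_num)) hf.two hα ENNReal.ofReal_ne_top
    convert this using 2
    · ext x
      simp only [mem_ofPred_eq]
      rw [← ofReal_norm, ← ENNReal.ofReal_ofNat 2, ← ENNReal.ofReal_mul (by norm_num),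
        ENNReal.ofReal_lt_ofReal_iff_of_nonneg (by positivity)]
      constructor <;> intro h <;> linarith
    · have hu : Measurable fun x => ‖f x‖ₑ := hfm.enorm
      have hs1 : MeasurableSet {x | ‖f x‖ₑ ≤ ENNReal.ofReal t} :=
        measurableSet_le hu measurable_const
      have hs2 : MeasurableSet {x | ENNReal.ofReal t / 2 < ‖f x‖ₑ} :=
        measurableSet_lt measurable_const hu
      have ht2 : (ENNReal.ofReal t ^ (2 : ℝ))⁻¹ ≠ ⊤ := by simp [ht]
      have ht1 : (ENNReal.ofReal t)⁻¹ ≠ ⊤ := by simp [ht]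
      rw [div_eq_mul_inv, div_eq_mul_inv, ← lintegral_indicator hs1, ← lintegral_indicator hs2,
        ← lintegral_mul_const' _ _ ht2, ← lintegral_mul_const' _ _ ht1,
        ← lintegral_add_left (((hu.pow_const 2).indicator hs1).mul_const _)]
      refine lintegral_congr fun x => ?_
      rw [weakIntegrand]
      congr 1
      · by_cases h : ‖f x‖ ≤ t
        · have : x ∈ {x | ‖f x‖ₑ ≤ ENNReal.ofReal t} := by
            rw [mem_ofPred_eq, ← ofReal_norm]; exact ENNReal.ofReal_le_ofReal h
          rw [indicator_of_mem this, if_pos h, ← ofReal_norm,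
            ENNReal.ofReal_div_of_pos (by positivity), div_eq_mul_inv,
            ENNReal.ofReal_rpow_of_nonneg (norm_nonneg _) (by norm_num),
            ENNReal.ofReal_rpow_of_nonneg ht.le (by norm_num)]
          norm_cast
        · have : x ∉ {x | ‖f x‖ₑ ≤ ENNReal.ofReal t} := by
            rw [mem_ofPred_eq, ← ofReal_norm, ENNReal.ofReal_le_ofReal_iff ht.le]; exact h
          rw [indicator_of_notMem this, if_neg h]
          simp
      · have hiff : x ∈ {x | ENNReal.ofReal t / 2 < ‖f x‖ₑ} ↔ t / 2 < ‖f x‖ := by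
          rw [mem_ofPred_eq, ← ofReal_norm, ← ENNReal.ofReal_ofNat 2,
            ← ENNReal.ofReal_div_of_pos (by norm_num),
            ENNReal.ofReal_lt_ofReal_iff_of_nonneg (by positivity)]
        by_cases h : t / 2 < ‖f x‖
        · rw [indicator_of_mem (hiff.2 h), if_pos h, ← ofReal_norm,
            ENNReal.ofReal_div_of_pos ht, div_eq_mul_inv]
        · rw [indicator_of_notMem (fun h' => h (hiff.1 h')), if_neg h]
          simp

lemma exists_bound_lt_two [NeZero n] (w : ℕ) {p : ℝ} (hp1 : 1 < p) (hp2 : p < 2) :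
    ∃ C : ℝ≥0∞, C ≠ ⊤ ∧ ∀ (F : Finset ℤ) (a : ℤ → Rn n → Rn n → ℂ),
      (∀ m ∈ F, BiGood w m 1 (a m)) → ∀ f : Rn n → ℂ, AllLp f →
        eLpNorm (kop (fun x y => ∑ m ∈ F, a m x y) f) (ENNReal.ofReal p) volume ≤
          C * eLpNorm f (ENNReal.ofReal p) volume := by
  obtain ⟨C, hC, h⟩ := exists_bound_cubeConst (n := n) w hp1 hp2
  have hq := one_le_ofReal hp1
  refine ⟨C + ENNReal.ofReal (1 * horConst n w), by simp [hC], fun F a ha f hf => ?_⟩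
  set T : Rn n → Rn n → ℂ := fun x y => ∑ m ∈ F, a m x y
  have hT : FinRange T := BiGood.finRange_sum ha
  obtain ⟨j, hj⟩ : ∃ j : ℤ, ∀ m ∈ F, j ≤ m := by
    obtain ⟨j, hj⟩ := F.bddBelow
    exact ⟨j, fun m hm => hj hm⟩
  have hE : AllLp (cavg j f) := hf.kop (finRange_avgKer j)
  have hD : AllLp fun y => f y - cavg j f y := hf.sub hE
  have hsplit : kop T f = kop T (cavg j f) + kop T fun y => f y - cavg j f y := by
    funext x
    rw [Pi.add_apply, ← kop_add hT hE.locInt hD.locInt]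
    congr 1; funext y; ring
  rw [hsplit, add_mul]
  refine (eLpNorm_add_le (hE.kop hT).two.1 (hD.kop hT).two.1 hq).trans (add_le_add ?_ ?_)
  · refine (h F a ha _ j (cubeConst_cavg j f) hE).trans ?_
    gcongr
    exact eLpNorm_cavg_le j hf.two.1 hq ENNReal.ofReal_ne_top
  · have : kop T (fun y => f y - cavg j f y) =
        ∑ m ∈ F, kop (a m) fun y => f y - cavg j f y := by
      funext x
      rw [Finset.sum_apply]
      exact kop_finset_sum F (fun m hm => (ha m hm).1.finRange) hD.locInt x
    rw [this]
    exact (eLpNorm_sum_le (fun m hm => (hD.kop (ha m hm).1.finRange).two.1) hq).trans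
      (sum_eLpNorm_fine_le F zero_le_one (fun m hm => (ha m hm).1) hj hf.two hq
        ENNReal.ofReal_ne_top)

lemma AllLp.duality {f : Rn n → ℂ} (hf : AllLp f) {T : Rn n → Rn n → ℂ} (hT : FinRange T)
    {p q : ℝ} (hpq : p.HolderConjugate q) (hp2 : 2 < p) {C : ℝ≥0∞}
    (h : ∀ g : Rn n → ℂ, AllLp g → eLpNorm (JumpNonosc.kop (adj T) g) (ENNReal.ofReal q) volume ≤
      C * eLpNorm g (ENNReal.ofReal q) volume) :
    eLpNorm (JumpNonosc.kop T f) (ENNReal.ofReal p) volume ≤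
      C * eLpNorm f (ENNReal.ofReal p) volume := by
  set g := JumpNonosc.kop T f
  have hg : AllLp g := hf.kop hT
  have hp1 : 0 < p - 1 := by linarith
  set k : Rn n → ℂ := fun x => g x * ((‖g x‖ ^ (p - 2) : ℝ) : ℂ)
  have hkn : ∀ x, ‖k x‖ = ‖g x‖ ^ (p - 1) := by
    intro x
    simp only [k]
    rw [norm_mul, Complex.norm_real, Real.norm_of_nonneg (by positivity),
      ← Real.rpow_one_add' (norm_nonneg _) (by linarith)]
    congr 1; ring
  have hkm : AEStronglyMeasurable k volume := by
    refine hg.two.1.mul ?_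
    exact (Complex.measurable_ofReal.comp_aemeasurable
      (hg.two.1.norm.aemeasurable.pow_const _)).aestronglyMeasurable
  have hke : ∀ r : ℝ≥0∞, eLpNorm k r volume =
      eLpNorm g (r * ENNReal.ofReal (p - 1)) volume ^ (p - 1) := by
    intro r
    rw [← eLpNorm_norm_rpow g hp1]
    refine eLpNorm_congr_norm_ae (Eventually.of_forall fun x => ?_)
    rw [hkn, Real.norm_of_nonneg (by positivity)]
  have hk : AllLp k := by
    intro r h1 h2
    refine ⟨hkm, ?_⟩
    rw [hke]
    refine ENNReal.rpow_lt_top_of_nonneg hp1.le (hg _ ?_ ?_).2.ne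
    · exact one_le_mul h1 (ENNReal.one_le_ofReal.2 (by linarith))
    · exact ENNReal.mul_ne_top h2 ENNReal.ofReal_ne_top
  have hgp : MemLp g (ENNReal.ofReal p) volume :=
    hg _ (one_le_ofReal hpq.lt) ENNReal.ofReal_ne_top
  have e1 : ∫⁻ x, ‖g x‖ₑ ^ p = ‖∫ x, g x * (starRingEnd ℂ) (k x)‖ₑ := by
    have hpt : ∀ x, g x * (starRingEnd ℂ) (k x) = ((‖g x‖ ^ p : ℝ) : ℂ) := by
      intro x
      simp only [k, map_mul, Complex.conj_ofReal]
      rw [← mul_assoc, Complex.mul_conj, Complex.normSq_eq_norm_sq, ← Complex.ofReal_mul,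
        ← Real.rpow_natCast, ← Real.rpow_add' (norm_nonneg _)]
      · congr 2; push_cast; ring
      · push_cast; linarith
    simp only [hpt]
    have hint : Integrable (fun x => ‖g x‖ ^ p) volume := by
      have := hgp.integrable_norm_rpow (by simpa using hpq.pos) ENNReal.ofReal_ne_top
      rwa [ENNReal.toReal_ofReal hpq.nonneg] at this
    rw [integral_complex_ofReal, ← ofReal_norm, Complex.norm_real,
      Real.norm_of_nonneg (integral_nonneg fun x => by positivity),
      ofReal_integral_eq_lintegral_ofReal hint (Eventually.of_forall fun x => by positivity)]
    refine lintegral_congr fun x => ?_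
    rw [← ofReal_norm, ENNReal.ofReal_rpow_of_nonneg (norm_nonneg _) hpq.nonneg]
  set N := eLpNorm g (ENNReal.ofReal p) volume with hN
  have hNp : ∫⁻ x, ‖g x‖ₑ ^ p = N ^ p := by
    rw [hN, eLpNorm_ofReal hpq.pos, ← ENNReal.rpow_mul, one_div, inv_mul_cancel₀ hpq.pos.ne',
      ENNReal.rpow_one]
  have e2 : N ^ p ≤ C * eLpNorm f (ENNReal.ofReal p) volume * N ^ (p - 1) := by
    rw [← hNp, e1, integral_kop_mul_conj hT hf.two hk.two]
    calc _ ≤ ∫⁻ x, ‖f x‖ₑ * ‖JumpNonosc.kop (adj T) k x‖ₑ := by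
          refine (enorm_integral_le_lintegral_enorm _).trans_eq (lintegral_congr fun x => ?_)
          rw [enorm_mul, ← ofReal_norm ((starRingEnd ℂ) _), RCLike.norm_conj, ofReal_norm]
      _ ≤ eLpNorm f (ENNReal.ofReal p) volume *
          eLpNorm (JumpNonosc.kop (adj T) k) (ENNReal.ofReal q) volume := by
          rw [eLpNorm_ofReal hpq.pos, eLpNorm_ofReal hpq.symm.pos]
          exact ENNReal.lintegral_mul_le_Lp_mul_Lq volume hpq hf.two.1.enorm
            (hk.kop hT.adj).two.1.enorm
      _ ≤ eLpNorm f (ENNReal.ofReal p) volume * (C * N ^ (p - 1)) := by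
          gcongr
          refine (h k hk).trans_eq ?_
          rw [hke, ← ENNReal.ofReal_mul hpq.symm.nonneg]
          congr 4
          have := hpq.sub_one_mul_conj
          linarith
      _ = _ := by ring
  by_cases hN0 : N = 0
  · rw [hN0]; exact zero_le
  have hNt : N ≠ ⊤ := hgp.2.ne
  have hNN : N ^ p = N * N ^ (p - 1) := by
    nth_rw 2 [← ENNReal.rpow_one N]
    rw [← ENNReal.rpow_add _ _ hN0 hNt]; congr 1; ring
  rw [hNN] at e2
  exact (ENNReal.mul_le_mul_iff_left (by simp [hN0, hNt]) (by
    exact ENNReal.rpow_ne_top_of_nonneg hp1.le hNt)).1 e2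

lemma exists_bound_one [NeZero n] (w : ℕ) {p : ℝ} (hp1 : 1 < p) :
    ∃ C : ℝ≥0∞, C ≠ ⊤ ∧ ∀ (F : Finset ℤ) (a : ℤ → Rn n → Rn n → ℂ),
      (∀ m ∈ F, BiGood w m 1 (a m)) → ∀ f : Rn n → ℂ, AllLp f →
        eLpNorm (kop (fun x y => ∑ m ∈ F, a m x y) f) (ENNReal.ofReal p) volume ≤
          C * eLpNorm f (ENNReal.ofReal p) volume := by
  rcases lt_trichotomy p 2 with hp | rfl | hp
  · exact exists_bound_lt_two w hp1 hp
  · refine ⟨ENNReal.ofReal (l2Const n w * 1), ENNReal.ofReal_ne_top, fun F a ha f hf => ?_⟩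
    rw [ENNReal.ofReal_ofNat]
    exact eLpNorm_two_le F zero_le_one ha hf.two
  · have hpq := Real.HolderConjugate.conjExponent hp1
    have hq2 : p.conjExponent < 2 := by
      rw [Real.conjExponent, div_lt_iff₀ (by linarith)]; linarith
    obtain ⟨C, hC, h⟩ := exists_bound_lt_two (n := n) w hpq.symm.lt hq2
    refine ⟨C, hC, fun F a ha f hf => hf.duality (BiGood.finRange_sum ha) hpq hp fun g hg => ?_⟩
    have : adj (fun x y => ∑ m ∈ F, a m x y) = fun x y => ∑ m ∈ F, adj (a m) x y := by
      funext x y; simp [adj]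
    rw [this]
    exact h F _ (fun m hm => (ha m hm).symm) g hg

lemma BiGood.const_mul {w : ℕ} {m : ℤ} {c : ℝ} {a : Rn n → Rn n → ℂ} (ha : BiGood w m c a)
    (z : ℂ) : BiGood w m (‖z‖ * c) fun x y => z * a x y := by
  refine ⟨ha.1.const_mul z, ?_⟩
  have := ha.2.const_mul ((starRingEnd ℂ) z)
  rw [RCLike.norm_conj] at this
  convert this using 3
  simp [adj]

/-- The `L^p` bound for sums of good kernels. -/
theorem exists_bound [NeZero n] (w : ℕ) {p : ℝ} (hp1 : 1 < p) :
    ∃ C : ℝ≥0∞, C ≠ ⊤ ∧ ∀ (F : Finset ℤ) (a : ℤ → Rn n → Rn n → ℂ) (c : ℝ), 0 < c →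
      (∀ m ∈ F, BiGood w m c (a m)) → ∀ f : Rn n → ℂ, AllLp f →
        eLpNorm (kop (fun x y => ∑ m ∈ F, a m x y) f) (ENNReal.ofReal p) volume ≤
          C * ENNReal.ofReal c * eLpNorm f (ENNReal.ofReal p) volume := by
  obtain ⟨C, hC, h⟩ := exists_bound_one (n := n) w hp1
  refine ⟨C, hC, fun F a c hc ha f hf => ?_⟩
  have h1 := h F (fun m x y => ((c⁻¹ : ℝ) : ℂ) * a m x y) (fun m hm => by
    have := (ha m hm).const_mul ((c⁻¹ : ℝ) : ℂ)
    rwa [Complex.norm_real, Real.norm_of_nonneg (by positivity), inv_mul_cancel₀ hc.ne'] at this)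
    f hf
  have h2 : kop (fun x y => ∑ m ∈ F, a m x y) f = (c : ℂ) •
      kop (fun x y => ∑ m ∈ F, ((c⁻¹ : ℝ) : ℂ) * a m x y) f := by
    funext x
    rw [Pi.smul_apply, smul_eq_mul, ← kop_mul_left _ (fun _ => (c : ℂ))]
    congr 1
    funext x y
    rw [← Finset.mul_sum, ← mul_assoc, ← Complex.ofReal_mul, mul_inv_cancel₀ hc.ne',
      Complex.ofReal_one, one_mul]
  rw [h2, eLpNorm_const_smul, ← ofReal_norm, Complex.norm_real, Real.norm_of_nonneg hc.le,
    mul_comm C, mul_assoc]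
  gcongr

end LpBound

/-! ### Examples of good kernels -/

section Examples

variable {n : ℕ}

/-- Convolution kernels. -/
def cker (κ : Rn n → ℂ) (x y : Rn n) : ℂ := κ (x - y)

/-- Lipschitz functions adapted to the ball of radius `2 ^ m`. -/
structure LipKer (w : ℕ) (m : ℤ) (A B : ℝ) (κ : Rn n → ℂ) : Prop where
  bound : ∀ z, ‖κ z‖ ≤ A * (cubeVol n m)⁻¹
  lip : ∀ z z', ‖κ z - κ z'‖ ≤ B * (‖z - z'‖ / 2 ^ m) * (cubeVol n m)⁻¹
  supp : ∀ z, κ z ≠ 0 → ‖z‖ ≤ w * (2 : ℝ) ^ m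

lemma abs_coord_le (x : Rn n) (i : Fin n) : |x i| ≤ ‖x‖ := by
  simpa using PiLp.norm_apply_le x i

lemma conj_avgKer (j : ℤ) (x y : Rn n) : (starRingEnd ℂ) (avgKer j y x) = avgKer j x y := by
  conv_rhs => rw [← adj_avgKer]
  rfl

namespace LipKer

variable {w : ℕ} {m : ℤ} {A B : ℝ} {κ : Rn n → ℂ}

lemma continuous (h : LipKer w m A B κ) : Continuous κ := by
  have hV := cubeVol_pos (n := n) m
  have : LipschitzWith (B * (2 ^ m)⁻¹ * (cubeVol n m)⁻¹).toNNReal κ := by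
    refine LipschitzWith.of_dist_le_mul fun z z' => ?_
    rw [dist_eq_norm, dist_eq_norm]
    refine (h.lip z z').trans ?_
    have := Real.le_coe_toNNReal (B * (2 ^ m)⁻¹ * (cubeVol n m)⁻¹)
    calc B * (‖z - z'‖ / 2 ^ m) * (cubeVol n m)⁻¹
        = B * (2 ^ m)⁻¹ * (cubeVol n m)⁻¹ * ‖z - z'‖ := by ring
      _ ≤ _ := by gcongr
  exact this.continuous

lemma A_nonneg (h : LipKer w m A B κ) : 0 ≤ A :=
  nonneg_of_mul_nonneg_left ((norm_nonneg _).trans (h.bound 0)) (by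
    have := cubeVol_pos (n := n) m; positivity)

lemma measurable_cker (h : LipKer w m A B κ) : Measurable (Function.uncurry (cker κ)) := by
  have : Continuous (Function.uncurry (cker κ)) :=
    h.continuous.comp (continuous_fst.sub continuous_snd)
  exact this.measurable

lemma cker_supp (h : LipKer w m A B κ) {x y : Rn n} (hxy : cker κ x y ≠ 0) (i : Fin n) :
    |x i - y i| ≤ w * (2 : ℝ) ^ m := by
  simpa using (abs_coord_le (x - y) i).trans (h.supp _ hxy)

lemma finRange (h : LipKer w m A B κ) : FinRange (cker κ) :=
  finRange_of_coord h.measurable_cker (w := w * 2 ^ m) (by positivity) (fun x y => h.bound _)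
    fun _ _ hxy => h.cker_supp hxy

lemma hasCompactSupport (h : LipKer w m A B κ) : HasCompactSupport κ := by
  refine HasCompactSupport.of_support_subset_isCompact
    (isCompact_closedBall (0 : Rn n) (w * 2 ^ m)) fun z hz => ?_
  simpa using h.supp z hz

lemma integrable (h : LipKer w m A B κ) : Integrable κ :=
  h.continuous.integrable_of_hasCompactSupport h.hasCompactSupport

lemma osc (h : LipKer w m A B κ) (hB : 0 ≤ B) {j : ℤ} (hj : j ≤ m) {x y z : Rn n}
    (hyz : idx j y = idx j z) :
    ‖cker κ x y - cker κ x z‖ ≤ √(2 * A * (B * n)) * dec (m - j) * (cubeVol n m)⁻¹ := by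
  have hV := cubeVol_pos (n := n) m
  have hA := h.A_nonneg
  have hd := dec_pos (m - j)
  have h1 : ‖cker κ x y - cker κ x z‖ * cubeVol n m ≤ 2 * A := by
    rw [← le_div_iff₀ hV]
    refine (norm_sub_le _ _).trans ?_
    have h1 := h.bound (x - y)
    have h2 := h.bound (x - z)
    rw [cker, cker, div_eq_mul_inv]
    linarith
  have h2 : ‖cker κ x y - cker κ x z‖ * cubeVol n m ≤ B * n * dec (m - j) ^ 2 := by
    rw [← le_div_iff₀ hV]
    refine (h.lip _ _).trans ?_
    have h3 : ‖x - y - (x - z)‖ ≤ n * 2 ^ j := by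
      refine norm_le_of_coord (by positivity) fun i => ?_
      have := abs_sub_lt_of_idx hyz.symm i
      simpa using this.le
    rw [show m - j = -(j - m) by ring, dec_neg, ← two_zpow_sub hj, div_eq_mul_inv _ (cubeVol n m)]
    calc B * (‖x - y - (x - z)‖ / 2 ^ m) * (cubeVol n m)⁻¹
        ≤ B * (n * 2 ^ j / 2 ^ m) * (cubeVol n m)⁻¹ := by gcongr
      _ = _ := by ring
  rw [← div_eq_mul_inv, le_div_iff₀ hV]
  have hX : 0 ≤ ‖cker κ x y - cker κ x z‖ * cubeVol n m := by positivity
  generalize ‖cker κ x y - cker κ x z‖ * cubeVol n m = X at h1 h2 hX ⊢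
  refine le_of_sq_le_sq ?_ (by positivity)
  rw [mul_pow, Real.sq_sqrt (by positivity)]
  calc X ^ 2 = X * X := sq X
    _ ≤ 2 * A * (B * n * dec (m - j) ^ 2) := by gcongr
    _ = _ := by ring

/-- The Hölder constant of a Lipschitz kernel. -/
def cst (n : ℕ) (A B : ℝ) : ℝ := A + √(2 * A * (B * n))

lemma goodKer (h : LipKer w m A B κ) (hB : 0 ≤ B) (h0 : ∫ z, κ z = 0) :
    GoodKer w m (cst n A B) (cker κ) := by
  have hV := cubeVol_pos (n := n) m
  have hA := h.A_nonneg
  refine ⟨h.measurable_cker, fun x y => (h.bound _).trans ?_, fun x y hxy => h.cker_supp hxy,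
    fun x => ?_, fun j hj x y z hyz => (h.osc hB hj hyz).trans ?_⟩
  · gcongr
    exact le_add_of_nonneg_right (by positivity)
  · simp only [cker]
    rw [integral_sub_left_eq_self κ, h0]
  · have := dec_pos (m - j)
    gcongr
    exact le_add_of_nonneg_left hA

lemma conj_neg (h : LipKer w m A B κ) :
    LipKer w m A B fun z => (starRingEnd ℂ) (κ (-z)) where
  bound z := by rw [RCLike.norm_conj]; exact h.bound _
  lip z z' := by
    rw [← map_sub, RCLike.norm_conj]
    refine (h.lip _ _).trans_eq ?_
    rw [← norm_neg (z - z')]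
    congr 4
    abel
  supp z hz := by
    have := h.supp (-z) (by simpa using hz)
    rwa [norm_neg] at this

lemma adj_cker (κ : Rn n → ℂ) : adj (cker κ) = cker fun z => (starRingEnd ℂ) (κ (-z)) := by
  funext x y
  simp [adj, cker]

lemma biGood (h : LipKer w m A B κ) (hB : 0 ≤ B) (h0 : ∫ z, κ z = 0) :
    BiGood w m (cst n A B) (cker κ) := by
  refine ⟨h.goodKer hB h0, ?_⟩
  rw [adj_cker]
  refine h.conj_neg.goodKer hB ?_
  rw [integral_conj, integral_neg_eq_self κ, h0, map_zero]

lemma goodKer_avg_sub (h : LipKer w m A B κ) (hB : 0 ≤ B) (hw : 1 ≤ w) (h1 : ∫ z, κ z = 1) :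
    GoodKer w m (1 + cst n A B) fun x y => avgKer m x y - cker κ x y := by
  have hV := cubeVol_pos (n := n) m
  have hA := h.A_nonneg
  refine ⟨(measurable_avgKer m).sub h.measurable_cker, fun x y => ?_, fun x y hxy i => ?_,
    fun x => ?_, fun j hj x y z hyz => ?_⟩
  · refine (norm_sub_le _ _).trans ?_
    have h2 := norm_avgKer_le m x y
    have h3 := h.bound (x - y)
    have h4 : 0 ≤ √(2 * A * (B * n)) * (cubeVol n m)⁻¹ := by positivity
    rw [cker, cst, add_mul, add_mul]
    linarith
  · by_cases hc : cker κ x y = 0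
    · have : idx m y = idx m x := by
        by_contra hne
        exact hxy (by simp [hc, avgKer, hne])
      refine (abs_sub_lt_of_idx this.symm i).le.trans ?_
      have : (1 : ℝ) ≤ w := by exact_mod_cast hw
      exact le_mul_of_one_le_left (by positivity) this
    · exact h.cker_supp hc i
  · rw [integral_sub, integral_avgKer]
    · simp only [cker]
      rw [integral_sub_left_eq_self κ, h1, sub_self]
    · have := (finRange_avgKer (n := n) m).integrable_mul (f := fun _ => 1)
        (locallyIntegrable_const 1) x
      simpa using this
    · exact h.integrable.comp_sub_left x
  · have e : avgKer m x y = avgKer m x z := by simp [avgKer, idx_of_le hj hyz]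
    rw [e, sub_sub_sub_cancel_left, norm_sub_rev]
    refine (h.osc hB hj hyz).trans ?_
    have := dec_pos (m - j)
    gcongr
    rw [cst]
    linarith

lemma biGood_avg_sub (h : LipKer w m A B κ) (hB : 0 ≤ B) (hw : 1 ≤ w) (h1 : ∫ z, κ z = 1) :
    BiGood w m (1 + cst n A B) fun x y => avgKer m x y - cker κ x y := by
  refine ⟨h.goodKer_avg_sub hB hw h1, ?_⟩
  have : (adj fun x y => avgKer m x y - cker κ x y) =
      fun x y => avgKer m x y - cker (fun z => (starRingEnd ℂ) (κ (-z))) x y := by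
    rw [← adj_cker]
    funext x y
    simp [adj, conj_avgKer]
  rw [this]
  refine h.conj_neg.goodKer_avg_sub hB hw ?_
  rw [integral_conj, integral_neg_eq_self κ, h1, map_one]

end LipKer

/-- Bound for the martingale difference kernels. -/
def diffCst (n : ℕ) : ℝ := 2 * (2 ^ n + 1)

lemma integrable_avgKer (j : ℤ) (x : Rn n) : Integrable (avgKer j x) := by
  have := (finRange_avgKer (n := n) j).integrable_mul (f := fun _ => 1)
    (locallyIntegrable_const 1) x
  simpa using this

lemma goodKer_diff {m : ℤ} {v : Rn n → ℂ} (hv : Measurable v) (hv1 : ∀ x, ‖v x‖ ≤ 1) :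
    GoodKer 1 m (diffCst n) fun x y => v x * (avgKer (m - 1) x y - avgKer m x y) := by
  have hV := cubeVol_pos (n := n) m
  have hV' := cubeVol_pos (n := n) (m - 1)
  have hvol : (cubeVol n (m - 1))⁻¹ = 2 ^ n * (cubeVol n m)⁻¹ := by
    have := cubeVol_succ (n := n) (m - 1)
    rw [sub_add_cancel] at this
    rw [this]
    field_simp
  have hb : ∀ x y : Rn n, ‖v x * (avgKer (m - 1) x y - avgKer m x y)‖ ≤
      (2 ^ n + 1) * (cubeVol n m)⁻¹ := by
    intro x y
    rw [norm_mul]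
    have h1 := norm_avgKer_le (m - 1) x y
    have h2 := norm_avgKer_le m x y
    calc _ ≤ 1 * ‖avgKer (m - 1) x y - avgKer m x y‖ := by gcongr; exact hv1 x
      _ ≤ _ := by rw [one_mul, add_mul, ← hvol, one_mul]; exact (norm_sub_le _ _).trans (by gcongr)
  refine ⟨?_, fun x y => (hb x y).trans ?_, fun x y hxy i => ?_, fun x => ?_,
    fun j hj x y z hyz => ?_⟩
  · exact (hv.comp measurable_fst).mul ((measurable_avgKer (m - 1)).sub (measurable_avgKer m))
  · rw [diffCst]
    gcongr
    have : (0 : ℝ) < 2 ^ n := by positivity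
    linarith
  · have : idx m y = idx m x := by
      by_contra hc
      have h2 : idx (m - 1) y ≠ idx (m - 1) x := fun h => hc (idx_of_le (by lia) h)
      exact hxy (by simp [avgKer, hc, h2])
    simpa using (abs_sub_lt_of_idx this.symm i).le
  · rw [integral_const_mul, integral_sub (integrable_avgKer _ x) (integrable_avgKer _ x),
      integral_avgKer, integral_avgKer, sub_self, mul_zero]
  · rcases hj.eq_or_lt with rfl | hlt
    · rw [sub_self, dec_zero, diffCst, mul_one]
      refine (norm_sub_le _ _).trans ?_
      have h1 := hb x y
      have h2 := hb x z
      linarith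
    · have e1 : avgKer m x y = avgKer m x z := by simp [avgKer, idx_of_le hj hyz]
      have e2 : avgKer (m - 1) x y = avgKer (m - 1) x z := by
        simp [avgKer, idx_of_le (by lia : j ≤ m - 1) hyz]
      have := dec_pos (m - j)
      rw [e1, e2, sub_self, norm_zero, diffCst]
      positivity

lemma biGood_diff {m : ℤ} {v : Rn n → ℂ} (hv : CubeConst m v) (hv1 : ∀ x, ‖v x‖ ≤ 1) :
    BiGood 1 m (diffCst n) fun x y => v x * (avgKer (m - 1) x y - avgKer m x y) := by
  refine ⟨goodKer_diff hv.measurable hv1, ?_⟩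
  have : (adj fun x y => v x * (avgKer (m - 1) x y - avgKer m x y)) =
      fun x y => (starRingEnd ℂ) (v x) * (avgKer (m - 1) x y - avgKer m x y) := by
    funext x y
    rw [adj, map_mul, map_sub, conj_avgKer, conj_avgKer]
    by_cases hxy : idx m y = idx m x
    · rw [hv y x hxy]
    · have h2 : idx (m - 1) y ≠ idx (m - 1) x := fun h => hxy (idx_of_le (by lia) h)
      simp [avgKer, hxy, h2]
  rw [this]
  exact goodKer_diff (Complex.continuous_conj.measurable.comp hv.measurable)
    fun x => by rw [RCLike.norm_conj]; exact hv1 x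

lemma BiGood.mono {w w' : ℕ} {m : ℤ} {c c' : ℝ} {a : Rn n → Rn n → ℂ} (h : BiGood w m c a)
    (hw : w ≤ w') (hc : c ≤ c') : BiGood w' m c' a := ⟨h.1.mono hw hc, h.2.mono hw hc⟩

lemma BiGood.sum {w : ℕ} {m : ℤ} {ι : Type*} (F : Finset ι) {c : ι → ℝ}
    {a : ι → Rn n → Rn n → ℂ} (h : ∀ i ∈ F, BiGood w m (c i) (a i)) :
    BiGood w m (∑ i ∈ F, c i) fun x y => ∑ i ∈ F, a i x y := by
  refine ⟨GoodKer.sum F fun i hi => (h i hi).1, ?_⟩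
  have : (adj fun x y => ∑ i ∈ F, a i x y) = fun x y => ∑ i ∈ F, adj (a i) x y := by
    funext x y
    simp [adj]
  rw [this]
  exact GoodKer.sum F fun i hi => (h i hi).2

end Examples

/-! ### Random signs and the lower Khinchine inequality -/

section Khinchine

variable {ι : Type*}

/-- Average over all sign patterns on `F`. -/
def signAvg (F : Finset ι) (Φ : Finset ι → ℝ) : ℝ := (2 ^ F.card : ℝ)⁻¹ * ∑ S ∈ F.powerset, Φ S

lemma signAvg_mono (F : Finset ι) {Φ Ψ : Finset ι → ℝ} (h : ∀ S ∈ F.powerset, Φ S ≤ Ψ S) :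
    signAvg F Φ ≤ signAvg F Ψ := by
  unfold signAvg
  gcongr with S hS
  exact h S hS

lemma signAvg_const (F : Finset ι) (c : ℝ) : signAvg F (fun _ => c) = c := by
  simp [signAvg]

lemma signAvg_add (F : Finset ι) (Φ Ψ : Finset ι → ℝ) :
    signAvg F (fun S => Φ S + Ψ S) = signAvg F Φ + signAvg F Ψ := by
  simp [signAvg, Finset.sum_add_distrib, mul_add]

lemma signAvg_const_mul (F : Finset ι) (c : ℝ) (Φ : Finset ι → ℝ) :
    signAvg F (fun S => c * Φ S) = c * signAvg F Φ := by
  simp only [signAvg, ← Finset.mul_sum]; ring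

variable [DecidableEq ι]

/-- The sign of `i` in the sign pattern `S`. -/
def sgn (S : Finset ι) (i : ι) : ℂ := if i ∈ S then 1 else -1

lemma norm_sgn (S : Finset ι) (i : ι) : ‖sgn S i‖ = 1 := by
  unfold sgn; split_ifs <;> simp

lemma signAvg_insert {i : ι} {F : Finset ι} (hi : i ∉ F) (Φ : Finset ι → ℝ) :
    signAvg (insert i F) Φ = signAvg F fun S => (Φ S + Φ (insert i S)) / 2 := by
  unfold signAvg
  rw [Finset.sum_powerset_insert hi, Finset.card_insert_of_notMem hi, ← Finset.sum_div,
    Finset.sum_add_distrib]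
  field_simp
  ring

/-- The signed sum. -/
def signSum (z : ι → ℂ) (F S : Finset ι) : ℂ := ∑ i ∈ F, sgn S i * z i

lemma signSum_insert {i : ι} {F S : Finset ι} (z : ι → ℂ) (hi : i ∉ F) (hS : S ⊆ F) :
    signSum z (insert i F) S = signSum z F S - z i ∧
      signSum z (insert i F) (insert i S) = signSum z F S + z i := by
  have h1 : i ∉ S := fun h => hi (hS h)
  unfold signSum
  rw [Finset.sum_insert hi, Finset.sum_insert hi]
  constructor
  · simp [sgn, h1]; ring
  · have : ∑ j ∈ F, sgn (insert i S) j * z j = ∑ j ∈ F, sgn S j * z j := by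
      refine Finset.sum_congr rfl fun j hj => ?_
      have : j ≠ i := fun h => hi (h ▸ hj)
      simp [sgn, this]
    rw [this]
    simp [sgn]; ring

lemma signAvg_sq (z : ι → ℂ) (F : Finset ι) :
    signAvg F (fun S => ‖signSum z F S‖ ^ 2) = ∑ i ∈ F, ‖z i‖ ^ 2 := by
  induction F using Finset.induction_on with
  | empty => simp [signAvg, signSum]
  | insert i F hi ih =>
    rw [signAvg_insert hi, Finset.sum_insert hi, ← ih, ← signAvg_const F (‖z i‖ ^ 2),
      ← signAvg_add]
    unfold signAvg
    congr 1
    refine Finset.sum_congr rfl fun S hS => ?_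
    obtain ⟨h1, h2⟩ := signSum_insert z hi (Finset.mem_powerset.1 hS)
    beta_reduce
    rw [h1, h2]
    have := parallelogram_law_with_norm ℝ (signSum z F S) (z i)
    nlinarith

lemma avg_fourth_le (a b : ℂ) :
    (‖a - b‖ ^ 4 + ‖a + b‖ ^ 4) / 2 ≤ ‖a‖ ^ 4 + 6 * ‖b‖ ^ 2 * ‖a‖ ^ 2 + ‖b‖ ^ 4 := by
  have h1 := norm_add_sq_real a b
  have h2 := norm_sub_sq_real a b
  have h3 : (inner ℝ a b) ^ 2 ≤ ‖a‖ ^ 2 * ‖b‖ ^ 2 := by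
    have := abs_real_inner_le_norm a b
    rw [← sq_abs, ← mul_pow]
    gcongr
  have e1 : ‖a - b‖ ^ 4 = (‖a - b‖ ^ 2) ^ 2 := by ring
  have e2 : ‖a + b‖ ^ 4 = (‖a + b‖ ^ 2) ^ 2 := by ring
  rw [e1, e2, h1, h2]
  nlinarith

lemma signAvg_fourth_le (z : ι → ℂ) (F : Finset ι) :
    signAvg F (fun S => ‖signSum z F S‖ ^ 4) ≤ 3 * (∑ i ∈ F, ‖z i‖ ^ 2) ^ 2 := by
  induction F using Finset.induction_on with
  | empty => simp [signAvg, signSum]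
  | insert i F hi ih =>
    rw [signAvg_insert hi, Finset.sum_insert hi]
    have h : signAvg F (fun S => (‖signSum z (insert i F) S‖ ^ 4 +
        ‖signSum z (insert i F) (insert i S)‖ ^ 4) / 2) ≤
        signAvg F (fun S => (‖signSum z F S‖ ^ 4 +
          6 * ‖z i‖ ^ 2 * ‖signSum z F S‖ ^ 2) + ‖z i‖ ^ 4) := by
      refine signAvg_mono F fun S hS => ?_
      obtain ⟨h1, h2⟩ := signSum_insert z hi (Finset.mem_powerset.1 hS)
      rw [h1, h2]
      exact avg_fourth_le _ _
    rw [signAvg_add, signAvg_add, signAvg_const_mul, signAvg_const, signAvg_sq] at h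
    nlinarith [sq_nonneg (‖z i‖ ^ 2)]

lemma rpow_lower_of_le_two {p s A : ℝ} (hp : p ≤ 2) (hs : 0 ≤ s) (hA : 0 < A) :
    A ^ (p - 2) * (s ^ 2 - s ^ 4 / A ^ 2) ≤ s ^ p := by
  rcases hs.eq_or_lt with rfl | hs
  · simpa using Real.rpow_nonneg le_rfl p
  rcases le_or_gt s A with h | h
  · calc A ^ (p - 2) * (s ^ 2 - s ^ 4 / A ^ 2) ≤ s ^ (p - 2) * s ^ 2 := by
          have h1 : A ^ (p - 2) ≤ s ^ (p - 2) :=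
            Real.rpow_le_rpow_of_nonpos hs h (by linarith)
          have h2 : s ^ 2 - s ^ 4 / A ^ 2 ≤ s ^ 2 := by
            have : 0 ≤ s ^ 4 / A ^ 2 := by positivity
            linarith
          calc _ ≤ A ^ (p - 2) * s ^ 2 := by gcongr
            _ ≤ _ := by gcongr
      _ = s ^ p := by
          rw [← Real.rpow_natCast, ← Real.rpow_add hs]; norm_num
  · have : s ^ 2 - s ^ 4 / A ^ 2 ≤ 0 := by
      rw [sub_nonpos, le_div_iff₀ (by positivity)]
      have : A ^ 2 ≤ s ^ 2 := by gcongr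
      nlinarith [sq_nonneg s]
    exact (mul_nonpos_of_nonneg_of_nonpos (by positivity) this).trans (by positivity)

lemma rpow_lower_of_two_le {p s A : ℝ} (hp : 2 ≤ p) (hs : 0 ≤ s) (hA : 0 < A) :
    A ^ (p - 2) * (s ^ 2 - A ^ 2) ≤ s ^ p := by
  rcases le_or_gt A s with h | h
  · have hs : 0 < s := hA.trans_le h
    calc A ^ (p - 2) * (s ^ 2 - A ^ 2) ≤ s ^ (p - 2) * s ^ 2 := by
          have h1 : A ^ (p - 2) ≤ s ^ (p - 2) :=
            Real.rpow_le_rpow hA.le h (by linarith)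
          have h2 : s ^ 2 - A ^ 2 ≤ s ^ 2 := by
            have : 0 ≤ A ^ 2 := by positivity
            linarith
          calc _ ≤ A ^ (p - 2) * s ^ 2 := by gcongr
            _ ≤ _ := by gcongr
      _ = s ^ p := by
          rw [← Real.rpow_natCast, ← Real.rpow_add hs]; norm_num
  · have : s ^ 2 - A ^ 2 ≤ 0 := by
      rw [sub_nonpos]
      gcongr
    exact (mul_nonpos_of_nonneg_of_nonpos (by positivity) this).trans (by positivity)

/-- The lower Khinchine inequality. -/
lemma khinchine {p : ℝ} (hp : 0 < p) :
    ∃ C > (0 : ℝ), ∀ (F : Finset ι) (z : ι → ℂ),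
      (∑ i ∈ F, ‖z i‖ ^ 2) ^ (p / 2) ≤ C * signAvg F fun S => ‖signSum z F S‖ ^ p := by
  have key : ∀ {B : ℝ}, 0 < B → ∀ V : ℝ, 0 < V →
      (√(B * V)) ^ (p - 2) * (V / 2) = B ^ (p / 2 - 1) / 2 * V ^ (p / 2) := by
    intro B hB V hV
    rw [Real.sqrt_eq_rpow, ← Real.rpow_mul (by positivity), Real.mul_rpow hB.le hV.le,
      show 1 / 2 * (p - 2) = p / 2 - 1 by ring, Real.rpow_sub_one hV.ne']
    field_simp
  have main : ∃ B : ℝ, 0 < B ∧ ∀ (F : Finset ι) (z : ι → ℂ), 0 < ∑ i ∈ F, ‖z i‖ ^ 2 →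
      (√(B * ∑ i ∈ F, ‖z i‖ ^ 2)) ^ (p - 2) * ((∑ i ∈ F, ‖z i‖ ^ 2) / 2) ≤
        signAvg F fun S => ‖signSum z F S‖ ^ p := by
    rcases le_total p 2 with h2 | h2
    · refine ⟨6, by norm_num, fun F z hV => ?_⟩
      set V := ∑ i ∈ F, ‖z i‖ ^ 2 with hVdef
      have hA : 0 < √(6 * V) := by positivity
      have hA2 : √(6 * V) ^ 2 = 6 * V := Real.sq_sqrt (by positivity)
      refine le_trans ?_ (signAvg_mono F fun S _ => rpow_lower_of_le_two h2 (norm_nonneg _) hA)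
      have e : ∀ S, √(6 * V) ^ (p - 2) * (‖signSum z F S‖ ^ 2 - ‖signSum z F S‖ ^ 4 /
          √(6 * V) ^ 2) = √(6 * V) ^ (p - 2) * (‖signSum z F S‖ ^ 2 +
            (-(6 * V)⁻¹) * ‖signSum z F S‖ ^ 4) := by
        intro S; rw [hA2]; ring
      simp only [e]
      rw [signAvg_const_mul, signAvg_add, signAvg_const_mul, signAvg_sq]
      refine mul_le_mul_of_nonneg_left ?_ (by positivity)
      have h4 := signAvg_fourth_le z F
      rw [← hVdef] at h4 ⊢
      have : (6 * V)⁻¹ * signAvg F (fun S => ‖signSum z F S‖ ^ 4) ≤ (6 * V)⁻¹ * (3 * V ^ 2) := by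
        gcongr
      have e2 : (6 * V)⁻¹ * (3 * V ^ 2) = V / 2 := by field_simp; norm_num
      linarith
    · refine ⟨1 / 2, by norm_num, fun F z hV => ?_⟩
      set V := ∑ i ∈ F, ‖z i‖ ^ 2 with hVdef
      have hA : 0 < √(1 / 2 * V) := by positivity
      have hA2 : √(1 / 2 * V) ^ 2 = 1 / 2 * V := Real.sq_sqrt (by positivity)
      refine le_trans ?_ (signAvg_mono F fun S _ => rpow_lower_of_two_le h2 (norm_nonneg _) hA)
      simp only [sub_eq_add_neg]
      rw [signAvg_const_mul, signAvg_add, signAvg_const, signAvg_sq, ← hVdef, hA2]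
      refine mul_le_mul_of_nonneg_left (by linarith) (by positivity)
  obtain ⟨B, hB, h⟩ := main
  refine ⟨(B ^ (p / 2 - 1) / 2)⁻¹, by positivity, fun F z => ?_⟩
  have hV : 0 ≤ ∑ i ∈ F, ‖z i‖ ^ 2 := Finset.sum_nonneg fun _ _ => by positivity
  rcases hV.eq_or_lt with h0 | hpos
  · rw [← h0, Real.zero_rpow (by positivity)]
    have : 0 ≤ signAvg F fun S => ‖signSum z F S‖ ^ p := by
      unfold signAvg
      positivity
    positivity
  · have := h F z hpos
    rw [key hB _ hpos] at this
    rw [inv_mul_eq_div, le_div_iff₀ (by positivity)]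
    linarith

end Khinchine

/-! ### Greedy blocks and jumps -/

section Blocks

/-- The greedy `μ`-block decomposition of a sequence: the number of completed blocks and the
value at the beginning of the current block. -/
def blk (μ : ℝ) (a : ℕ → ℂ) : ℕ → ℕ × ℂ
  | 0 => (0, a 0)
  | t + 1 => if μ < ‖a (t + 1) - (blk μ a t).2‖ then ((blk μ a t).1 + 1, a (t + 1)) else blk μ a t

variable {μ : ℝ} {a : ℕ → ℂ}

lemma blk_congr {a b : ℕ → ℂ} {t : ℕ} (h : ∀ s ≤ t, a s = b s) : blk μ a t = blk μ b t := by
  induction t with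
  | zero => simp [blk, h]
  | succ t ih => simp only [blk, ih fun s hs => h s (by lia), h (t + 1) le_rfl]

lemma blk_mono : Monotone fun t => (blk μ a t).1 := by
  refine monotone_nat_of_le_succ fun t => ?_
  simp only [blk]
  split_ifs <;> simp

lemma blk_snd (hμ : 0 ≤ μ) (t : ℕ) : ‖a t - (blk μ a t).2‖ ≤ μ := by
  cases t with
  | zero => simpa [blk] using hμ
  | succ t =>
    simp only [blk]
    split_ifs with h
    · simpa using hμ
    · simpa using h

lemma blk_const {s t : ℕ} (hst : s ≤ t) (h : (blk μ a s).1 = (blk μ a t).1) :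
    blk μ a s = blk μ a t := by
  induction t, hst using Nat.le_induction with
  | base => rfl
  | succ t hst ih =>
    have h1 : (blk μ a s).1 ≤ (blk μ a t).1 := blk_mono hst
    have h2 : (blk μ a t).1 ≤ (blk μ a (t + 1)).1 := blk_mono (Nat.le_succ t)
    rw [ih (by lia)]
    have h3 : (blk μ a t).1 = (blk μ a (t + 1)).1 := by lia
    simp only [blk] at h3 ⊢
    split_ifs at h3 ⊢ with hc
    · simp at h3
    · rfl

/-- The increment over the `i`-th block. -/
def blkSum (μ : ℝ) (a : ℕ → ℂ) (T i : ℕ) : ℂ :=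
  ∑ t ∈ Finset.range T, if (blk μ a t).1 = i then a (t + 1) - a t else 0

lemma blkSum_spec (T i : ℕ) :
    (i < (blk μ a T).1 → μ < ‖blkSum μ a T i‖) ∧
    (i = (blk μ a T).1 → blkSum μ a T i = a T - (blk μ a T).2) ∧
    ((blk μ a T).1 < i → blkSum μ a T i = 0) := by
  induction T with
  | zero => simp +contextual [blk, blkSum]
  | succ T ih =>
    obtain ⟨h1, h2, h3⟩ := ih
    have e : blkSum μ a (T + 1) i =
        blkSum μ a T i + if (blk μ a T).1 = i then a (T + 1) - a T else 0 := by
      rw [blkSum, Finset.sum_range_succ]; rfl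
    rw [e]
    simp only [blk]
    split_ifs with hc hi hi
    · subst hi
      rw [h2 rfl]
      refine ⟨fun _ => ?_, fun h => ?_, fun h => ?_⟩
      · convert hc using 2; ring
      · exact absurd h (by simp)
      · exact absurd h (by simp)
    · rw [add_zero]
      refine ⟨fun h => h1 ?_, fun h => ?_, fun h => h3 ?_⟩
      · simp at h; lia
      · simp at h
        rw [h3 (by lia)]; simp
      · simp at h; lia
    · subst hi
      rw [h2 rfl]
      refine ⟨fun h => absurd h (lt_irrefl _), fun _ => by ring, fun h => absurd h (lt_irrefl _)⟩
    · rw [add_zero]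
      exact ⟨h1, fun h => absurd h.symm hi, h3⟩

lemma blk_fst_le (T : ℕ) : (blk μ a T).1 ≤ T := by
  induction T with
  | zero => simp [blk]
  | succ T ih =>
    simp only [blk]
    split_ifs
    · simpa using ih
    · exact ih.trans (Nat.le_succ T)

/-- The number of disjoint jumps is controlled by the square function of the block increments. -/
lemma card_jumps_le (hμ : 0 ≤ μ) {T : ℕ} {ι : Type*} {P : Finset ι} {u v : ι → ℕ}
    (hP : ∀ q ∈ P, u q ≤ v q ∧ v q ≤ T ∧ 2 * μ < ‖a (v q) - a (u q)‖)
    (hd : ∀ q ∈ P, ∀ r ∈ P, q ≠ r → v q ≤ u r ∨ v r ≤ u q) :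
    μ ^ 2 * P.card ≤ ∑ i ∈ Finset.range T, ‖blkSum μ a T i‖ ^ 2 := by
  have hjump : ∀ q ∈ P, (blk μ a (u q)).1 < (blk μ a (v q)).1 := by
    intro q hq
    obtain ⟨h1, -, h3⟩ := hP q hq
    refine lt_of_le_of_ne (blk_mono h1) fun h => ?_
    have hs := blk_snd (a := a) hμ (u q)
    have ht := blk_snd (a := a) hμ (v q)
    rw [blk_const h1 h] at hs
    have : ‖a (v q) - a (u q)‖ ≤ μ + μ := by
      calc _ = ‖(a (v q) - (blk μ a (v q)).2) - (a (u q) - (blk μ a (v q)).2)‖ := by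
            congr 1; ring
        _ ≤ _ := (norm_sub_le _ _).trans (add_le_add ht hs)
    linarith
  have hcard : P.card ≤ (blk μ a T).1 := by
    rw [← Finset.card_range (blk μ a T).1]
    refine Finset.card_le_card_of_injOn (fun q => (blk μ a (u q)).1) (fun q hq => ?_)
      fun q hq r hr hqr => ?_
    · have h1 := hjump q hq
      have h2 : (blk μ a (v q)).1 ≤ (blk μ a T).1 := blk_mono (hP q hq).2.1
      simpa using h1.trans_le h2
    · by_contra hne
      have hqr' : (blk μ a (u q)).1 = (blk μ a (u r)).1 := hqr
      rcases hd q hq r hr hne with h | h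
      · have h1 := hjump q hq
        have h2 : (blk μ a (v q)).1 ≤ (blk μ a (u r)).1 := blk_mono h
        lia
      · have h1 := hjump r hr
        have h2 : (blk μ a (v r)).1 ≤ (blk μ a (u q)).1 := blk_mono h
        lia
  calc μ ^ 2 * P.card ≤ μ ^ 2 * (blk μ a T).1 := by gcongr
    _ = ∑ i ∈ Finset.range (blk μ a T).1, μ ^ 2 := by simp [mul_comm]
    _ ≤ ∑ i ∈ Finset.range (blk μ a T).1, ‖blkSum μ a T i‖ ^ 2 := by
        refine Finset.sum_le_sum fun i hi => ?_
        have := ((blkSum_spec T i).1 (Finset.mem_range.1 hi)).le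
        gcongr
    _ ≤ _ := Finset.sum_le_sum_of_subset_of_nonneg
        (Finset.range_mono (blk_fst_le T)) fun _ _ _ => by positivity

end Blocks

/-! ### Convolutions of adapted kernels -/

section Conv

variable {n : ℕ}

/-- Convolution of two functions. -/
def conv (σ φ : Rn n → ℂ) (z : Rn n) : ℂ := ∫ u, σ u * φ (z - u)

lemma conv_comm (σ φ : Rn n → ℂ) : conv σ φ = conv φ σ := by
  funext z
  unfold conv
  rw [← integral_sub_left_eq_self (fun u => φ u * σ (z - u)) volume z]
  simp [mul_comm]

lemma integral_conv {σ φ : Rn n → ℂ} (hσ : Integrable σ) (hφ : Integrable φ) :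
    ∫ z, conv σ φ z = (∫ z, σ z) * ∫ z, φ z := by
  have := integral_convolution (L := ContinuousLinearMap.mul ℝ ℂ) hσ hφ
  simpa [convolution, conv] using this

namespace LipKer

variable {w w' : ℕ} {l m : ℤ} {A B A' B' : ℝ} {σ φ : Rn n → ℂ}

lemma integral_norm_le (h : LipKer w l A B σ) : ∫ z, ‖σ z‖ ≤ A * (2 * w) ^ n := by
  have hA := h.A_nonneg
  rw [integral_norm_eq_lintegral_enorm h.integrable.1]
  refine ENNReal.toReal_le_of_le_ofReal (by positivity) ?_
  rw [← lintegral_boxKer w l hA (0 : Rn n)]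
  refine lintegral_mono fun y => enorm_le_boxKer (h.bound y) fun hy i => ?_
  simpa using (abs_coord_le y i).trans (h.supp y hy)

lemma integrable_conv (hσ : LipKer w l A B σ) (hφ : LipKer w' m A' B' φ) (z : Rn n) :
    Integrable fun u => σ u * φ (z - u) := by
  refine Continuous.integrable_of_hasCompactSupport ?_ hσ.hasCompactSupport.mul_right
  exact hσ.continuous.mul (hφ.continuous.comp (continuous_const.sub continuous_id))

lemma conv_sub_const (hσ : LipKer w l A B σ) (hφ : LipKer w' m A' B' φ) (z : Rn n) :
    conv σ φ z - (∫ u, σ u) * φ z = ∫ u, σ u * (φ (z - u) - φ z) := by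
  rw [conv, ← integral_mul_const, ← integral_sub (hσ.integrable_conv hφ z)
    (hσ.integrable.mul_const _)]
  simp only [mul_sub]

lemma norm_conv_sub_const_le (hσ : LipKer w l A B σ) (hφ : LipKer w' m A' B' φ) (hB' : 0 ≤ B')
    (z : Rn n) :
    ‖conv σ φ z - (∫ u, σ u) * φ z‖ ≤
      A * (2 * w) ^ n * (B' * w) * (2 ^ l / 2 ^ m) * (cubeVol n m)⁻¹ := by
  have hV := cubeVol_pos (n := n) m
  rw [hσ.conv_sub_const hφ]
  refine (norm_integral_le_integral_norm _).trans ?_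
  set c := B' * (w * 2 ^ l / 2 ^ m) * (cubeVol n m)⁻¹ with hc
  have hc0 : 0 ≤ c := by positivity
  calc ∫ u, ‖σ u * (φ (z - u) - φ z)‖ ≤ ∫ u, ‖σ u‖ * c := by
        refine integral_mono_of_nonneg (.of_forall fun _ => norm_nonneg _)
          (hσ.integrable.norm.mul_const _) (.of_forall fun u => ?_)
        simp only [norm_mul]
        by_cases hu : σ u = 0
        · simp [hu]
        refine mul_le_mul_of_nonneg_left ((hφ.lip _ _).trans ?_) (norm_nonneg _)
        have := hσ.supp u hu
        rw [sub_sub_cancel_left, norm_neg, hc]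
        gcongr
    _ = (∫ u, ‖σ u‖) * c := integral_mul_const _ _
    _ ≤ A * (2 * w) ^ n * c := by
        have := hσ.integral_norm_le
        gcongr
    _ = _ := by rw [hc]; ring

lemma norm_conv_sub_le (hσ : LipKer w l A B σ) (hφ : LipKer w' m A' B' φ) (hB' : 0 ≤ B')
    (z z' : Rn n) :
    ‖conv σ φ z - conv σ φ z'‖ ≤
      A * (2 * w) ^ n * B' * (‖z - z'‖ / 2 ^ m) * (cubeVol n m)⁻¹ := by
  have hV := cubeVol_pos (n := n) m
  rw [conv, conv, ← integral_sub (hσ.integrable_conv hφ z) (hσ.integrable_conv hφ z')]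
  refine (norm_integral_le_integral_norm _).trans ?_
  set c := B' * (‖z - z'‖ / 2 ^ m) * (cubeVol n m)⁻¹ with hc
  have hc0 : 0 ≤ c := by positivity
  calc ∫ u, ‖σ u * φ (z - u) - σ u * φ (z' - u)‖ ≤ ∫ u, ‖σ u‖ * c := by
        refine integral_mono_of_nonneg (.of_forall fun _ => norm_nonneg _)
          (hσ.integrable.norm.mul_const _) (.of_forall fun u => ?_)
        simp only [← mul_sub, norm_mul]
        refine mul_le_mul_of_nonneg_left ((hφ.lip _ _).trans_eq ?_) (norm_nonneg _)
        rw [sub_sub_sub_cancel_right, hc]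
    _ = (∫ u, ‖σ u‖) * c := integral_mul_const _ _
    _ ≤ A * (2 * w) ^ n * c := by
        have := hσ.integral_norm_le
        gcongr
    _ = _ := by rw [hc]; ring

lemma conv_supp (hσ : LipKer w l A B σ) (hφ : LipKer w' m A' B' φ) {z : Rn n}
    (hz : conv σ φ z ≠ 0) : ‖z‖ ≤ w * (2 : ℝ) ^ l + w' * 2 ^ m := by
  by_contra hc
  refine hz ?_
  have : ∀ u, σ u * φ (z - u) = 0 := by
    intro u
    by_contra hne
    have h1 := hσ.supp u (left_ne_zero_of_mul hne)
    have h2 := hφ.supp _ (right_ne_zero_of_mul hne)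
    have h3 : ‖z‖ ≤ ‖u‖ + ‖z - u‖ := by simpa using norm_add_le u (z - u)
    linarith
  simp [conv, this]

/-- Convolving a cancelling kernel at scale `l ≤ m` with a bump at scale `m`. -/
lemma conv_fine (hσ : LipKer w l A B σ) (h0 : ∫ z, σ z = 0) (hφ : LipKer w' m A' B' φ)
    (hB' : 0 ≤ B') (hlm : l ≤ m) :
    LipKer (w + w') m (A * (2 * w) ^ n * (B' * w) * (2 ^ l / 2 ^ m)) (A * (2 * w) ^ n * B')
      (conv σ φ) where
  bound z := by simpa [h0] using hσ.norm_conv_sub_const_le hφ hB' z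
  lip := hσ.norm_conv_sub_le hφ hB'
  supp z hz := by
    refine (hσ.conv_supp hφ hz).trans ?_
    push_cast
    rw [add_mul]
    gcongr
    norm_num

/-- Removing from a kernel at scale `m ≥ l` its convolution with a bump at scale `l`. -/
lemma sub_conv_coarse (hσ : LipKer w l A B σ) (h1 : ∫ z, σ z = 1) (hφ : LipKer w' m A' B' φ)
    (hB' : 0 ≤ B') (hlm : l ≤ m) :
    LipKer (w + w') m (A * (2 * w) ^ n * (B' * w) * (2 ^ l / 2 ^ m)) (B' + A * (2 * w) ^ n * B')
      (fun z => φ z - conv σ φ z) where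
  bound z := by
    rw [norm_sub_rev]
    simpa [h1] using hσ.norm_conv_sub_const_le hφ hB' z
  lip z z' := by
    have h2 := hφ.lip z z'
    have h3 := hσ.norm_conv_sub_le hφ hB' z z'
    rw [sub_sub_sub_comm]
    refine (norm_sub_le _ _).trans ((add_le_add h2 h3).trans_eq (by ring))
  supp z hz := by
    have hl : (2 : ℝ) ^ l ≤ 2 ^ m := zpow_le_zpow_right₀ (by norm_num) hlm
    by_cases hc : conv σ φ z = 0
    · refine (hφ.supp z (by simpa [hc] using hz)).trans ?_
      push_cast
      rw [add_mul]
      have : 0 ≤ (w : ℝ) * 2 ^ m := by positivity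
      linarith
    · refine (hσ.conv_supp hφ hc).trans ?_
      push_cast
      rw [add_mul]
      gcongr

lemma kop_conv (hσ : LipKer w l A B σ) (hφ : LipKer w' m A' B' φ) {f : Rn n → ℂ}
    (hf : MemLp f 2 volume) (x : Rn n) :
    kop (cker φ) (kop (cker σ) f) x = kop (cker (conv σ φ)) f x := by
  rw [kop_kop hφ.finRange hσ.finRange hf]
  congr 1
  funext x y
  simp only [cker, conv]
  rw [← integral_sub_right_eq_self (fun u => σ u * φ (x - y - u)) y]
  refine integral_congr_ae (.of_forall fun u => ?_)
  simp

end LipKer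

lemma dec_le_one (k : ℤ) : dec k ≤ 1 :=
  pow_le_one₀ (by have := rho_pos; positivity)
    (pow_le_one₀ rho_pos.le rho_lt_one.le)

lemma cst_dec_le {a b : ℝ} (ha : 0 ≤ a) (hb : 0 ≤ b) {l m : ℤ} (hlm : l ≤ m) :
    LipKer.cst n (a * (2 ^ l / 2 ^ m)) b ≤ LipKer.cst n a b * dec (l - m) := by
  have hd := dec_pos (l - m)
  have hd1 := dec_le_one (l - m)
  rw [two_zpow_sub hlm, LipKer.cst, LipKer.cst, add_mul]
  have e : √(2 * (a * dec (l - m) ^ 2) * (b * n)) = √(2 * a * (b * n)) * dec (l - m) := by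
    rw [show 2 * (a * dec (l - m) ^ 2) * (b * n) = 2 * a * (b * n) * dec (l - m) ^ 2 by ring,
      Real.sqrt_mul (by positivity), Real.sqrt_sq hd.le]
  rw [e]
  gcongr
  nlinarith

end Conv

/-! ### Square function bounds -/

section SquareFunction

variable {n : ℕ}

/-- `X` is nonnegative and measurable, and the integral of `X ^ q` is at most `B`. -/
structure PowBd (q : ℝ) (X : Rn n → ℝ) (B : ℝ≥0∞) : Prop where
  nonneg : ∀ x, 0 ≤ X x
  meas : AEMeasurable X volume
  le : ∫⁻ x, ENNReal.ofReal (X x ^ q) ≤ B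

lemma rpow_add_le {q a b : ℝ} (hq : 0 ≤ q) (ha : 0 ≤ a) (hb : 0 ≤ b) :
    (a + b) ^ q ≤ 2 ^ q * (a ^ q + b ^ q) := by
  have h1 : a + b ≤ 2 * max a b := by
    rw [two_mul]; exact add_le_add (le_max_left _ _) (le_max_right _ _)
  calc (a + b) ^ q ≤ (2 * max a b) ^ q := Real.rpow_le_rpow (by positivity) h1 hq
    _ = 2 ^ q * (max a b) ^ q := Real.mul_rpow (by norm_num) (le_max_of_le_left ha)
    _ ≤ _ := by
        gcongr
        rcases max_cases a b with ⟨h, -⟩ | ⟨h, -⟩ <;> rw [h]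
        · exact le_add_of_nonneg_right (Real.rpow_nonneg hb q)
        · exact le_add_of_nonneg_left (Real.rpow_nonneg ha q)

lemma PowBd.add {q : ℝ} (hq : 0 ≤ q) {X Y : Rn n → ℝ} {B D : ℝ≥0∞} (hX : PowBd q X B)
    (hY : PowBd q Y D) : PowBd q (fun x => X x + Y x) (ENNReal.ofReal (2 ^ q) * (B + D)) where
  nonneg x := add_nonneg (hX.nonneg x) (hY.nonneg x)
  meas := hX.meas.add hY.meas
  le := by
    have h1 : AEMeasurable (fun x => ENNReal.ofReal (X x ^ q)) volume :=
      (hX.meas.pow_const q).ennreal_ofReal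
    calc ∫⁻ x, ENNReal.ofReal ((X x + Y x) ^ q)
        ≤ ∫⁻ x, ENNReal.ofReal (2 ^ q) * (ENNReal.ofReal (X x ^ q) + ENNReal.ofReal (Y x ^ q)) := by
          refine lintegral_mono fun x => ?_
          have hx := Real.rpow_nonneg (hX.nonneg x) q
          have hy := Real.rpow_nonneg (hY.nonneg x) q
          rw [← ENNReal.ofReal_add hx hy, ← ENNReal.ofReal_mul (by positivity)]
          exact ENNReal.ofReal_le_ofReal (rpow_add_le hq (hX.nonneg x) (hY.nonneg x))
      _ = ENNReal.ofReal (2 ^ q) * ∫⁻ x, (ENNReal.ofReal (X x ^ q) + ENNReal.ofReal (Y x ^ q)) :=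
          lintegral_const_mul' _ _ ENNReal.ofReal_ne_top
      _ = ENNReal.ofReal (2 ^ q) * ((∫⁻ x, ENNReal.ofReal (X x ^ q)) +
            ∫⁻ x, ENNReal.ofReal (Y x ^ q)) := by rw [lintegral_add_left' h1]
      _ ≤ _ := by
          gcongr
          · exact hX.le
          · exact hY.le

lemma PowBd.mono {q : ℝ} {X : Rn n → ℝ} {B D : ℝ≥0∞} (hX : PowBd q X B) (h : B ≤ D) :
    PowBd q X D := ⟨hX.nonneg, hX.meas, hX.le.trans h⟩

lemma kop_sub_ker {a b : Rn n → Rn n → ℂ} (ha : FinRange a) (hb : FinRange b) {f : Rn n → ℂ}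
    (hf : LocallyIntegrable f volume) (x : Rn n) :
    kop (fun x y => a x y - b x y) f x = kop a f x - kop b f x := by
  simp only [kop, sub_mul]
  exact integral_sub (ha.integrable_mul hf x) (hb.integrable_mul hf x)

/-- The sequence of dyadic averages of `g` at `x`, from scale `2 ^ M` to finer scales. -/
def avgSeq (M : ℤ) (g : Rn n → ℂ) (x : Rn n) (t : ℕ) : ℂ := cavg (M - t) g x

lemma avgSeq_congr {M : ℤ} {T : ℕ} (g : Rn n → ℂ) {x y : Rn n}
    (hxy : idx (M - T) x = idx (M - T) y) {t : ℕ} (ht : t ≤ T) :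
    avgSeq M g x t = avgSeq M g y t :=
  cubeConst_cavg _ _ _ _ (idx_of_le (by lia) hxy)

variable {ι : Type*} [DecidableEq ι]

lemma exists_squareFn_bound {p : ℝ} (hp : 0 < p) :
    ∃ C : ℝ≥0∞, C ≠ ⊤ ∧ ∀ (F : Finset ι) (z : ι → Rn n → ℂ) (B : ℝ≥0∞),
      (∀ i ∈ F, AEStronglyMeasurable (z i) volume) →
      (∀ S ∈ F.powerset, eLpNorm (fun x => signSum (fun i => z i x) F S) (ENNReal.ofReal p) volume
        ≤ B) →
      PowBd (p / 2) (fun x => ∑ i ∈ F, ‖z i x‖ ^ 2) (C * B ^ p) := by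
  obtain ⟨C, hC, h⟩ := khinchine (ι := ι) hp
  refine ⟨ENNReal.ofReal C, ENNReal.ofReal_ne_top, fun F z B hz hB =>
    ⟨fun x => Finset.sum_nonneg fun _ _ => by positivity,
      Finset.aemeasurable_fun_sum F fun i hi => (hz i hi).norm.aemeasurable.pow_const 2, ?_⟩⟩
  have hmeas : ∀ S, AEStronglyMeasurable (fun x => signSum (fun i => z i x) F S) volume := by
    intro S
    unfold signSum
    exact Finset.aestronglyMeasurable_fun_sum F fun i hi => (hz i hi).const_mul _
  have hB' : ∀ S ∈ F.powerset, ∫⁻ x, ‖signSum (fun i => z i x) F S‖ₑ ^ p ≤ B ^ p := by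
    intro S hS
    have := hB S hS
    rw [eLpNorm_ofReal hp] at this
    calc _ = ((∫⁻ x, ‖signSum (fun i => z i x) F S‖ₑ ^ p) ^ (1 / p)) ^ p := by
          rw [← ENNReal.rpow_mul, one_div_mul_cancel hp.ne', ENNReal.rpow_one]
      _ ≤ _ := ENNReal.rpow_le_rpow this hp.le
  calc ∫⁻ x, ENNReal.ofReal ((∑ i ∈ F, ‖z i x‖ ^ 2) ^ (p / 2))
      ≤ ∫⁻ x, ENNReal.ofReal (C * (2 ^ F.card)⁻¹) *
          ∑ S ∈ F.powerset, ‖signSum (fun i => z i x) F S‖ₑ ^ p := by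
        refine lintegral_mono fun x => ?_
        refine (ENNReal.ofReal_le_ofReal (h F fun i => z i x)).trans_eq ?_
        rw [signAvg, ← mul_assoc, ENNReal.ofReal_mul (by positivity),
          ENNReal.ofReal_sum_of_nonneg fun _ _ => by positivity]
        congr 1
        refine Finset.sum_congr rfl fun S _ => ?_
        rw [← ofReal_norm, ENNReal.ofReal_rpow_of_nonneg (norm_nonneg _) hp.le]
    _ = ENNReal.ofReal (C * (2 ^ F.card)⁻¹) *
          ∑ S ∈ F.powerset, ∫⁻ x, ‖signSum (fun i => z i x) F S‖ₑ ^ p := by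
        rw [lintegral_const_mul' _ _ ENNReal.ofReal_ne_top, lintegral_finsetSum']
        exact fun S _ => (hmeas S).enorm.pow_const p
    _ ≤ ENNReal.ofReal (C * (2 ^ F.card)⁻¹) * ∑ S ∈ F.powerset, B ^ p := by
        gcongr with S hS
        exact hB' S hS
    _ = ENNReal.ofReal C * B ^ p := by
        rw [Finset.sum_const, Finset.card_powerset, nsmul_eq_mul, ← mul_assoc]
        congr 1
        rw [← ENNReal.ofReal_natCast, ← ENNReal.ofReal_mul (by positivity)]
        congr 1
        push_cast
        field_simp

variable [NeZero n]

/-- Square functions of families of sums of good kernels. -/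
lemma exists_kop_squareFn_bound (w : ℕ) {p : ℝ} (hp : 1 < p) :
    ∃ C : ℝ≥0∞, C ≠ ⊤ ∧ ∀ (F : Finset ι) (G : Finset ℤ) (a : ι → ℤ → Rn n → Rn n → ℂ)
      (c : ι → ℤ → ℝ) (c₀ : ℝ), 0 < c₀ → (∀ i ∈ F, ∀ m ∈ G, BiGood w m (c i m) (a i m)) →
      (∀ m ∈ G, ∑ i ∈ F, c i m ≤ c₀) → ∀ f : Rn n → ℂ, AllLp f →
      PowBd (p / 2) (fun x => ∑ i ∈ F, ‖∑ m ∈ G, kop (a i m) f x‖ ^ 2)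
        (C * (ENNReal.ofReal c₀ * eLpNorm f (ENNReal.ofReal p) volume) ^ p) := by
  obtain ⟨C₁, hC₁, h₁⟩ := exists_squareFn_bound (n := n) (ι := ι) (zero_lt_one.trans hp)
  obtain ⟨C₂, hC₂, h₂⟩ := exists_bound (n := n) w hp
  have hp0 : 0 ≤ p := by linarith
  refine ⟨C₁ * C₂ ^ p, ENNReal.mul_ne_top hC₁ (ENNReal.rpow_ne_top_of_nonneg hp0 hC₂),
    fun F G a c c₀ hc₀ ha hc f hf => ?_⟩
  have := h₁ F (fun i x => ∑ m ∈ G, kop (a i m) f x)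
    (C₂ * ENNReal.ofReal c₀ * eLpNorm f (ENNReal.ofReal p) volume) (fun i hi => ?_) fun S hS => ?_
  · refine this.mono (le_of_eq ?_)
    rw [mul_assoc C₂, ENNReal.mul_rpow_of_nonneg _ _ hp0, mul_assoc]
  · exact Finset.aestronglyMeasurable_fun_sum G fun m hm =>
      aestronglyMeasurable_kop (ha i hi m hm).1.finRange hf.two.1
  · have hb : ∀ m ∈ G, BiGood w m c₀ fun x y => ∑ i ∈ F, sgn S i * a i m x y := by
      intro m hm
      refine (BiGood.sum F fun i hi => (ha i hi m hm).const_mul (sgn S i)).mono le_rfl ?_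
      simpa [norm_sgn] using hc m hm
    refine (h₂ G _ c₀ hc₀ hb f hf).trans_eq' ?_
    congr 1
    funext x
    have hfr : ∀ i ∈ F, ∀ m ∈ G, FinRange fun x y => sgn S i * a i m x y :=
      fun i hi m hm => (ha i hi m hm).1.finRange.const_mul _
    rw [kop_finset_sum G (fun m hm => FinRange.sum F fun i hi => hfr i hi m hm) hf.locInt, signSum]
    simp only [Finset.mul_sum]
    rw [Finset.sum_comm]
    refine Finset.sum_congr rfl fun m hm => ?_
    rw [kop_finset_sum F (fun i hi => hfr i hi m hm) hf.locInt]
    exact Finset.sum_congr rfl fun i _ => kop_mul_left (a i m) (fun _ => sgn S i) f x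

/-- The square function over the greedy blocks of the dyadic averages. -/
lemma exists_blkSum_bound {p : ℝ} (hp : 1 < p) :
    ∃ C : ℝ≥0∞, C ≠ ⊤ ∧ ∀ (M : ℤ) (T : ℕ) (μ : ℝ) (g : Rn n → ℂ), AllLp g →
      PowBd (p / 2) (fun x => ∑ i ∈ Finset.range T, ‖blkSum μ (avgSeq M g x) T i‖ ^ 2)
        (C * eLpNorm g (ENNReal.ofReal p) volume ^ p) := by
  obtain ⟨C₁, hC₁, h₁⟩ := exists_squareFn_bound (n := n) (ι := ℕ) (zero_lt_one.trans hp)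
  obtain ⟨C₂, hC₂, h₂⟩ := exists_bound (n := n) 1 hp
  have hp0 : 0 ≤ p := by linarith
  have hdc : 0 < diffCst n := by unfold diffCst; positivity
  refine ⟨C₁ * (C₂ * ENNReal.ofReal (diffCst n)) ^ p, ENNReal.mul_ne_top hC₁
    (ENNReal.rpow_ne_top_of_nonneg hp0 (ENNReal.mul_ne_top hC₂ ENNReal.ofReal_ne_top)),
    fun M T μ g hg => ?_⟩
  have := h₁ (Finset.range T) (fun i x => blkSum μ (avgSeq M g x) T i)
    (C₂ * ENNReal.ofReal (diffCst n) * eLpNorm g (ENNReal.ofReal p) volume)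
    (fun i _ => ?_) fun S _ => ?_
  · refine this.mono (le_of_eq ?_)
    rw [ENNReal.mul_rpow_of_nonneg _ _ hp0, mul_assoc]
  · have : CubeConst (M - T) fun x => blkSum μ (avgSeq M g x) T i := by
      intro x y hxy
      refine Finset.sum_congr rfl fun t ht => ?_
      have ht := Finset.mem_range.1 ht
      rw [blk_congr fun s hs => avgSeq_congr g hxy (hs.trans ht.le), avgSeq_congr g hxy ht,
        avgSeq_congr g hxy ht.le]
    exact this.measurable.aestronglyMeasurable
  · set v : ℤ → Rn n → ℂ := fun m x => sgn S (blk μ (avgSeq M g x) (M - m).toNat).1 with hv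
    set G := (Finset.range T).image fun t : ℕ => M - (t : ℤ) with hG
    have hb : ∀ m ∈ G, BiGood 1 m (diffCst n)
        fun x y => v m x * (avgKer (m - 1) x y - avgKer m x y) := by
      intro m hm
      obtain ⟨t, -, rfl⟩ := Finset.mem_image.1 hm
      refine biGood_diff (fun x y hxy => ?_) fun x => (norm_sgn _ _).le
      simp only [hv, sub_sub_cancel, Int.toNat_natCast]
      rw [blk_congr fun s hs => avgSeq_congr g hxy hs]
    refine (h₂ G _ _ hdc hb g hg).trans_eq' ?_
    congr 1
    funext x
    rw [kop_finset_sum G (fun m hm => (hb m hm).1.finRange) hg.locInt, hG,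
      Finset.sum_image (by simp)]
    have e : ∀ t : ℕ, kop (fun x y => v (M - t) x *
        (avgKer (M - t - 1) x y - avgKer (M - t) x y)) g x =
        sgn S (blk μ (avgSeq M g x) t).1 * (avgSeq M g x (t + 1) - avgSeq M g x t) := by
      intro t
      rw [kop_mul_left (fun x y => avgKer (M - t - 1) x y - avgKer (M - t) x y),
        kop_sub_ker (finRange_avgKer _) (finRange_avgKer _) hg.locInt]
      simp only [hv, sub_sub_cancel, Int.toNat_natCast, avgSeq, cavg]
      push_cast
      rw [sub_sub]
    simp only [e, signSum, blkSum, Finset.mul_sum]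
    rw [Finset.sum_comm]
    refine Finset.sum_congr rfl fun t ht => ?_
    simp only [mul_ite, mul_zero]
    rw [Finset.sum_ite_eq, if_pos]
    have := blk_fst_le (μ := μ) (a := avgSeq M g x) t
    have := Finset.mem_range.1 ht
    simp only [Finset.mem_range]
    lia

end SquareFunction

/-! ### The jump inequality for truncated sums of kernels -/

section Jumps

variable {n : ℕ}

lemma PowBd.const_mul {q c : ℝ} (hc : 0 ≤ c) {X : Rn n → ℝ} {B : ℝ≥0∞} (hX : PowBd q X B) :
    PowBd q (fun x => c * X x) (ENNReal.ofReal (c ^ q) * B) where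
  nonneg x := mul_nonneg hc (hX.nonneg x)
  meas := hX.meas.const_mul c
  le := by
    calc ∫⁻ x, ENNReal.ofReal ((c * X x) ^ q)
        = ∫⁻ x, ENNReal.ofReal (c ^ q) * ENNReal.ofReal (X x ^ q) := by
          refine lintegral_congr fun x => ?_
          rw [Real.mul_rpow hc (hX.nonneg x), ENNReal.ofReal_mul (by positivity)]
      _ = ENNReal.ofReal (c ^ q) * ∫⁻ x, ENNReal.ofReal (X x ^ q) :=
          lintegral_const_mul' _ _ ENNReal.ofReal_ne_top
      _ ≤ _ := by gcongr; exact hX.le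

/-- Jumps of `g - a (τ k) + b k` are controlled by the blocks of `a` and by `b`. -/
lemma sq_mul_jumps_le {lam : ℝ} (hlam : 0 < lam) {K₀ : Finset ℤ} {h b : ℤ → ℂ} {a : ℕ → ℂ}
    {τ : ℤ → ℕ} {T : ℕ} (g : ℂ) (hτ : Monotone τ) (hT : ∀ k ∈ K₀, τ k ≤ T)
    (hh : ∀ k ∈ K₀, h k = g - a (τ k) + b k) {J : ℕ} {s t : Fin J → ℤ} (hs : ∀ i, s i ∈ K₀)
    (ht : ∀ i, t i ∈ K₀) (hst : ∀ i, s i < t i) (hd : ∀ i j, i < j → t i < s j)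
    (hj : ∀ i, lam < ‖h (t i) - h (s i)‖) :
    lam ^ 2 * J ≤ 16 * (∑ i ∈ Finset.range T, ‖blkSum (lam / 4) a T i‖ ^ 2) +
      16 * ∑ k ∈ K₀, ‖b k‖ ^ 2 := by
  classical
  set P := Finset.univ.filter fun i => lam / 2 < ‖a (τ (t i)) - a (τ (s i))‖ with hP
  set Q := Finset.univ.filter fun i => ¬ lam / 2 < ‖a (τ (t i)) - a (τ (s i))‖ with hQ
  have h1 : (lam / 4) ^ 2 * P.card ≤ ∑ i ∈ Finset.range T, ‖blkSum (lam / 4) a T i‖ ^ 2 := by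
    refine card_jumps_le (by positivity) (u := fun i => τ (s i)) (v := fun i => τ (t i))
      (fun q hq => ⟨hτ (hst q).le, hT _ (ht q), ?_⟩) fun q _ r _ hqr => ?_
    · have := (Finset.mem_filter.1 hq).2
      linarith
    · rcases lt_or_gt_of_ne hqr with h | h
      · exact .inl (hτ (hd q r h).le)
      · exact .inr (hτ (hd r q h).le)
  have hsi : Function.Injective s := by
    intro q r hqr
    by_contra hne
    rcases lt_or_gt_of_ne hne with h | h
    · exact absurd ((hst q).trans (hd q r h)) (by simp [hqr])
    · exact absurd ((hst r).trans (hd r q h)) (by simp [hqr])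
  have hti : Function.Injective t := by
    intro q r hqr
    by_contra hne
    rcases lt_or_gt_of_ne hne with h | h
    · exact absurd ((hd q r h).trans (hst r)) (by simp [hqr])
    · exact absurd ((hd r q h).trans (hst q)) (by simp [hqr])
  have hsum : ∀ u : Fin J → ℤ, Function.Injective u → (∀ i, u i ∈ K₀) →
      ∑ i ∈ Q, ‖b (u i)‖ ^ 2 ≤ ∑ k ∈ K₀, ‖b k‖ ^ 2 := by
    intro u hu huK
    rw [← Finset.sum_image (f := fun k => ‖b k‖ ^ 2) fun x _ y _ hxy => hu hxy]
    refine Finset.sum_le_sum_of_subset_of_nonneg (fun k hk => ?_) fun _ _ _ => by positivity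
    obtain ⟨i, -, rfl⟩ := Finset.mem_image.1 hk
    exact huK i
  have h2 : (lam / 2) ^ 2 * Q.card ≤ 4 * ∑ k ∈ K₀, ‖b k‖ ^ 2 := by
    have : ∀ i ∈ Q, (lam / 2) ^ 2 ≤ 2 * ‖b (t i)‖ ^ 2 + 2 * ‖b (s i)‖ ^ 2 := by
      intro i hi
      have hi := not_lt.1 (Finset.mem_filter.1 hi).2
      have hji := hj i
      rw [hh _ (ht i), hh _ (hs i)] at hji
      have e : g - a (τ (t i)) + b (t i) - (g - a (τ (s i)) + b (s i)) =
        b (t i) - b (s i) - (a (τ (t i)) - a (τ (s i))) := by ring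
      rw [e] at hji
      have h3 := norm_sub_le (b (t i) - b (s i)) (a (τ (t i)) - a (τ (s i)))
      have h4 := norm_sub_le (b (t i)) (b (s i))
      have h5 : lam / 2 ≤ ‖b (t i)‖ + ‖b (s i)‖ := by linarith
      have h6 : (lam / 2) ^ 2 ≤ (‖b (t i)‖ + ‖b (s i)‖) ^ 2 := by gcongr
      nlinarith [sq_nonneg (‖b (t i)‖ - ‖b (s i)‖)]
    calc (lam / 2) ^ 2 * Q.card = ∑ i ∈ Q, (lam / 2) ^ 2 := by
          rw [Finset.sum_const, nsmul_eq_mul, mul_comm]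
      _ ≤ ∑ i ∈ Q, (2 * ‖b (t i)‖ ^ 2 + 2 * ‖b (s i)‖ ^ 2) := Finset.sum_le_sum this
      _ = 2 * ∑ i ∈ Q, ‖b (t i)‖ ^ 2 + 2 * ∑ i ∈ Q, ‖b (s i)‖ ^ 2 := by
          rw [Finset.sum_add_distrib, Finset.mul_sum, Finset.mul_sum]
      _ ≤ _ := by linarith [hsum t hti ht, hsum s hsi hs]
  have h3 : (P.card : ℝ) + Q.card = J := by
    have := Finset.card_filter_add_card_filter_not (s := (Finset.univ : Finset (Fin J)))
      fun i => lam / 2 < ‖a (τ (t i)) - a (τ (s i))‖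
    rw [Finset.card_univ, Fintype.card_fin] at this
    exact_mod_cast this
  rw [← h3]
  nlinarith

lemma jumpCount_le {lam W : ℝ} (hlam : 0 < lam) {𝒦 : Set ℤ} {h : ℤ → ℂ}
    (hW : ∀ (J : ℕ) (s t : Fin J → ℤ), (∀ i, s i ∈ 𝒦) → (∀ i, t i ∈ 𝒦) → (∀ i, s i < t i) →
      (∀ i j, i < j → t i < s j) → (∀ i, lam < ‖h (t i) - h (s i)‖) → lam ^ 2 * J ≤ W) :
    ENNReal.ofReal (lam ^ 2) * jumpCount lam 𝒦 h ≤ ENNReal.ofReal W := by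
  have : jumpCount lam 𝒦 h ≤ ENNReal.ofReal (W / lam ^ 2) := by
    refine iSup_le fun J => iSup_le fun s => iSup_le fun t => iSup_le fun hs => iSup_le fun ht =>
      iSup_le fun hst => iSup_le fun hd => iSup_le fun hj => ?_
    rw [← ENNReal.ofReal_natCast]
    refine ENNReal.ofReal_le_ofReal ((le_div_iff₀ (by positivity)).2 ?_)
    rw [mul_comm]
    exact hW J s t hs ht hst hd hj
  refine (mul_le_mul_right this _).trans_eq ?_
  rw [← ENNReal.ofReal_mul (by positivity), mul_div_cancel₀ _ (by positivity)]

/-- Kernels `σ l` at scale `2 ^ l`, perturbations `ν k l` of them which are summable in `k`,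
bumps `φ m` at scale `2 ^ m` and truncation parameters `μ k`. -/
structure Admissible (A : ℝ) (σ : ℤ → Rn n → ℂ) (ν : ℤ → ℤ → Rn n → ℂ) (φ : ℤ → Rn n → ℂ)
    (μ : ℤ → ℤ) (η : ℤ → ℤ → ℝ) : Prop where
  sigma_lip : ∀ l, LipKer 2 l A A (σ l)
  sigma_int : ∀ l, ∫ z, σ l z = 0
  phi_lip : ∀ m, LipKer 1 m A A (φ m)
  phi_int : ∀ m, ∫ z, φ m z = 1
  nu_lip : ∀ k l, l ≤ μ k → LipKer 2 l (η k l) (η k l) (ν k l)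
  nu_int : ∀ k l, l ≤ μ k → ∫ z, ν k l z = 0
  eta_sum : ∀ (K₀ : Finset ℤ) l, ∑ k ∈ K₀, (if l ≤ μ k then η k l else 0) ≤ A
  mult : ∀ (K₀ : Finset ℤ) m, ∑ k ∈ K₀, (if m = μ k then 1 else 0 : ℝ) ≤ A
  anti : Antitone μ

/-- The truncated sums of the kernels `σ l + ν k l`. -/
def truncSum (σ : ℤ → Rn n → ℂ) (ν : ℤ → ℤ → Rn n → ℂ) (μ : ℤ → ℤ) (Λ : Finset ℤ)
    (f : Rn n → ℂ) (x : Rn n) (k : ℤ) : ℂ :=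
  ∑ l ∈ Λ, if l ≤ μ k then kop (cker (σ l)) f x + kop (cker (ν k l)) f x else 0

lemma BiGood.zero (w : ℕ) (m : ℤ) : BiGood w m 0 (fun _ _ : Rn n => 0) := by
  simpa using BiGood.sum (w := w) (m := m) (∅ : Finset ℕ) (c := fun _ => 0)
    (a := fun _ (_ _ : Rn n) => (0 : ℂ)) (by simp)

lemma BiGood.ite {w : ℕ} {m : ℤ} {c : ℝ} {a : Rn n → Rn n → ℂ} {P : Prop} [Decidable P]
    (h : P → BiGood w m c a) :
    BiGood w m (if P then c else 0) (if P then a else fun _ _ => 0) := by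
  split_ifs with hP
  · exact h hP
  · exact BiGood.zero w m

lemma kop_zero (f : Rn n → ℂ) (x : Rn n) : kop (fun _ _ => 0) f x = 0 := by
  simp [kop]

lemma kop_ite {a : Rn n → Rn n → ℂ} {P : Prop} [Decidable P] (f : Rn n → ℂ) (x : Rn n) :
    kop (if P then a else fun _ _ => 0) f x = if P then kop a f x else 0 := by
  split_ifs
  · rfl
  · exact kop_zero f x

namespace Admissible

variable {A : ℝ} {σ : ℤ → Rn n → ℂ} {ν : ℤ → ℤ → Rn n → ℂ} {φ : ℤ → Rn n → ℂ} {μ : ℤ → ℤ}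
  {η : ℤ → ℤ → ℝ}

lemma A_nonneg (h : Admissible A σ ν φ μ η) : 0 ≤ A := (h.sigma_lip 0).A_nonneg

lemma sum_dec_le (h : Admissible A σ ν φ μ η) (K₀ : Finset ℤ) (l : ℤ) :
    ∑ k ∈ K₀, dec (μ k - l) ≤ A * (2 / (1 - rho ^ 2)) := by
  calc ∑ k ∈ K₀, dec (μ k - l)
      = ∑ k ∈ K₀, ∑ m ∈ K₀.image μ, (if m = μ k then 1 else 0) * dec (m - l) := by
        refine Finset.sum_congr rfl fun k hk => ?_
        simp only [ite_mul, one_mul, zero_mul]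
        rw [Finset.sum_ite_eq', if_pos (Finset.mem_image_of_mem μ hk)]
    _ = ∑ m ∈ K₀.image μ, (∑ k ∈ K₀, (if m = μ k then 1 else 0)) * dec (m - l) := by
        rw [Finset.sum_comm]
        exact Finset.sum_congr rfl fun m _ => by rw [Finset.sum_mul]
    _ ≤ ∑ m ∈ K₀.image μ, A * dec (m - l) := by
        gcongr with m _
        · exact (dec_pos _).le
        · exact h.mult K₀ m
    _ = A * ∑ m ∈ K₀.image μ, dec (m - l) := by rw [Finset.mul_sum]
    _ ≤ _ := mul_le_mul_of_nonneg_left (JumpNonosc.sum_dec_le _ _) h.A_nonneg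

end Admissible

/-- The constant in the estimates for products of kernels and bumps. -/
def prodCst (n : ℕ) (A : ℝ) : ℝ :=
  LipKer.cst n (A * (2 * 2) ^ n * (A * 2)) (A + A * (2 * 2) ^ n * A)

lemma LipKer.cst_nonneg {A B : ℝ} (hA : 0 ≤ A) : 0 ≤ LipKer.cst n A B := by
  unfold LipKer.cst; positivity

lemma LipKer.cst_mono {A B A' B' : ℝ} (hA0 : 0 ≤ A) (hB0 : 0 ≤ B) (hA : A ≤ A') (hB : B ≤ B') :
    LipKer.cst n A B ≤ LipKer.cst n A' B' := by
  have hA' : 0 ≤ A' := hA0.trans hA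
  unfold LipKer.cst
  gcongr

namespace Admissible

variable {A : ℝ} {σ : ℤ → Rn n → ℂ} {ν : ℤ → ℤ → Rn n → ℂ} {φ : ℤ → Rn n → ℂ} {μ : ℤ → ℤ}
  {η : ℤ → ℤ → ℝ}

lemma biGood_sigma (h : Admissible A σ ν φ μ η) (l : ℤ) :
    BiGood 3 l (LipKer.cst n A A) (cker (σ l)) :=
  ((h.sigma_lip l).biGood h.A_nonneg (h.sigma_int l)).mono (by norm_num) le_rfl

lemma biGood_nu (h : Admissible A σ ν φ μ η) {k l : ℤ} (hl : l ≤ μ k) :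
    BiGood 3 l (LipKer.cst n 1 1 * η k l) (cker (ν k l)) := by
  have h0 := (h.nu_lip k l hl).A_nonneg
  refine ((h.nu_lip k l hl).biGood h0 (h.nu_int k l hl)).mono (by norm_num) (le_of_eq ?_)
  rw [LipKer.cst, LipKer.cst, show 2 * η k l * (η k l * n) = η k l ^ 2 * (2 * 1 * (1 * n)) by ring,
    Real.sqrt_mul (by positivity), Real.sqrt_sq h0]
  ring

lemma biGood_avg (h : Admissible A σ ν φ μ η) (m : ℤ) :
    BiGood 3 m (1 + LipKer.cst n A A) (fun x y => avgKer m x y - cker (φ m) x y) :=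
  ((h.phi_lip m).biGood_avg_sub h.A_nonneg le_rfl (h.phi_int m)).mono (by norm_num) le_rfl

lemma biGood_fine (h : Admissible A σ ν φ μ η) {l m : ℤ} (hlm : l ≤ m) :
    BiGood 3 m (prodCst n A * dec (l - m)) (cker (conv (σ l) (φ m))) := by
  have hA := h.A_nonneg
  have h1 := (h.sigma_lip l).conv_fine (h.sigma_int l) (h.phi_lip m) hA hlm
  have h2 : ∫ z, conv (σ l) (φ m) z = 0 := by
    rw [integral_conv (h.sigma_lip l).integrable (h.phi_lip m).integrable, h.sigma_int, zero_mul]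
  refine (h1.biGood (by positivity) h2).mono (by norm_num) ?_
  refine (cst_dec_le (by positivity) (by positivity) hlm).trans ?_
  refine mul_le_mul_of_nonneg_right (LipKer.cst_mono (by positivity) (by positivity) ?_ ?_)
    (dec_pos _).le
  · norm_num
  · norm_num
    exact hA

lemma biGood_coarse (h : Admissible A σ ν φ μ η) {l m : ℤ} (hml : m ≤ l) :
    BiGood 3 l (prodCst n A * dec (m - l)) (cker fun z => σ l z - conv (σ l) (φ m) z) := by
  have hA := h.A_nonneg
  rw [conv_comm]
  have h1 := (h.phi_lip m).sub_conv_coarse (h.phi_int m) (h.sigma_lip l) hA hml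
  have hc : Integrable (conv (φ m) (σ l)) := by
    exact (h.phi_lip m).integrable.integrable_convolution
      (ContinuousLinearMap.mul ℝ ℂ) (h.sigma_lip l).integrable
  have h2 : ∫ z, σ l z - conv (φ m) (σ l) z = 0 := by
    rw [integral_sub (h.sigma_lip l).integrable hc,
      integral_conv (h.phi_lip m).integrable (h.sigma_lip l).integrable, h.sigma_int, mul_zero,
      sub_zero]
  refine (h1.biGood (by positivity) h2).mono (by norm_num) ?_
  refine (cst_dec_le (by positivity) (by positivity) hml).trans ?_
  refine mul_le_mul_of_nonneg_right (LipKer.cst_mono (by positivity) (by positivity) ?_ ?_)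
    (dec_pos _).le
  · have : (2 * 1 : ℝ) ^ n ≤ (2 * 2) ^ n := by gcongr; norm_num
    push_cast
    gcongr
    norm_num
  · have : (2 * 1 : ℝ) ^ n ≤ (2 * 2) ^ n := by gcongr; norm_num
    push_cast
    gcongr

/-- The error term in the comparison of the truncated sums with dyadic averages. -/
def err (σ : ℤ → Rn n → ℂ) (ν : ℤ → ℤ → Rn n → ℂ) (φ : ℤ → Rn n → ℂ) (μ : ℤ → ℤ)
    (Λ : Finset ℤ) (f g : Rn n → ℂ) (x : Rn n) (k : ℤ) : ℂ :=
  kop (fun x y => avgKer (μ k) x y - cker (φ (μ k)) x y) g x +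
    kop (fun x y => ∑ l ∈ Λ, (if l ≤ μ k then cker (conv (σ l) (φ (μ k))) else fun _ _ => 0) x y)
      f x -
    (∑ l ∈ Λ, kop (if μ k < l then cker (fun z => σ l z - conv (σ l) (φ (μ k)) z)
      else fun _ _ => 0) f x) +
    ∑ l ∈ Λ, kop (if l ≤ μ k then cker (ν k l) else fun _ _ => 0) f x

lemma truncSum_eq (h : Admissible A σ ν φ μ η) (Λ : Finset ℤ) {f : Rn n → ℂ} (hf : AllLp f)
    (x : Rn n) (k : ℤ) :
    truncSum σ ν μ Λ f x k = kop (fun x y => ∑ l ∈ Λ, cker (σ l) x y) f x -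
      cavg (μ k) (kop (fun x y => ∑ l ∈ Λ, cker (σ l) x y) f) x +
      err σ ν φ μ Λ f (kop (fun x y => ∑ l ∈ Λ, cker (σ l) x y) f) x k := by
  have hσ : ∀ l ∈ Λ, FinRange (cker (σ l)) := fun l _ => (h.sigma_lip l).finRange
  have hφ := (h.phi_lip (μ k)).finRange
  set g := kop (fun x y => ∑ l ∈ Λ, cker (σ l) x y) f with hg
  have hgL : AllLp g := hf.kop (FinRange.sum Λ hσ)
  have hge : g = fun x => ∑ l ∈ Λ, kop (cker (σ l)) f x := by
    funext x
    exact kop_finset_sum Λ hσ hf.locInt x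
  have hcv : ∀ l, FinRange (cker (conv (σ l) (φ (μ k)))) := by
    intro l
    rcases le_total l (μ k) with hl | hl
    · exact ((h.sigma_lip l).conv_fine (h.sigma_int l) (h.phi_lip _) h.A_nonneg hl).finRange
    · have h1 := ((h.phi_lip (μ k)).sub_conv_coarse (h.phi_int _) (h.sigma_lip l) h.A_nonneg
        hl).finRange
      have h2 := (h.sigma_lip l).finRange.add (h1.const_mul (-1))
      convert h2 using 3
      simp [cker, conv_comm]
  have e1 : kop (cker (φ (μ k))) g x = ∑ l ∈ Λ, kop (cker (conv (σ l) (φ (μ k)))) f x := by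
    rw [hge, kop_finset_sum_fun Λ hφ fun l hl => (hf.kop (hσ l hl)).locInt]
    exact Finset.sum_congr rfl fun l _ => (h.sigma_lip l).kop_conv (h.phi_lip _) hf.two x
  have e2 : kop (fun x y => ∑ l ∈ Λ,
      (if l ≤ μ k then cker (conv (σ l) (φ (μ k))) else fun _ _ => 0) x y) f x =
      ∑ l ∈ Λ, if l ≤ μ k then kop (cker (conv (σ l) (φ (μ k)))) f x else 0 := by
    rw [kop_finset_sum Λ (fun l _ => ?_) hf.locInt]
    · exact Finset.sum_congr rfl fun l _ => kop_ite f x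
    · split_ifs
      · exact hcv l
      · exact FinRange.zero
  have e3 : ∀ l, kop (cker fun z => σ l z - conv (σ l) (φ (μ k)) z) f x =
      kop (cker (σ l)) f x - kop (cker (conv (σ l) (φ (μ k)))) f x := fun l =>
    kop_sub_ker (h.sigma_lip l).finRange (hcv l) hf.locInt x
  have e4 : g x = ∑ l ∈ Λ, kop (cker (σ l)) f x := by rw [hge]
  rw [err, kop_sub_ker (finRange_avgKer _) hφ hgL.locInt, e1, e2, cavg, e4]
  simp only [kop_ite, e3, truncSum]
  have e5 : ∑ l ∈ Λ, (if l ≤ μ k then kop (cker (σ l)) f x + kop (cker (ν k l)) f x else 0) =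
      ∑ l ∈ Λ, kop (cker (σ l)) f x - ∑ l ∈ Λ, kop (cker (conv (σ l) (φ (μ k)))) f x +
      ∑ l ∈ Λ, (if l ≤ μ k then kop (cker (conv (σ l) (φ (μ k)))) f x else 0) -
      (∑ l ∈ Λ, if μ k < l then kop (cker (σ l)) f x - kop (cker (conv (σ l) (φ (μ k)))) f x
        else 0) + ∑ l ∈ Λ, (if l ≤ μ k then kop (cker (ν k l)) f x else 0) := by
    simp only [← Finset.sum_add_distrib, ← Finset.sum_sub_distrib]
    refine Finset.sum_congr rfl fun l _ => ?_
    rcases le_or_gt l (μ k) with hl | hl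
    · simp [hl, hl.not_gt]
    · simp [hl, hl.not_ge]
  rw [e5]
  ring

end Admissible

/-- The jump inequality for truncated sums, with constants independent of the truncation. -/
theorem exists_jump_bound [NeZero n] (A : ℝ) {p : ℝ} (hp : 1 < p) :
    ∃ C : ℝ≥0∞, C ≠ ⊤ ∧ ∀ (σ : ℤ → Rn n → ℂ) (ν : ℤ → ℤ → Rn n → ℂ) (φ : ℤ → Rn n → ℂ)
      (μ : ℤ → ℤ) (η : ℤ → ℤ → ℝ), Admissible A σ ν φ μ η → ∀ (Λ K₀ : Finset ℤ) (f : Rn n → ℂ),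
      AllLp f → ∀ lam : ℝ, 0 < lam → ∃ W : Rn n → ℝ,
        PowBd (p / 2) W (C * eLpNorm f (ENNReal.ofReal p) volume ^ p) ∧
        ∀ x, ENNReal.ofReal (lam ^ 2) * jumpCount lam (K₀ : Set ℤ) (truncSum σ ν μ Λ f x) ≤
          ENNReal.ofReal (W x) := by
  obtain ⟨C₁, hC₁, h₁⟩ := exists_blkSum_bound (n := n) hp
  obtain ⟨C₂, hC₂, h₂⟩ := exists_kop_squareFn_bound (n := n) (ι := ℤ) 3 hp
  obtain ⟨C₃, hC₃, h₃⟩ := exists_bound (n := n) 3 hp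
  have hp0 : 0 ≤ p := by linarith
  set D : ℝ := 2 / (1 - rho ^ 2) with hD
  have hD0 : 0 ≤ D := by
    have := sum_dec_le ∅ 0
    simpa [hD] using this
  set c₀ : ℝ := |A| * (1 + LipKer.cst n |A| |A| + prodCst n |A| * D + LipKer.cst n 1 1) +
    LipKer.cst n |A| |A| + 1 with hc₀
  set R : ℝ≥0∞ := (C₃ * ENNReal.ofReal c₀) ^ p with hR
  set q : ℝ := p / 2 with hq
  set E : ℝ≥0∞ := C₂ * ENNReal.ofReal c₀ ^ p with hE
  set t : ℝ≥0∞ := ENNReal.ofReal (2 ^ q) with ht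
  have hq0 : 0 ≤ q := by positivity
  have hRt : R ≠ ⊤ := ENNReal.rpow_ne_top_of_nonneg hp0 (ENNReal.mul_ne_top hC₃
    ENNReal.ofReal_ne_top)
  have hEt : E ≠ ⊤ := ENNReal.mul_ne_top hC₂ (ENNReal.rpow_ne_top_of_nonneg hp0
    ENNReal.ofReal_ne_top)
  have htt : t ≠ ⊤ := ENNReal.ofReal_ne_top
  refine ⟨t * (ENNReal.ofReal (16 ^ q) * (C₁ * R) +
    ENNReal.ofReal (64 ^ q) * (t * (t * (E * R + E) + t * (E + E)))), ?_,
    fun σ ν φ μ η h Λ K₀ f hf lam hlam => ?_⟩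
  · have := ENNReal.ofReal_ne_top (r := 16 ^ q)
    have := ENNReal.ofReal_ne_top (r := 64 ^ q)
    finiteness
  have hA := h.A_nonneg
  rw [abs_of_nonneg hA] at hc₀
  have k1 : 0 ≤ LipKer.cst n A A := LipKer.cst_nonneg hA
  have k2 : 0 ≤ prodCst n A := LipKer.cst_nonneg (by positivity)
  have k3 : 0 ≤ LipKer.cst n 1 1 := LipKer.cst_nonneg zero_le_one
  have k4 : 0 ≤ A * LipKer.cst n A A := by positivity
  have k5 : 0 ≤ A * (prodCst n A * D) := by positivity
  have k6 : 0 ≤ A * LipKer.cst n 1 1 := by positivity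
  have hc0 : 0 < c₀ := by rw [hc₀]; positivity
  set N := eLpNorm f (ENNReal.ofReal p) volume with hN
  set g := kop (fun x y => ∑ l ∈ Λ, cker (σ l) x y) f with hg
  have hgL : AllLp g := hf.kop (FinRange.sum Λ fun l _ => (h.sigma_lip l).finRange)
  have hgN : eLpNorm g (ENNReal.ofReal p) volume ^ p ≤ R * N ^ p := by
    rw [hR, ← ENNReal.mul_rpow_of_nonneg _ _ hp0]
    refine ENNReal.rpow_le_rpow (h₃ Λ (fun l => cker (σ l)) c₀ hc0 (fun l _ =>
      (h.biGood_sigma l).mono le_rfl ?_) f hf) hp0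
    rw [hc₀]; linarith
  have conv2 : ∀ M : ℝ≥0∞, C₂ * (ENNReal.ofReal c₀ * M) ^ p = E * M ^ p := by
    intro M
    rw [ENNReal.mul_rpow_of_nonneg _ _ hp0, hE, mul_assoc]
  -- the martingale blocks
  obtain ⟨M, hM⟩ : ∃ M : ℤ, ∀ k ∈ K₀, μ k ≤ M := by
    obtain ⟨M, hM⟩ := (K₀.image μ).bddAbove
    exact ⟨M, fun k hk => hM (Finset.mem_coe.2 (Finset.mem_image_of_mem μ hk))⟩
  set τ : ℤ → ℕ := fun k => (M - μ k).toNat with hτ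
  obtain ⟨T, hT⟩ : ∃ T : ℕ, ∀ k ∈ K₀, τ k ≤ T := by
    obtain ⟨T, hT⟩ := (K₀.image τ).bddAbove
    exact ⟨T, fun k hk => hT (Finset.mem_coe.2 (Finset.mem_image_of_mem τ hk))⟩
  have b0 := (h₁ M T (lam / 4) g hgL).mono (mul_le_mul_right hgN C₁)
  -- the four error terms
  have hmem : ∀ k ∈ K₀, μ k ∈ K₀.image μ := fun k hk => Finset.mem_image_of_mem μ hk
  have b1 := h₂ K₀ (K₀.image μ)
    (fun k m => if m = μ k then fun x y => avgKer m x y - cker (φ m) x y else fun _ _ => 0)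
    (fun k m => if m = μ k then 1 + LipKer.cst n A A else 0) c₀ hc0
    (fun k _ m _ => BiGood.ite fun _ => h.biGood_avg m) (fun m _ => ?_) g hgL
  swap
  · calc ∑ k ∈ K₀, (if m = μ k then 1 + LipKer.cst n A A else 0)
        = (∑ k ∈ K₀, (if m = μ k then 1 else 0)) * (1 + LipKer.cst n A A) := by
          rw [Finset.sum_mul]; simp
      _ ≤ A * (1 + LipKer.cst n A A) := mul_le_mul_of_nonneg_right (h.mult K₀ m) (by positivity)
      _ ≤ c₀ := by rw [hc₀]; linarith
  have b2 := h₂ K₀ (K₀.image μ)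
    (fun k m => if m = μ k then fun x y => ∑ l ∈ Λ,
      (if l ≤ m then cker (conv (σ l) (φ m)) else fun _ _ => 0) x y else fun _ _ => 0)
    (fun k m => if m = μ k then prodCst n A * D else 0) c₀ hc0
    (fun k _ m _ => BiGood.ite fun _ => ?_) (fun m _ => ?_) f hf
  rotate_left
  · refine (BiGood.sum Λ fun l _ => BiGood.ite fun hl => h.biGood_fine hl).mono le_rfl ?_
    calc ∑ l ∈ Λ, (if l ≤ m then prodCst n A * dec (l - m) else 0)
        ≤ ∑ l ∈ Λ, prodCst n A * dec (l - m) := by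
          refine Finset.sum_le_sum fun l _ => ?_
          have := dec_pos (l - m)
          split_ifs
          · exact le_rfl
          · positivity
      _ ≤ prodCst n A * D := by
          rw [← Finset.mul_sum]
          exact mul_le_mul_of_nonneg_left (sum_dec_le _ _) k2
  · calc ∑ k ∈ K₀, (if m = μ k then prodCst n A * D else 0)
        = (∑ k ∈ K₀, (if m = μ k then 1 else 0)) * (prodCst n A * D) := by
          rw [Finset.sum_mul]; simp
      _ ≤ A * (prodCst n A * D) := mul_le_mul_of_nonneg_right (h.mult K₀ m) (by positivity)
      _ ≤ c₀ := by rw [hc₀]; linarith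
  have b3 := h₂ K₀ Λ
    (fun k l => if μ k < l then cker (fun z => σ l z - conv (σ l) (φ (μ k)) z) else fun _ _ => 0)
    (fun k l => if μ k < l then prodCst n A * dec (μ k - l) else 0) c₀ hc0
    (fun k _ l _ => BiGood.ite fun hl => h.biGood_coarse hl.le) (fun l _ => ?_) f hf
  swap
  · calc ∑ k ∈ K₀, (if μ k < l then prodCst n A * dec (μ k - l) else 0)
        ≤ ∑ k ∈ K₀, prodCst n A * dec (μ k - l) := by
          refine Finset.sum_le_sum fun k _ => ?_
          have := dec_pos (μ k - l)
          split_ifs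
          · exact le_rfl
          · positivity
      _ ≤ prodCst n A * (A * D) := by
          rw [← Finset.mul_sum]
          exact mul_le_mul_of_nonneg_left (h.sum_dec_le _ _) k2
      _ ≤ c₀ := by rw [hc₀]; linarith
  have b4 := h₂ K₀ Λ (fun k l => if l ≤ μ k then cker (ν k l) else fun _ _ => 0)
    (fun k l => if l ≤ μ k then LipKer.cst n 1 1 * η k l else 0) c₀ hc0
    (fun k _ l _ => BiGood.ite fun hl => h.biGood_nu hl) (fun l _ => ?_) f hf
  swap
  · calc ∑ k ∈ K₀, (if l ≤ μ k then LipKer.cst n 1 1 * η k l else 0)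
        = LipKer.cst n 1 1 * ∑ k ∈ K₀, (if l ≤ μ k then η k l else 0) := by
          rw [Finset.mul_sum]; simp
      _ ≤ LipKer.cst n 1 1 * A := mul_le_mul_of_nonneg_left (h.eta_sum K₀ l) k3
      _ ≤ c₀ := by rw [hc₀]; linarith
  rw [conv2] at b1 b2 b3 b4
  replace b1 := b1.mono (mul_le_mul_right hgN E)
  have b := (b0.const_mul (by norm_num : (0 : ℝ) ≤ 16)).add hq0
    (((b1.add hq0 b2).add hq0 (b3.add hq0 b4)).const_mul (by norm_num : (0 : ℝ) ≤ 64))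
  refine ⟨_, b.mono (le_of_eq (by ring)), fun x => ?_⟩
  refine jumpCount_le hlam fun J s t' hs ht' hst hd hj => ?_
  refine (sq_mul_jumps_le hlam (g x) (a := avgSeq M g x) (b := Admissible.err σ ν φ μ Λ f g x)
    (τ := τ) (K₀ := K₀) (T := T) (fun k l hkl => ?_) hT (fun k hk => ?_) hs ht' hst hd hj).trans ?_
  · have := h.anti hkl
    simp only [hτ]
    lia
  · have hk := hM k hk
    rw [h.truncSum_eq Λ hf, avgSeq]
    congr 4
    simp only [hτ]
    lia
  · refine add_le_add_right ?_ _
    rw [show (64 : ℝ) = 16 * 4 by norm_num, mul_assoc]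
    refine mul_le_mul_of_nonneg_left ?_ (by norm_num)
    simp only [← Finset.sum_add_distrib]
    rw [Finset.mul_sum]
    refine Finset.sum_le_sum fun k hk => ?_
    have four : ∀ a b c d : ℂ, ‖a + b - c + d‖ ^ 2 ≤
        4 * (‖a‖ ^ 2 + ‖b‖ ^ 2 + (‖c‖ ^ 2 + ‖d‖ ^ 2)) := by
      intro a b c d
      have h1 := norm_add_le (a + b - c) d
      have h2 := norm_sub_le (a + b) c
      have h3 := norm_add_le a b
      have h4 : ‖a + b - c + d‖ ^ 2 ≤ (‖a‖ + ‖b‖ + ‖c‖ + ‖d‖) ^ 2 := by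
        gcongr; linarith
      nlinarith [sq_nonneg (‖a‖ - ‖b‖), sq_nonneg (‖a‖ - ‖c‖), sq_nonneg (‖a‖ - ‖d‖),
        sq_nonneg (‖b‖ - ‖c‖), sq_nonneg (‖b‖ - ‖d‖), sq_nonneg (‖c‖ - ‖d‖)]
    refine (four _ _ _ _).trans (le_of_eq ?_)
    simp only [kop_ite]
    rw [Finset.sum_ite_eq', if_pos (hmem k hk), Finset.sum_ite_eq', if_pos (hmem k hk)]

end Jumps

/-! ### Phase functions -/

section Phase

lemma sum_two_zpow_le (S : Finset ℤ) : ∀ N : ℤ, (∀ k ∈ S, k ≤ N) →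
    ∑ k ∈ S, (2 : ℝ) ^ k ≤ 2 ^ (N + 1) := by
  induction S using Finset.induction_on_max with
  | empty => intro N _; simp; positivity
  | insert a S ha ih =>
    intro N hN
    rw [Finset.sum_insert fun h => lt_irrefl a (ha a h)]
    have h1 := ih (a - 1) fun k hk => by have := ha k hk; lia
    rw [sub_add_cancel] at h1
    have h2 : (2 : ℝ) ^ (a + 1) ≤ 2 ^ (N + 1) :=
      zpow_le_zpow_right₀ (by norm_num) (by have := hN a (by simp); lia)
    rw [zpow_add_one₀ (by norm_num : (2 : ℝ) ≠ 0) a] at h2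
    linarith

lemma sum_two_zpow_mul_le {S : Finset ℤ} {a : ℝ} (h : ∀ k ∈ S, (2 : ℝ) ^ k * a ≤ 1) (ha : 0 ≤ a) :
    ∑ k ∈ S, (2 : ℝ) ^ k * a ≤ 2 := by
  rcases S.eq_empty_or_nonempty with rfl | hS
  · simp
  have h1 := sum_two_zpow_le S (S.max' hS) fun k hk => S.le_max' k hk
  have h2 := h _ (S.max'_mem hS)
  rw [zpow_add_one₀ (by norm_num)] at h1
  rw [← Finset.sum_mul]
  nlinarith

end Phase

end JumpNonosc

namespace IsGammaU

variable {Γ : ℝ → ℝ}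

lemma differentiableAt (h : IsGammaU Γ) {s : ℝ} (hs : 0 < s) : DifferentiableAt ℝ Γ s :=
  (h.smooth.contDiffAt (Ioi_mem_nhds hs)).differentiableAt (by simp)

lemma strictMonoOn (h : IsGammaU Γ) : StrictMonoOn Γ (Ici 0) :=
  strictMonoOn_of_deriv_pos (convex_Ici 0) h.continuousOn fun s hs => by
    rw [interior_Ici] at hs
    exact h.deriv_pos s hs

lemma pos (h : IsGammaU Γ) {s : ℝ} (hs : 0 < s) : 0 < Γ s := by
  have := h.strictMonoOn (mem_Ici.2 le_rfl) hs.le hs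
  rwa [h.map_zero] at this

lemma le_of_le (h : IsGammaU Γ) {s t : ℝ} (hs : 0 ≤ s) (hst : s ≤ t) : Γ s ≤ Γ t :=
  h.strictMonoOn.monotoneOn hs (hs.trans hst) hst

lemma continuous_norm {E : Type*} [NormedAddCommGroup E] (h : IsGammaU Γ) :
    Continuous fun t : E => Γ ‖t‖ :=
  h.continuousOn.comp_continuous _root_.continuous_norm fun _ => norm_nonneg _

lemma exists_deriv_ge (h : IsGammaU Γ) :
    ∃ c > 0, ∀ s > 0, c * Γ s ≤ s * deriv Γ s := by
  obtain ⟨c, hc, hc'⟩ := h.lower 1 (by simp)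
  refine ⟨c, hc, fun s hs => ?_⟩
  have := hc' s hs
  have hΓ := h.pos hs
  have hd := h.deriv_pos s hs
  rw [iteratedDeriv_one, pow_one, abs_of_pos (by positivity), le_div_iff₀ hΓ] at this
  exact this

lemma exists_deriv_le (h : IsGammaU Γ) :
    ∃ c > 0, ∀ s > 0, s * deriv Γ s ≤ c * Γ s := by
  obtain ⟨c, hc, hc'⟩ := h.upper 1 le_rfl
  refine ⟨c, hc, fun s hs => ?_⟩
  have := hc' s hs
  have hΓ := h.pos hs
  have hd := h.deriv_pos s hs
  rw [iteratedDeriv_one, pow_one, abs_of_pos (by positivity), div_le_iff₀ hΓ] at this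
  exact this

lemma hasDerivAt_rpow_mul (h : IsGammaU Γ) (c : ℝ) {s : ℝ} (hs : 0 < s) :
    HasDerivAt (fun s => s ^ (-c) * Γ s) (s ^ (-c - 1) * (s * deriv Γ s - c * Γ s)) s := by
  have := (Real.hasDerivAt_rpow_const (p := -c) (.inl hs.ne')).mul (h.differentiableAt hs).hasDerivAt
  refine this.congr_deriv ?_
  have e : s ^ (-c) = s ^ (-c - 1) * s := by
    rw [← Real.rpow_add_one hs.ne']; ring_nf
  rw [e]; ring

lemma exists_growth (h : IsGammaU Γ) :
    ∃ c > (0 : ℝ), ∀ s ≥ 1, s ^ c * Γ 1 ≤ Γ s := by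
  obtain ⟨c, hc, hc'⟩ := h.exists_deriv_ge
  have hm : MonotoneOn (fun s => s ^ (-c) * Γ s) (Ioi 0) := by
    refine monotoneOn_of_deriv_nonneg (convex_Ioi 0)
      (fun s hs => (h.hasDerivAt_rpow_mul c hs).continuousAt.continuousWithinAt)
      (fun s hs => ?_) fun s hs => ?_
    · rw [interior_Ioi] at hs
      exact (h.hasDerivAt_rpow_mul c hs).differentiableAt.differentiableWithinAt
    · rw [interior_Ioi] at hs
      rw [(h.hasDerivAt_rpow_mul c hs).deriv]
      have := hc' s hs
      have hs0 : 0 < s := hs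
      exact mul_nonneg (by positivity) (by linarith)
  refine ⟨c, hc, fun s hs => ?_⟩
  have hs0 : 0 < s := by linarith
  have := hm (mem_Ioi.2 one_pos) hs0 hs
  simp only [Real.one_rpow, one_mul] at this
  rw [Real.rpow_neg hs0.le] at this
  rwa [inv_mul_eq_div, le_div_iff₀ (by positivity), mul_comm] at this

lemma exists_doubling (h : IsGammaU Γ) :
    ∃ D ≥ 1, (∀ s > 0, Γ (2 * s) ≤ D * Γ s) ∧ ∀ s > 0, s * deriv Γ s ≤ D * Γ s := by
  obtain ⟨c, hc, hc'⟩ := h.exists_deriv_le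
  have hm : AntitoneOn (fun s => s ^ (-c) * Γ s) (Ioi 0) := by
    refine antitoneOn_of_deriv_nonpos (convex_Ioi 0)
      (fun s hs => (h.hasDerivAt_rpow_mul c hs).continuousAt.continuousWithinAt)
      (fun s hs => ?_) fun s hs => ?_
    · rw [interior_Ioi] at hs
      exact (h.hasDerivAt_rpow_mul c hs).differentiableAt.differentiableWithinAt
    · rw [interior_Ioi] at hs
      rw [(h.hasDerivAt_rpow_mul c hs).deriv]
      have := hc' s hs
      have hs0 : 0 < s := hs
      exact mul_nonpos_of_nonneg_of_nonpos (by positivity) (by linarith)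
  refine ⟨max (2 ^ c) c, le_max_of_le_left (Real.one_le_rpow one_le_two hc.le), fun s hs => ?_,
    fun s hs => (hc' s hs).trans ?_⟩
  · have h2 : 0 < 2 * s := by positivity
    have := hm (mem_Ioi.2 hs) (mem_Ioi.2 h2) (by linarith)
    have e : (2 * s) ^ (-c) = (2 ^ c)⁻¹ * s ^ (-c) := by
      rw [Real.mul_rpow zero_le_two hs.le, Real.rpow_neg zero_le_two]
    simp only [e] at this
    have hs' : 0 < s ^ (-c) := by positivity
    have h3 : (2 ^ c)⁻¹ * Γ (2 * s) ≤ Γ s := by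
      refine le_of_mul_le_mul_left ?_ hs'
      calc _ = (2 ^ c)⁻¹ * s ^ (-c) * Γ (2 * s) := by ring
        _ ≤ _ := this
    rw [inv_mul_le_iff₀ (by positivity)] at h3
    exact h3.trans (mul_le_mul_of_nonneg_right (le_max_left _ _) (h.pos hs).le)
  · exact mul_le_mul_of_nonneg_right (le_max_right _ _) (h.pos hs).le

lemma kstar_set_bddAbove (h : IsGammaU Γ) (k : ℤ) :
    BddAbove {m : ℤ | (2 : ℝ) ^ k * Γ (2 ^ m) ≤ 1} := by
  obtain ⟨c, hc, hc'⟩ := h.exists_growth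
  have h1 := h.pos one_pos
  have ht : Tendsto (fun s : ℝ => (2 : ℝ) ^ k * (s ^ c * Γ 1)) atTop atTop :=
    ((tendsto_rpow_atTop hc).atTop_mul_const h1).const_mul_atTop (by positivity)
  obtain ⟨R, hR⟩ := (eventually_atTop.1 (ht.eventually (eventually_gt_atTop 1)))
  obtain ⟨N, hN⟩ := pow_unbounded_of_one_lt (max R 1) (one_lt_two : (1 : ℝ) < 2)
  refine ⟨N, fun m hm => ?_⟩
  by_contra hlt
  have h2 : (2 : ℝ) ^ (N : ℤ) ≤ 2 ^ m := zpow_le_zpow_right₀ one_le_two (not_le.1 hlt).le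
  rw [zpow_natCast] at h2
  have h3 := hR (2 ^ m) ((le_max_left R 1).trans (hN.le.trans h2))
  have h4 := hc' (2 ^ m) ((le_max_right R 1).trans (hN.le.trans h2))
  have h5 : (2 : ℝ) ^ k * Γ (2 ^ m) ≤ 1 := hm
  have : (2 : ℝ) ^ k * ((2 ^ m) ^ c * Γ 1) ≤ 2 ^ k * Γ (2 ^ m) := by gcongr
  linarith

lemma kstar_set_nonempty (h : IsGammaU Γ) (k : ℤ) :
    {m : ℤ | (2 : ℝ) ^ k * Γ (2 ^ m) ≤ 1}.Nonempty := by
  have h0 : Tendsto Γ (𝓝[≥] 0) (𝓝 (Γ 0)) := h.continuousOn 0 (mem_Ici.2 le_rfl)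
  have ht : Tendsto (fun N : ℕ => (2 : ℝ) ^ (-(N : ℤ))) atTop (𝓝[≥] 0) := by
    refine tendsto_nhdsWithin_iff.2 ⟨?_, .of_forall fun N => mem_Ici.2 (by positivity)⟩
    simp only [zpow_neg, zpow_natCast, ← inv_pow]
    exact tendsto_pow_atTop_nhds_zero_of_lt_one (by norm_num) (by norm_num)
  have h1 := (h0.comp ht).const_mul ((2 : ℝ) ^ k)
  rw [h.map_zero, mul_zero] at h1
  obtain ⟨N, hN⟩ := (h1.eventually (eventually_le_nhds one_pos)).exists
  exact ⟨_, hN⟩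

lemma le_kstar_iff (h : IsGammaU Γ) {k l : ℤ} : l ≤ kstar Γ k ↔ (2 : ℝ) ^ k * Γ (2 ^ l) ≤ 1 := by
  refine ⟨fun hl => ?_, fun hl => le_csSup (h.kstar_set_bddAbove k) hl⟩
  have h1 : (2 : ℝ) ^ k * Γ (2 ^ kstar Γ k) ≤ 1 :=
    Int.csSup_mem (h.kstar_set_nonempty k) (h.kstar_set_bddAbove k)
  refine le_trans (mul_le_mul_of_nonneg_left (h.le_of_le (by positivity) ?_) (by positivity)) h1
  exact zpow_le_zpow_right₀ one_le_two hl

lemma kstar_antitone (h : IsGammaU Γ) : Antitone (kstar Γ) := by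
  intro k k' hk
  rw [h.le_kstar_iff]
  refine le_trans (mul_le_mul_of_nonneg_right ?_ (h.pos (by positivity)).le)
    (h.le_kstar_iff.1 le_rfl)
  exact zpow_le_zpow_right₀ one_le_two hk

lemma sum_phase_le (h : IsGammaU Γ) (K₀ : Finset ℤ) (l : ℤ) :
    ∑ k ∈ K₀, (if l ≤ kstar Γ k then (2 : ℝ) ^ k * Γ (2 ^ l) else 0) ≤ 2 := by
  rw [← Finset.sum_filter]
  exact JumpNonosc.sum_two_zpow_mul_le (fun k hk => h.le_kstar_iff.1 (Finset.mem_filter.1 hk).2)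
    (h.pos (by positivity)).le

lemma sum_kstar_eq_le (h : IsGammaU Γ) {D : ℝ} (hD : 1 ≤ D) (hΓ : ∀ s > 0, Γ (2 * s) ≤ D * Γ s)
    (K₀ : Finset ℤ) (m : ℤ) :
    ∑ k ∈ K₀, (if m = kstar Γ k then 1 else 0 : ℝ) ≤ D * 2 := by
  refine le_trans ?_ (mul_le_mul_of_nonneg_left (h.sum_phase_le K₀ m) (by linarith))
  rw [Finset.mul_sum]
  refine Finset.sum_le_sum fun k _ => ?_
  have hpos := h.pos (s := 2 ^ m) (by positivity)
  split_ifs with h1 h2 h2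
  · have h3 : ¬ m + 1 ≤ kstar Γ k := by lia
    rw [h.le_kstar_iff, not_le, zpow_add_one₀ (by norm_num), mul_comm _ (2 : ℝ)] at h3
    have h4 := hΓ (2 ^ m) (by positivity)
    have h5 : (2 : ℝ) ^ k * Γ (2 * 2 ^ m) ≤ 2 ^ k * (D * Γ (2 ^ m)) := by gcongr
    linarith
  · exact absurd h1.le h2
  · positivity
  · simp

end IsGammaU

namespace JumpNonosc

/-! ### Homogeneous kernels -/

section Kernels

variable {n : ℕ}

/-- The `L¹`-normalised dilation of `κ` to scale `2 ^ l`. -/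
def dil (l : ℤ) (κ : Rn n → ℂ) (z : Rn n) : ℂ :=
  ((cubeVol n l)⁻¹ : ℝ) * κ ((2 : ℝ) ^ (-l) • z)

lemma norm_two_zpow_smul (l : ℤ) (z : Rn n) : ‖(2 : ℝ) ^ (-l) • z‖ = ‖z‖ / 2 ^ l := by
  rw [norm_smul, Real.norm_of_nonneg (by positivity), zpow_neg, inv_mul_eq_div]

lemma lipKer_dil {w : ℕ} (l : ℤ) {A B : ℝ} {κ : Rn n → ℂ} (hA : ∀ z, ‖κ z‖ ≤ A)
    (hB : ∀ z z', ‖κ z - κ z'‖ ≤ B * ‖z - z'‖) (hs : ∀ z, κ z ≠ 0 → ‖z‖ ≤ w) :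
    LipKer w l A B (dil l κ) where
  bound z := by
    have hV := cubeVol_pos (n := n) l
    rw [dil, norm_mul, Complex.norm_real, Real.norm_of_nonneg (by positivity), mul_comm]
    gcongr
    exact hA _
  lip z z' := by
    have hV := cubeVol_pos (n := n) l
    rw [dil, dil, ← mul_sub, norm_mul, Complex.norm_real, Real.norm_of_nonneg (by positivity),
      mul_comm]
    gcongr
    rw [← norm_two_zpow_smul, smul_sub]
    exact hB _ _
  supp z hz := by
    have := hs _ (right_ne_zero_of_mul hz)
    rwa [norm_two_zpow_smul, div_le_iff₀ (by positivity)] at this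

lemma integral_dil (l : ℤ) (κ : Rn n → ℂ) : ∫ z, dil l κ z = ∫ z, κ z := by
  have hV := cubeVol_pos (n := n) l
  simp only [dil]
  rw [integral_const_mul, Measure.integral_comp_smul, finrank_euclideanSpace_fin,
    abs_of_pos (by positivity), Complex.real_smul, ← mul_assoc, ← Complex.ofReal_mul]
  have : (cubeVol n l)⁻¹ * (((2 : ℝ) ^ (-l)) ^ n)⁻¹ = 1 := by
    rw [cubeVol, zpow_neg, inv_pow, inv_inv, inv_mul_cancel₀ (by positivity)]
  rw [this, Complex.ofReal_one, one_mul]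

lemma exists_lipschitz_bound {κ : Rn n → ℂ} (h : ContDiff ℝ 1 κ) (hc : HasCompactSupport κ) :
    ∃ A : ℝ, 0 ≤ A ∧ (∀ z, ‖κ z‖ ≤ A) ∧ ∀ z z', ‖κ z - κ z'‖ ≤ A * ‖z - z'‖ := by
  obtain ⟨A, hA⟩ := h.continuous.bounded_above_of_compact_support hc
  obtain ⟨B, hB⟩ := h.lipschitzWith_of_hasCompactSupport hc one_ne_zero
  refine ⟨max A B, le_max_of_le_right B.2, fun z => (hA z).trans (le_max_left _ _), fun z z' => ?_⟩
  refine (hB.norm_sub_le z z').trans ?_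
  gcongr
  exact le_max_right _ _

/-- Bumps of integral one at all scales. -/
lemma exists_bump (n : ℕ) : ∃ (A : ℝ) (φ : ℤ → Rn n → ℂ),
    (∀ m, LipKer 1 m A A (φ m)) ∧ ∀ m, ∫ z, φ m z = 1 := by
  let χ : ContDiffBump (0 : Rn n) := ⟨1 / 2, 1, by norm_num, by norm_num⟩
  set κ : Rn n → ℂ := fun z => (χ.normed volume z : ℂ) with hκ
  have h1 : ContDiff ℝ 1 κ := Complex.ofRealCLM.contDiff.comp χ.contDiff_normed
  have h2 : HasCompactSupport κ := χ.hasCompactSupport_normed.comp_left Complex.ofReal_zero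
  obtain ⟨A, -, hA, hA'⟩ := exists_lipschitz_bound h1 h2
  refine ⟨A, fun m => dil m κ, fun m => lipKer_dil m hA hA' fun z hz => ?_, fun m => ?_⟩
  · have hz' : z ∈ Function.support (χ.normed volume) := by
      intro h; exact hz (by simp [hκ, h])
    rw [χ.support_normed_eq, mem_ball_zero_iff] at hz'
    simpa using hz'.le
  · rw [integral_dil, hκ, integral_complex_ofReal, χ.integral_normed, Complex.ofReal_one]

/-- A homogeneous Calderón–Zygmund kernel `K` together with its angular part `Ω`. -/
structure HomKer (K Ω : Rn n → ℝ) : Prop where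
  smooth : ContDiffOn ℝ (⊤ : ℕ∞) Ω {x : Rn n | x ≠ 0}
  hom : ∀ c : ℝ, 0 < c → ∀ t : Rn n, Ω (c • t) = Ω t
  mean : ∫ θ : Metric.sphere (0 : Rn n) 1, Ω θ ∂((volume : Measure (Rn n)).toSphere) = 0
  eq : ∀ t : Rn n, t ≠ 0 → K t = Ω t / ‖t‖ ^ n

namespace HomKer

variable {K Ω : Rn n → ℝ}

lemma contDiffAt (h : HomKer K Ω) {t : Rn n} (ht : t ≠ 0) : ContDiffAt ℝ (⊤ : ℕ∞) K t := by
  have ho : {x : Rn n | x ≠ 0} ∈ 𝓝 t := isOpen_ne.mem_nhds ht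
  have h1 : ContDiffAt ℝ (⊤ : ℕ∞) (fun t => Ω t / ‖t‖ ^ n) t :=
    (h.smooth.contDiffAt ho).div ((contDiffAt_norm ℝ ht).pow n)
      (pow_ne_zero _ (norm_ne_zero_iff.2 ht))
  refine h1.congr_of_eventuallyEq ?_
  filter_upwards [ho] with s hs using h.eq s hs

lemma exists_bound (h : HomKer K Ω) : ∃ M : ℝ, 0 ≤ M ∧ ∀ t : Rn n, t ≠ 0 → |K t| ≤ M / ‖t‖ ^ n := by
  have hc : ContinuousOn Ω (Metric.sphere 0 1) :=
    h.smooth.continuousOn.mono fun t ht => by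
      rintro rfl
      simp at ht
  obtain ⟨M, hM⟩ := (isCompact_sphere (0 : Rn n) 1).exists_bound_of_continuousOn hc
  refine ⟨max M 0, le_max_right _ _, fun t ht => ?_⟩
  have ht' : 0 < ‖t‖ := norm_pos_iff.2 ht
  rw [h.eq t ht, abs_div, abs_of_pos (pow_pos ht' n)]
  gcongr
  rw [← h.hom ‖t‖⁻¹ (by positivity) t]
  refine le_max_of_le_left (hM _ ?_)
  rw [mem_sphere_zero_iff_norm, norm_smul, norm_inv, norm_norm, inv_mul_cancel₀ ht'.ne']

lemma smul_eq (h : HomKer K Ω) {c : ℝ} (hc : 0 < c) {t : Rn n} (ht : t ≠ 0) :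
    K (c • t) = (c ^ n)⁻¹ * K t := by
  rw [h.eq _ (smul_ne_zero hc.ne' ht), h.eq t ht, h.hom c hc, norm_smul,
    Real.norm_of_nonneg hc.le, mul_pow]
  field_simp

/-- Radial multiples of a homogeneous kernel have vanishing integral. -/
lemma integral_radial [NeZero n] (h : HomKer K Ω) (g : ℝ → ℂ) : ∫ t, g ‖t‖ * (K t : ℂ) = 0 := by
  have hne : Nontrivial (Rn n) := inferInstance
  set G : ℝ → ℂ := fun r => g r / (r ^ n : ℝ) with hG
  calc ∫ t, g ‖t‖ * (K t : ℂ)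
      = ∫ t : Rn n, (Ω t : ℂ) * G ‖t‖ := by
        refine integral_congr_ae ?_
        filter_upwards [compl_mem_ae_iff.2 (measure_singleton (0 : Rn n))] with t ht
        rw [h.eq t ht, hG]
        push_cast
        ring
    _ = ∫ t : ({(0)}ᶜ : Set (Rn n)), (Ω t.1 : ℂ) * G ‖t.1‖ 
          ∂((volume : Measure (Rn n)).comap Subtype.val) := by
        rw [integral_subtype_comap (measurableSet_singleton _).compl
          fun t : Rn n => (Ω t : ℂ) * G ‖t‖, restrict_compl_singleton]
    _ = ∫ q : Metric.sphere (0 : Rn n) 1 × Ioi (0 : ℝ), (Ω q.1 : ℂ) * G q.2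
          ∂(volume : Measure (Rn n)).toSphere.prod (.volumeIoiPow (Module.finrank ℝ (Rn n) - 1)) := by
        rw [← (volume : Measure (Rn n)).measurePreserving_homeomorphUnitSphereProd.integral_comp
          (Homeomorph.measurableEmbedding _)]
        refine integral_congr_ae (.of_forall fun t => ?_)
        have ht : 0 < ‖t.1‖ := norm_pos_iff.2 t.2
        simp only [homeomorphUnitSphereProd_apply_fst_coe, homeomorphUnitSphereProd_apply_snd_coe]
        rw [h.hom _ (by positivity)]
    _ = 0 := by
        rw [integral_prod_mul (fun θ : Metric.sphere (0 : Rn n) 1 => (Ω θ : ℂ))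
          fun r : Ioi (0 : ℝ) => G r, integral_complex_ofReal, h.mean]
        simp

end HomKer

end Kernels

/-! ### The concrete kernels -/

lemma norm_exp_sub_exp_le (a b : ℝ) :
    ‖Complex.exp (Complex.I * a) - Complex.exp (Complex.I * b)‖ ≤ |a - b| := by
  have h : Complex.exp (Complex.I * a) - Complex.exp (Complex.I * b) =
      Complex.exp (Complex.I * b) * (Complex.exp (Complex.I * (a - b : ℝ)) - 1) := by
    rw [mul_sub, ← Complex.exp_add, mul_one]
    push_cast
    ring_nf
  rw [h, norm_mul, mul_comm Complex.I, Complex.norm_exp_ofReal_mul_I, one_mul]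
  exact Real.norm_exp_I_mul_ofReal_sub_one_le

section Concrete

variable {n : ℕ} {Γ ψ : ℝ → ℝ} {K Ω : Rn n → ℝ}

/-- The piece of `K` at scale `2 ^ l`. -/
def pieceKer (K : Rn n → ℝ) (ψ : ℝ → ℝ) (l : ℤ) (t : Rn n) : ℂ :=
  ((ψ ((2 : ℝ) ^ (-l) * ‖t‖) * K t : ℝ) : ℂ)

/-- The contribution of the phase to the piece of `K` at scale `2 ^ l`. -/
def phaseKer (Γ : ℝ → ℝ) (K : Rn n → ℝ) (ψ : ℝ → ℝ) (k l : ℤ) (t : Rn n) : ℂ :=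
  (Complex.exp (Complex.I * ((2 : ℝ) ^ k * Γ ‖t‖ : ℝ)) - 1) * pieceKer K ψ l t

lemma cutoff_zero (hψ : IsLPCutoff ψ) : ψ 0 = 0 := by
  by_contra h
  have := (hψ.2.2.1 0 h).1
  norm_num at this

lemma pieceKer_eq_dil (hK : HomKer K Ω) (hψ : IsLPCutoff ψ) (l : ℤ) :
    pieceKer K ψ l = dil l fun z => ((ψ ‖z‖ * K z : ℝ) : ℂ) := by
  funext t
  rw [pieceKer, dil, norm_two_zpow_smul, zpow_neg, inv_mul_eq_div]
  rcases eq_or_ne t 0 with rfl | ht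
  · simp [cutoff_zero hψ]
  · rw [← Complex.ofReal_mul, hK.smul_eq (by positivity) ht, cubeVol, inv_pow, inv_inv]
    congr 1
    have : (0 : ℝ) < 2 ^ l := by positivity
    field_simp

lemma pieceKer_supp (hψ : IsLPCutoff ψ) {l : ℤ} {t : Rn n} (h : pieceKer K ψ l t ≠ 0) :
    2 ^ l / 2 ≤ ‖t‖ ∧ ‖t‖ ≤ 2 * 2 ^ l := by
  have h1 : ψ ((2 : ℝ) ^ (-l) * ‖t‖) ≠ 0 := by
    intro h0
    exact h (by rw [pieceKer, h0]; simp)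
  have h2 := hψ.2.2.1 _ h1
  rw [abs_of_nonneg (by positivity), zpow_neg, inv_mul_eq_div] at h2
  have h3 : (0 : ℝ) < 2 ^ l := by positivity
  obtain ⟨h4, h5⟩ := h2
  rw [le_div_iff₀ h3] at h4
  rw [div_le_iff₀ h3] at h5
  exact ⟨by linarith, h5⟩

lemma exists_lipKer_pieceKer (hK : HomKer K Ω) (hψ : IsLPCutoff ψ) :
    ∃ A : ℝ, 0 ≤ A ∧ ∀ l, LipKer 2 l A A (pieceKer K ψ l) := by
  set κ : Rn n → ℂ := fun z => ((ψ ‖z‖ * K z : ℝ) : ℂ) with hκ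
  have hs : ∀ z, κ z ≠ 0 → 1 / 2 ≤ ‖z‖ ∧ ‖z‖ ≤ 2 := fun z hz => by
    have : ψ ‖z‖ ≠ 0 := fun h => hz (by simp [hκ, h])
    simpa using hψ.2.2.1 _ this
  have h1 : ContDiff ℝ 1 κ := by
    rw [contDiff_iff_contDiffAt]
    intro z
    rcases eq_or_ne z 0 with rfl | hz
    · refine (contDiffAt_const (c := (0 : ℂ))).congr_of_eventuallyEq ?_
      filter_upwards [Metric.ball_mem_nhds (0 : Rn n) (by norm_num : (0 : ℝ) < 1 / 2)] with z hz
      by_contra h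
      rw [mem_ball_zero_iff] at hz
      linarith [(hs z h).1]
    · refine Complex.ofRealCLM.contDiff.contDiffAt.comp z ?_
      refine ContDiffAt.mul ?_ ((hK.contDiffAt hz).of_le (by exact_mod_cast le_top))
      exact (hψ.1.of_le (by exact_mod_cast le_top)).contDiffAt.comp z (contDiffAt_norm ℝ hz)
  have h2 : HasCompactSupport κ := by
    refine HasCompactSupport.intro (isCompact_closedBall 0 2) fun z hz => ?_
    by_contra h
    exact hz (by simpa using (hs z h).2)
  obtain ⟨A, hA0, hA, hA'⟩ := exists_lipschitz_bound h1 h2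
  refine ⟨A, hA0, fun l => ?_⟩
  rw [pieceKer_eq_dil hK hψ]
  exact lipKer_dil l hA hA' fun z hz => by simpa using (hs z hz).2

lemma LipKer.mono {w : ℕ} {l : ℤ} {A A' : ℝ} {κ : Rn n → ℂ} (h : LipKer w l A A κ)
    (hA : A ≤ A') : LipKer w l A' A' κ where
  bound z := (h.bound z).trans <|
    mul_le_mul_of_nonneg_right hA (inv_nonneg.2 (cubeVol_pos l).le)
  lip z z' := (h.lip z z').trans <| by
    have := (cubeVol_pos (n := n) l).le
    gcongr
  supp := h.supp

lemma LipKer.mul {w : ℕ} {l : ℤ} {A a b : ℝ} (hA : 0 ≤ A) (ha : 0 ≤ a) (hb : 0 ≤ b)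
    {κ F : Rn n → ℂ} (h : LipKer w l A A κ) (hF : ∀ t, κ t ≠ 0 → ‖F t‖ ≤ a)
    (hF' : ∀ t t', κ t ≠ 0 → κ t' ≠ 0 → ‖F t - F t'‖ ≤ b * (‖t - t'‖ / 2 ^ l)) :
    LipKer w l ((a + b) * A) ((a + b) * A) fun t => F t * κ t := by
  have hV := cubeVol_pos (n := n) l
  refine ⟨fun t => ?_, fun t t' => ?_, fun t ht => h.supp t (right_ne_zero_of_mul ht)⟩
  · rcases eq_or_ne (κ t) 0 with h0 | h0
    · rw [h0, mul_zero, norm_zero]; positivity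
    · rw [norm_mul]
      calc ‖F t‖ * ‖κ t‖ ≤ (a + b) * (A * (cubeVol n l)⁻¹) :=
            mul_le_mul ((hF t h0).trans (by linarith)) (h.bound t) (norm_nonneg _) (by positivity)
        _ = _ := by ring
  · have key : ∀ t t', κ t ≠ 0 → ‖F t * (κ t - κ t')‖ ≤
        a * A * (‖t - t'‖ / 2 ^ l) * (cubeVol n l)⁻¹ := fun t t' h0 => by
      rw [norm_mul]
      calc ‖F t‖ * ‖κ t - κ t'‖ ≤ a * (A * (‖t - t'‖ / 2 ^ l) * (cubeVol n l)⁻¹) :=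
            mul_le_mul (hF t h0) (h.lip t t') (norm_nonneg _) ha
        _ = _ := by ring
    have hle : a * A * (‖t - t'‖ / 2 ^ l) * (cubeVol n l)⁻¹ ≤
        (a + b) * A * (‖t - t'‖ / 2 ^ l) * (cubeVol n l)⁻¹ := by
      gcongr; linarith
    rcases eq_or_ne (κ t) 0 with h0 | h0 <;> rcases eq_or_ne (κ t') 0 with h1 | h1
    · rw [h0, h1, mul_zero, mul_zero, sub_zero, norm_zero]; positivity
    · have := key t' t h1
      rw [h0, norm_sub_rev t' t] at this
      rw [h0, norm_sub_rev]
      simpa using this.trans hle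
    · have := key t t' h0
      rw [h1] at this
      rw [h1]
      simpa using this.trans hle
    · have e : F t * κ t - F t' * κ t' = F t * (κ t - κ t') + (F t - F t') * κ t' := by ring
      rw [e]
      refine (norm_add_le _ _).trans ?_
      have h2 : ‖(F t - F t') * κ t'‖ ≤ b * A * (‖t - t'‖ / 2 ^ l) * (cubeVol n l)⁻¹ := by
        rw [norm_mul]
        calc ‖F t - F t'‖ * ‖κ t'‖ ≤ b * (‖t - t'‖ / 2 ^ l) * (A * (cubeVol n l)⁻¹) :=
              mul_le_mul (hF' t t' h0 h1) (h.bound t') (norm_nonneg _) (by positivity)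
          _ = _ := by ring
      have key0 := key t t' h0
      linarith

/-- The phase kernels are as smooth as the pieces of `K`, with a gain of the size of the phase. -/
lemma lipKer_phaseKer (hΓ : IsGammaU Γ) (hψ : IsLPCutoff ψ) {A D : ℝ} (hA : 0 ≤ A) (hD : 1 ≤ D)
    (hd : ∀ s > 0, Γ (2 * s) ≤ D * Γ s) (hd' : ∀ s > 0, s * deriv Γ s ≤ D * Γ s) {l : ℤ}
    (h : LipKer 2 l A A (pieceKer K ψ l)) (k : ℤ) :
    LipKer 2 l ((D + 2 * D ^ 2) * A * (2 ^ k * Γ (2 ^ l))) ((D + 2 * D ^ 2) * A * (2 ^ k * Γ (2 ^ l)))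
      (phaseKer Γ K ψ k l) := by
  have hl : (0 : ℝ) < 2 ^ l := by positivity
  have hk : (0 : ℝ) < 2 ^ k := by positivity
  have hG : 0 < Γ (2 ^ l) := hΓ.pos hl
  have hup : ∀ s, 0 ≤ s → s ≤ 2 * 2 ^ l → Γ s ≤ D * Γ (2 ^ l) := fun s h0 hs =>
    (hΓ.le_of_le h0 hs).trans (hd _ hl)
  have e : (D + 2 * D ^ 2) * A * (2 ^ k * Γ (2 ^ l)) =
      (D * (2 ^ k * Γ (2 ^ l)) + 2 * D ^ 2 * (2 ^ k * Γ (2 ^ l))) * A := by ring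
  rw [e]
  refine LipKer.mul hA (by positivity) (by positivity) h (fun t ht => ?_) fun t t' ht ht' => ?_
  · obtain ⟨-, h2⟩ := pieceKer_supp hψ ht
    refine Real.norm_exp_I_mul_ofReal_sub_one_le.trans ?_
    rw [Real.norm_of_nonneg (mul_nonneg hk.le ?_), mul_left_comm]
    · gcongr
      exact hup _ (norm_nonneg _) h2
    · rw [← hΓ.map_zero]
      exact hΓ.le_of_le le_rfl (norm_nonneg _)
  · rw [sub_sub_sub_cancel_right]
    refine (norm_exp_sub_exp_le _ _).trans ?_
    rw [← mul_sub, abs_mul, abs_of_pos hk]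
    have hder : ∀ s ∈ Icc ((2 : ℝ) ^ l / 2) (2 * 2 ^ l), ‖deriv Γ s‖ ≤
        2 * D ^ 2 * Γ (2 ^ l) / 2 ^ l := fun s hs => by
      have hs0 : 0 < s := lt_of_lt_of_le (by positivity) hs.1
      rw [Real.norm_of_nonneg (hΓ.deriv_pos s hs0).le, le_div_iff₀ hl]
      have h1 : deriv Γ s * 2 ^ l ≤ 2 * (s * deriv Γ s) := by
        nlinarith [hs.1, hΓ.deriv_pos s hs0]
      have h2 := hd' s hs0
      have h3 := hup s hs0.le hs.2
      nlinarith
    have hmv := (convex_Icc ((2 : ℝ) ^ l / 2) (2 * 2 ^ l)).norm_image_sub_le_of_norm_deriv_le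
      (f := Γ) (fun s hs => hΓ.differentiableAt (lt_of_lt_of_le (by positivity) hs.1)) hder
      (pieceKer_supp hψ ht') (pieceKer_supp hψ ht)
    calc 2 ^ k * |Γ ‖t‖ - Γ ‖t'‖| ≤ 2 ^ k * (2 * D ^ 2 * Γ (2 ^ l) / 2 ^ l * ‖t - t'‖) := by
          gcongr
          refine hmv.trans ?_
          gcongr
          exact abs_norm_sub_norm_le t t'
      _ = _ := by ring

lemma exists_admissible [NeZero n] (hΓ : IsGammaU Γ) (hK : HomKer K Ω) (hψ : IsLPCutoff ψ) :
    ∃ A φ η, Admissible A (pieceKer K ψ) (phaseKer Γ K ψ) φ (kstar Γ) η := by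
  obtain ⟨D, hD, hd, hd'⟩ := hΓ.exists_doubling
  obtain ⟨A, hA0, hA⟩ := exists_lipKer_pieceKer hK hψ
  obtain ⟨B, φ, hφ, hφ1⟩ := exists_bump n
  set c : ℝ := (D + 2 * D ^ 2) * A with hc
  have hc0 : 0 ≤ c := by positivity
  set M : ℝ := A + |B| + c * 2 + D * 2 with hM
  have hB := le_abs_self B
  have hB' := abs_nonneg B
  refine ⟨M, φ, fun k l => c * (2 ^ k * Γ (2 ^ l)), ⟨fun l => ?_, fun l => ?_, fun m => ?_, hφ1,
    fun k l _ => lipKer_phaseKer hΓ hψ hA0 hD hd hd' (hA l) k, fun k l _ => ?_, fun K₀ l => ?_,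
    fun K₀ m => ?_, hΓ.kstar_antitone⟩⟩
  · exact (hA l).mono (by linarith)
  · have := hK.integral_radial fun r => (ψ ((2 : ℝ) ^ (-l) * r) : ℂ)
    simpa [pieceKer] using this
  · exact (hφ m).mono (by linarith)
  · have := hK.integral_radial fun r => (Complex.exp (Complex.I * ((2 : ℝ) ^ k * Γ r : ℝ)) - 1) *
      (ψ ((2 : ℝ) ^ (-l) * r) : ℂ)
    rw [← this]
    refine integral_congr_ae (.of_forall fun t => ?_)
    simp only [phaseKer, pieceKer]
    push_cast
    ring
  · have h1 := hΓ.sum_phase_le K₀ l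
    have h2 : ∑ k ∈ K₀, (if l ≤ kstar Γ k then c * (2 ^ k * Γ (2 ^ l)) else 0) =
        c * ∑ k ∈ K₀, (if l ≤ kstar Γ k then 2 ^ k * Γ (2 ^ l) else 0) := by
      rw [Finset.mul_sum]
      exact Finset.sum_congr rfl fun k _ => by split_ifs <;> simp
    rw [h2]
    nlinarith
  · have := hΓ.sum_kstar_eq_le hD hd K₀ m
    nlinarith

end Concrete

/-! ### Principal values -/

section PrincipalValue

variable {n : ℕ}

/-- Bounded Lipschitz functions. -/
structure BddLip (B : ℝ) (f : Rn n → ℂ) : Prop where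
  nonneg : 0 ≤ B
  continuous : Continuous f
  bound : ∀ x, ‖f x‖ ≤ B
  lip : ∀ x y, ‖f x - f y‖ ≤ B * ‖x - y‖

lemma exists_bddLip (f : SchwartzMap (Rn n) ℂ) : ∃ B, BddLip B (⇑f) := by
  obtain ⟨C, hC⟩ := f.decay 0 0
  obtain ⟨C', hC'⟩ := f.decay 0 1
  simp only [pow_zero, one_mul, norm_iteratedFDeriv_zero, norm_iteratedFDeriv_one] at hC hC'
  have h0 : 0 ≤ C := (norm_nonneg _).trans (hC.2 0)
  refine ⟨max C C', le_max_of_le_left h0, f.continuous, fun x => le_max_of_le_left (hC.2 x),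
    fun x y => ?_⟩
  refine (convex_univ.norm_image_sub_le_of_norm_fderiv_le (𝕜 := ℝ) (C := C')
    (fun z _ => f.differentiableAt) (fun z _ => hC'.2 z) (mem_univ y) (mem_univ x)).trans ?_
  gcongr
  exact le_max_right _ _

/-- The truncation `g` of the principal value operator, with the cancellation of `K` built in. -/
def pvOp (K : Rn n → ℝ) (g : ℝ → ℂ) (f : Rn n → ℂ) (x : Rn n) : ℂ :=
  ∫ t, (f (x - t) - f x) * (g ‖t‖ * (K t : ℂ))

namespace HomKer

variable {K Ω : Rn n → ℝ}

lemma aestronglyMeasurable [NeZero n] (hK : HomKer K Ω) :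
    AEStronglyMeasurable (fun t => (K t : ℂ)) (volume : Measure (Rn n)) := by
  have h : ContinuousOn (fun t => (K t : ℂ)) ({0}ᶜ : Set (Rn n)) := fun t ht =>
    (Complex.continuous_ofReal.continuousAt.comp
      (hK.contDiffAt (by simpa using ht)).continuousAt).continuousWithinAt
  have hne : Nontrivial (Rn n) := inferInstance
  have := h.aestronglyMeasurable (μ := volume) (measurableSet_singleton _).compl
  rwa [restrict_compl_singleton] at this

lemma integrable_radial [NeZero n] (hK : HomKer K Ω) {g : ℝ → ℂ} (hg : Measurable fun t : Rn n => g ‖t‖)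
    (h1 : ∀ r, ‖g r‖ ≤ 1) {ε R : ℝ} (hε : 0 < ε) (h2 : ∀ r, 0 ≤ r → g r ≠ 0 → ε ≤ r ∧ r ≤ R) :
    Integrable (fun t : Rn n => g ‖t‖ * (K t : ℂ)) := by
  obtain ⟨M, hM0, hM⟩ := hK.exists_bound
  have hmeas : AEStronglyMeasurable (fun t : Rn n => g ‖t‖ * (K t : ℂ)) volume :=
    hg.aestronglyMeasurable.mul hK.aestronglyMeasurable
  have hfin : Integrable (indicator (Metric.closedBall (0 : Rn n) R) fun _ => M / ε ^ n) :=
    (integrable_indicator_iff Metric.isClosed_closedBall.measurableSet).2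
      (integrableOn_const (isCompact_closedBall _ _).measure_lt_top.ne)
  refine hfin.mono' hmeas (.of_forall fun t => ?_)
  rcases eq_or_ne (g ‖t‖) 0 with h0 | h0
  · rw [h0, zero_mul, norm_zero]
    exact indicator_nonneg (fun _ _ => by positivity) _
  · obtain ⟨h3, h4⟩ := h2 _ (norm_nonneg _) h0
    have ht : t ≠ 0 := norm_pos_iff.1 (hε.trans_le h3)
    rw [indicator_of_mem (by simpa using h4), norm_mul, Complex.norm_real, Real.norm_eq_abs]
    calc ‖g ‖t‖‖ * |K t| ≤ 1 * (M / ε ^ n) :=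
          mul_le_mul (h1 _) ((hM t ht).trans (by gcongr)) (abs_nonneg _) zero_le_one
      _ = _ := one_mul _

lemma integrable_mul_radial [NeZero n] (hK : HomKer K Ω) {g : ℝ → ℂ} (hg : Measurable fun t : Rn n => g ‖t‖)
    (h1 : ∀ r, ‖g r‖ ≤ 1) {ε R : ℝ} (hε : 0 < ε) (h2 : ∀ r, 0 ≤ r → g r ≠ 0 → ε ≤ r ∧ r ≤ R)
    {B : ℝ} {f : Rn n → ℂ} (hf : BddLip B f) (x : Rn n) :
    Integrable (fun t : Rn n => f (x - t) * (g ‖t‖ * (K t : ℂ))) :=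
  (hK.integrable_radial hg h1 hε h2).bdd_mul (c := B)
    (hf.continuous.comp (continuous_const.sub continuous_id)).aestronglyMeasurable
    (.of_forall fun _ => hf.bound _)

lemma integral_eq_pvOp [NeZero n] (hK : HomKer K Ω) {g : ℝ → ℂ} (hg : Measurable fun t : Rn n => g ‖t‖)
    (h1 : ∀ r, ‖g r‖ ≤ 1) {ε R : ℝ} (hε : 0 < ε) (h2 : ∀ r, 0 ≤ r → g r ≠ 0 → ε ≤ r ∧ r ≤ R)
    {B : ℝ} {f : Rn n → ℂ} (hf : BddLip B f) (x : Rn n) :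
    ∫ t : Rn n, f (x - t) * (g ‖t‖ * (K t : ℂ)) = pvOp K g f x := by
  simp only [pvOp, sub_mul]
  rw [integral_sub (hK.integrable_mul_radial hg h1 hε h2 hf x)
    ((hK.integrable_radial hg h1 hε h2).const_mul _), integral_const_mul, hK.integral_radial,
    mul_zero, sub_zero]

lemma tendsto_pvOp [NeZero n] (hK : HomKer K Ω) {ι : Type*} {L : Filter ι}
    [L.IsCountablyGenerated] {g : ι → ℝ → ℂ} {g₀ : ℝ → ℂ} 
    (hg : ∀ i, Measurable fun t : Rn n => g i ‖t‖)
    (h1 : ∀ i r, ‖g i r‖ ≤ 1) {R : ℝ} (h2 : ∀ i r, 0 ≤ r → g i r ≠ 0 → r ≤ R)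
    (hlim : ∀ r, 0 < r → Tendsto (fun i => g i r) L (𝓝 (g₀ r)))
    {B : ℝ} {f : Rn n → ℂ} (hf : BddLip B f) (x : Rn n) :
    Tendsto (fun i => pvOp K (g i) f x) L (𝓝 (pvOp K g₀ f x)) := by
  obtain ⟨M, hM0, hM⟩ := hK.exists_bound
  have hn : 1 ≤ n := Nat.one_le_iff_ne_zero.2 (NeZero.ne n)
  have hne : Nontrivial (Rn n) := inferInstance
  have h0 : ∀ᵐ t : Rn n, t ≠ 0 := compl_mem_ae_iff.2 (measure_singleton _)
  have hB := hf.nonneg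
  have hloc : LocallyIntegrable (fun t : Rn n => ‖t‖ * (M / ‖t‖ ^ n)) volume := by
    refine locallyIntegrable_of_norm_le_rpow (C := M) (α := n - 1) (by simpa using hn) (by simp) ?_
      (measurable_norm.mul (measurable_const.div (measurable_norm.pow_const n))).aestronglyMeasurable
    filter_upwards [h0] with t ht
    have ht' : 0 < ‖t‖ := norm_pos_iff.2 ht
    rw [Real.norm_of_nonneg (by positivity), neg_sub, Real.rpow_sub ht', Real.rpow_one,
      Real.rpow_natCast]
    exact le_of_eq (by ring)
  refine tendsto_integral_filter_of_dominated_convergence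
    (indicator (Metric.closedBall (0 : Rn n) R) fun t => B * (‖t‖ * (M / ‖t‖ ^ n)))
    (.of_forall fun i => ?_) (.of_forall fun i => ?_) ?_ ?_
  · exact ((hf.continuous.comp (continuous_const.sub continuous_id)).aestronglyMeasurable.sub
      aestronglyMeasurable_const).mul
      ((hg i).aestronglyMeasurable.mul hK.aestronglyMeasurable)
  · filter_upwards [h0] with t ht
    rcases eq_or_ne (g i ‖t‖) 0 with h3 | h3
    · rw [h3, zero_mul, mul_zero, norm_zero]
      exact indicator_nonneg (fun _ _ => by positivity) _
    · rw [indicator_of_mem (by simpa using h2 i _ (norm_nonneg _) h3), norm_mul, norm_mul, Complex.norm_real,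
        Real.norm_eq_abs]
      have h4 : ‖f (x - t) - f x‖ ≤ B * ‖t‖ := by simpa using hf.lip (x - t) x
      calc ‖f (x - t) - f x‖ * (‖g i ‖t‖‖ * |K t|) ≤ B * ‖t‖ * (1 * (M / ‖t‖ ^ n)) := by
            gcongr
            · exact h1 _ _
            · exact hM t ht
        _ = _ := by ring
  · exact (integrable_indicator_iff Metric.isClosed_closedBall.measurableSet).2
      ((hloc.integrableOn_isCompact (isCompact_closedBall _ _)).const_mul B)
  · filter_upwards [h0] with t ht
    exact ((hlim _ (norm_pos_iff.2 ht)).mul_const _).const_mul _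

end HomKer

end PrincipalValue

/-! ### The jump inequality -/

section Final

variable {n : ℕ} {Γ ψ : ℝ → ℝ} {K Ω : Rn n → ℝ}

/-- The part of the cutoff at scales in `Λ` below `kstar`. -/
def cutSum (Γ ψ : ℝ → ℝ) (k : ℤ) (Λ : Finset ℤ) (r : ℝ) : ℝ :=
  ∑ l ∈ Λ, if l ≤ kstar Γ k then ψ ((2 : ℝ) ^ (-l) * r) else 0

/-- The cutoff below `kstar`. -/
def cutTsum (Γ ψ : ℝ → ℝ) (k : ℤ) (r : ℝ) : ℝ :=
  ∑' l : ℤ, if l ≤ kstar Γ k then ψ ((2 : ℝ) ^ (-l) * r) else 0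

/-- The unimodular phase. -/
def phase (Γ : ℝ → ℝ) (k : ℤ) (r : ℝ) : ℂ :=
  Complex.exp (Complex.I * Complex.ofReal ((2 : ℝ) ^ k * Γ r))

lemma norm_phase (k : ℤ) (r : ℝ) : ‖phase Γ k r‖ = 1 := by
  rw [phase, mul_comm, Complex.norm_exp_ofReal_mul_I]

lemma cutoff_term_nonneg (hψ : IsLPCutoff ψ) (k l : ℤ) (r : ℝ) :
    0 ≤ if l ≤ kstar Γ k then ψ ((2 : ℝ) ^ (-l) * r) else 0 := by
  split_ifs
  · exact (hψ.2.1 _).1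
  · exact le_rfl

lemma cutoff_term_supp (hψ : IsLPCutoff ψ) {k l : ℤ} {r : ℝ} (hr : 0 ≤ r)
    (h : (if l ≤ kstar Γ k then ψ ((2 : ℝ) ^ (-l) * r) else 0) ≠ 0) :
    2 ^ l / 2 ≤ r ∧ r ≤ 2 * 2 ^ kstar Γ k := by
  split_ifs at h with hl
  · have h2 := hψ.2.2.1 _ h
    rw [abs_of_nonneg (by positivity), zpow_neg, inv_mul_eq_div] at h2
    have h3 : (0 : ℝ) < 2 ^ l := by positivity
    obtain ⟨h4, h5⟩ := h2
    rw [le_div_iff₀ h3] at h4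
    rw [div_le_iff₀ h3] at h5
    refine ⟨by linarith, h5.trans ?_⟩
    gcongr
    norm_num
  · exact absurd rfl h

lemma hasSum_cutTsum (hψ : IsLPCutoff ψ) (k : ℤ) (r : ℝ) :
    HasSum (fun l : ℤ => if l ≤ kstar Γ k then ψ ((2 : ℝ) ^ (-l) * r) else 0)
      (cutTsum Γ ψ k r) := by
  refine Summable.hasSum ?_
  rcases eq_or_ne r 0 with rfl | hr
  · simp [cutoff_zero hψ]
  · refine Summable.of_nonneg_of_le (cutoff_term_nonneg hψ k · r) (fun l => ?_)
      (hψ.2.2.2 r hr).summable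
    split_ifs
    · exact le_rfl
    · exact (hψ.2.1 _).1

lemma cutTsum_mem (hψ : IsLPCutoff ψ) (k : ℤ) (r : ℝ) : cutTsum Γ ψ k r ∈ Icc (0 : ℝ) 1 := by
  refine ⟨tsum_nonneg (cutoff_term_nonneg hψ k · r), ?_⟩
  rcases eq_or_ne r 0 with rfl | hr
  · simp [cutTsum, cutoff_zero hψ]
  · refine hasSum_le (fun l => ?_) (hasSum_cutTsum hψ k r) (hψ.2.2.2 r hr)
    split_ifs
    · exact le_rfl
    · exact (hψ.2.1 _).1

lemma cutSum_mem (hψ : IsLPCutoff ψ) (k : ℤ) (Λ : Finset ℤ) (r : ℝ) :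
    cutSum Γ ψ k Λ r ∈ Icc (0 : ℝ) 1 :=
  ⟨Finset.sum_nonneg fun l _ => cutoff_term_nonneg hψ k l r,
    ((sum_le_hasSum Λ (fun l _ => cutoff_term_nonneg hψ k l r) (hasSum_cutTsum hψ k r))).trans
      (cutTsum_mem hψ k r).2⟩

lemma tendsto_cutSum (hψ : IsLPCutoff ψ) (k : ℤ) (r : ℝ) :
    Tendsto (fun L : ℕ => cutSum Γ ψ k (Finset.Icc (-L : ℤ) L) r) atTop
      (𝓝 (cutTsum Γ ψ k r)) :=
  (hasSum_cutTsum hψ k r).comp Finset.tendsto_Icc_neg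

lemma measurable_cutSum (hψ : IsLPCutoff ψ) (k : ℤ) (Λ : Finset ℤ) :
    Measurable (cutSum Γ ψ k Λ) := by
  refine Finset.measurable_fun_sum _ fun l _ => ?_
  split_ifs
  · exact hψ.1.continuous.measurable.comp (measurable_const_mul _)
  · exact measurable_const

lemma measurable_cutTsum (hψ : IsLPCutoff ψ) (k : ℤ) : Measurable (cutTsum Γ ψ k) :=
  measurable_of_tendsto_metrizable (fun L : ℕ => measurable_cutSum hψ k (Finset.Icc (-L : ℤ) L))
    (tendsto_pi_nhds.2 fun r => tendsto_cutSum hψ k r)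

lemma cutSum_supp (hψ : IsLPCutoff ψ) {k : ℤ} {L : ℕ} {r : ℝ} (hr : 0 ≤ r)
    (h : cutSum Γ ψ k (Finset.Icc (-L : ℤ) L) r ≠ 0) :
    2 ^ (-L : ℤ) / 2 ≤ r ∧ r ≤ 2 * 2 ^ kstar Γ k := by
  obtain ⟨l, hl, h⟩ := Finset.exists_ne_zero_of_sum_ne_zero h
  obtain ⟨h1, h2⟩ := cutoff_term_supp hψ hr h
  refine ⟨le_trans ?_ h1, h2⟩
  have := (Finset.mem_Icc.1 hl).1
  gcongr
  norm_num

lemma cutTsum_supp (hψ : IsLPCutoff ψ) {k : ℤ} {r : ℝ} (hr : 0 ≤ r) (h : cutTsum Γ ψ k r ≠ 0) :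
    r ≤ 2 * 2 ^ kstar Γ k := by
  by_contra h'
  refine h ((tsum_congr fun l => ?_).trans tsum_zero)
  by_contra h0
  exact h' (cutoff_term_supp hψ hr h0).2

lemma measurable_phase (hΓ : IsGammaU Γ) (k : ℤ) : Measurable fun t : Rn n => phase Γ k ‖t‖ := by
  have := hΓ.continuous_norm (E := Rn n)
  exact (Complex.continuous_exp.comp (continuous_const.mul
    (Complex.continuous_ofReal.comp (continuous_const.mul this)))).measurable

lemma norm_phase_mul_le {c : ℝ} (hc : c ∈ Icc (0 : ℝ) 1) (k : ℤ) (r : ℝ) :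
    ‖phase Γ k r * (c : ℂ)‖ ≤ 1 := by
  rw [norm_mul, norm_phase, one_mul, Complex.norm_real, Real.norm_of_nonneg hc.1]
  exact hc.2

lemma Hkno_eq [NeZero n] (hΓ : IsGammaU Γ) (hK : HomKer K Ω) (hψ : IsLPCutoff ψ) (k : ℤ)
    {B : ℝ} {f : Rn n → ℂ} (hf : BddLip B f) (x : Rn n) :
    Hkno Γ K ψ k f x = pvOp K (fun r => phase Γ k r * (cutTsum Γ ψ k r : ℂ)) f x := by
  refine Tendsto.limUnder_eq ?_
  set g : ℝ → ℂ := fun r => phase Γ k r * (cutTsum Γ ψ k r : ℂ) with hg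
  have hgm : Measurable fun t : Rn n => g ‖t‖ := (measurable_phase hΓ k).mul
    (Complex.measurable_ofReal.comp ((measurable_cutTsum hψ k).comp measurable_norm))
  have hg1 : ∀ r, ‖g r‖ ≤ 1 := fun r => norm_phase_mul_le (cutTsum_mem hψ k r) k r
  have hgs : ∀ r, 0 ≤ r → g r ≠ 0 → r ≤ 2 * 2 ^ kstar Γ k := fun r hr h =>
    cutTsum_supp hψ hr (Complex.ofReal_ne_zero.1 (right_ne_zero_of_mul h))
  have hm : ∀ ε : ℝ, MeasurableSet {t : Rn n | ε < ‖t‖ ∧ ‖t‖ < ε⁻¹} := fun ε =>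
    (measurableSet_lt measurable_const measurable_norm).inter
      (measurableSet_lt measurable_norm measurable_const)
  have hi : ∀ (ε : ℝ) (t : Rn n), (Ioo ε ε⁻¹).indicator g ‖t‖ =
      {t : Rn n | ε < ‖t‖ ∧ ‖t‖ < ε⁻¹}.indicator (fun t => g ‖t‖) t := fun ε t => rfl
  have him : ∀ ε : ℝ, Measurable fun t : Rn n => (Ioo ε ε⁻¹).indicator g ‖t‖ := fun ε => by
    simp only [hi]
    exact hgm.indicator (hm ε)
  have hi1 : ∀ (ε r : ℝ), ‖(Ioo ε ε⁻¹).indicator g r‖ ≤ 1 := fun ε r =>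
    (norm_indicator_le_norm_self _ _).trans (hg1 r)
  have hlim := hK.tendsto_pvOp (L := 𝓝[>] (0 : ℝ)) (g := fun ε => (Ioo ε ε⁻¹).indicator g)
    (g₀ := g) him hi1 (fun ε r hr h => hgs r hr fun h0 => h (by simp [indicator_apply, h0]))
    (fun r hr => ?_) hf x
  · refine hlim.congr' ?_
    filter_upwards [self_mem_nhdsWithin] with ε hε
    have hε' : 0 < ε := hε
    rw [← hK.integral_eq_pvOp (him ε) (hi1 ε) hε' (R := ε⁻¹) (fun r _ h => ?_) hf x,
      ← integral_indicator (hm ε)]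
    · refine integral_congr_ae (.of_forall fun t => ?_)
      simp only [hi, indicator_apply]
      split_ifs
      · simp only [hg, phase, cutTsum]
        push_cast
        ring
      · simp
    · have : r ∈ Ioo ε ε⁻¹ := mem_of_indicator_ne_zero h
      exact ⟨this.1.le, this.2.le⟩
  · refine tendsto_const_nhds.congr' ?_
    have h1 : ∀ᶠ ε in 𝓝[>] (0 : ℝ), ε < r := nhdsWithin_le_nhds (Iio_mem_nhds hr)
    have h2 : ∀ᶠ ε in 𝓝[>] (0 : ℝ), r < ε⁻¹ := tendsto_inv_nhdsGT_zero.eventually_gt_atTop r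
    filter_upwards [h1, h2] with ε h3 h4
    exact (indicator_of_mem (show r ∈ Ioo ε ε⁻¹ from ⟨h3, h4⟩) g).symm

lemma kop_cker_eq (κ f : Rn n → ℂ) (x : Rn n) : kop (cker κ) f x = ∫ t, f (x - t) * κ t := by
  rw [kop, ← integral_sub_left_eq_self _ volume x]
  simp [cker, mul_comm]

lemma truncSum_eq [NeZero n] (hΓ : IsGammaU Γ) (hK : HomKer K Ω) (hψ : IsLPCutoff ψ) (k : ℤ)
    (L : ℕ) {B : ℝ} {f : Rn n → ℂ} (hf : BddLip B f) (x : Rn n) :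
    truncSum (pieceKer K ψ) (phaseKer Γ K ψ) (kstar Γ) (Finset.Icc (-L : ℤ) L) f x k =
      pvOp K (fun r => phase Γ k r * (cutSum Γ ψ k (Finset.Icc (-L : ℤ) L) r : ℂ)) f x := by
  set Λ := Finset.Icc (-L : ℤ) L with hΛ
  have hcm : ∀ Λ : Finset ℤ, Measurable fun t : Rn n => (cutSum Γ ψ k Λ ‖t‖ : ℂ) := fun Λ =>
    Complex.measurable_ofReal.comp ((measurable_cutSum hψ k Λ).comp measurable_norm)
  rw [← hK.integral_eq_pvOp ((measurable_phase hΓ k).mul (hcm Λ))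
    (fun r => norm_phase_mul_le (cutSum_mem hψ k Λ r) k r)
    (ε := 2 ^ (-L : ℤ) / 2) (by positivity)
    (fun r hr h => cutSum_supp hψ hr (Complex.ofReal_ne_zero.1 (right_ne_zero_of_mul h))) hf x]
  have hterm : ∀ l r, cutSum Γ ψ k {l} r =
      if l ≤ kstar Γ k then ψ ((2 : ℝ) ^ (-l) * r) else 0 := fun l r => by simp [cutSum]
  have hsupp : ∀ l r, 0 ≤ r → cutSum Γ ψ k {l} r ≠ 0 → 2 ^ l / 2 ≤ r ∧ r ≤ 2 * 2 ^ kstar Γ k :=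
    fun l r hr h => cutoff_term_supp hψ hr (by rwa [hterm] at h)
  have hint : ∀ l, Integrable fun t : Rn n =>
      f (x - t) * (phase Γ k ‖t‖ * (cutSum Γ ψ k {l} ‖t‖ : ℂ) * (K t : ℂ)) := fun l =>
    hK.integrable_mul_radial (g := fun r => phase Γ k r * (cutSum Γ ψ k {l} r : ℂ))
      ((measurable_phase hΓ k).mul (hcm {l}))
      (fun r => norm_phase_mul_le (cutSum_mem hψ k {l} r) k r) (ε := 2 ^ l / 2) (by positivity)
      (fun r hr h => hsupp l r hr fun h0 => h (by simp [h0])) hf x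
  have hint' : ∀ l, Integrable fun t : Rn n =>
      f (x - t) * ((cutSum Γ ψ k {l} ‖t‖ : ℂ) * (K t : ℂ)) := fun l =>
    hK.integrable_mul_radial (g := fun r => (cutSum Γ ψ k {l} r : ℂ)) (hcm {l})
      (fun r => by
        have h := cutSum_mem (Γ := Γ) hψ k {l} r
        rw [Complex.norm_real, Real.norm_of_nonneg h.1]
        exact h.2) (ε := 2 ^ l / 2) (by positivity)
      (fun r hr h => hsupp l r hr fun h0 => h (by simp [h0])) hf x
  have hone : ∀ l, (if l ≤ kstar Γ k then kop (cker (pieceKer K ψ l)) f x +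
      kop (cker (phaseKer Γ K ψ k l)) f x else 0) =
      ∫ t, f (x - t) * (phase Γ k ‖t‖ * (cutSum Γ ψ k {l} ‖t‖ : ℂ) * (K t : ℂ)) := fun l => by
    have h1 := hint l
    have h2 := hint' l
    simp only [hterm] at h1 h2 ⊢
    split_ifs with hl
    · simp only [hl, if_true] at h1 h2
      rw [kop_cker_eq, kop_cker_eq, ← integral_add]
      · refine integral_congr_ae (.of_forall fun t => ?_)
        simp only [pieceKer, phaseKer, phase]
        push_cast
        ring
      · simpa [pieceKer] using h2
      · refine (h1.sub h2).congr (.of_forall fun t => ?_)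
        simp only [pieceKer, phaseKer, phase, Pi.sub_apply]
        push_cast
        ring
    · simp
  rw [truncSum, Finset.sum_congr rfl fun l _ => hone l, ← integral_finsetSum _ fun l _ => hint l]
  refine integral_congr_ae (.of_forall fun t => ?_)
  simp only [hterm]
  simp only [cutSum, Complex.ofReal_sum, Finset.mul_sum, Finset.sum_mul]

lemma tendsto_truncSum [NeZero n] (hΓ : IsGammaU Γ) (hK : HomKer K Ω) (hψ : IsLPCutoff ψ) (k : ℤ)
    {B : ℝ} {f : Rn n → ℂ} (hf : BddLip B f) (x : Rn n) :
    Tendsto (fun L : ℕ => truncSum (pieceKer K ψ) (phaseKer Γ K ψ) (kstar Γ)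
      (Finset.Icc (-L : ℤ) L) f x k) atTop (𝓝 (Hkno Γ K ψ k f x)) := by
  simp only [truncSum_eq hΓ hK hψ k _ hf x, Hkno_eq hΓ hK hψ k hf x]
  refine hK.tendsto_pvOp (R := 2 * 2 ^ kstar Γ k) (fun L => (measurable_phase hΓ k).mul
    (Complex.measurable_ofReal.comp ((measurable_cutSum hψ k _).comp measurable_norm)))
    (fun L r => norm_phase_mul_le (cutSum_mem hψ k _ r) k r)
    (fun L r hr h =>
      (cutSum_supp hψ hr (Complex.ofReal_ne_zero.1 (right_ne_zero_of_mul h))).2) (fun r _ => ?_) hf x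
  exact ((Complex.continuous_ofReal.tendsto _).comp (tendsto_cutSum hψ k r)).const_mul _

lemma jumpCount_le_liminf {lam : ℝ} {a : ℤ → ℂ} {b : ℕ → ℤ → ℂ}
    (h : ∀ k, Tendsto (fun L => b L k) atTop (𝓝 (a k))) :
    jumpCount lam (univ : Set ℤ) a ≤
      liminf (fun L : ℕ => jumpCount lam ((Finset.Icc (-L : ℤ) L : Finset ℤ) : Set ℤ) (b L))
        atTop := by
  refine iSup_le fun J => iSup_le fun s => iSup_le fun t => iSup_le fun _ => iSup_le fun _ =>
    iSup_le fun hst => iSup_le fun hts => iSup_le fun hj => ?_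
  have hmem : ∀ k : ℤ, ∀ᶠ L : ℕ in atTop, k ∈ Finset.Icc (-L : ℤ) L := fun k =>
    (eventually_ge_atTop k.natAbs).mono fun L hL => Finset.mem_Icc.2 (by omega)
  refine le_liminf_of_le (by isBoundedDefault) ?_
  have h1 : ∀ᶠ L : ℕ in atTop, ∀ i, s i ∈ Finset.Icc (-L : ℤ) L := eventually_all.2 fun i => hmem _
  have h2 : ∀ᶠ L : ℕ in atTop, ∀ i, t i ∈ Finset.Icc (-L : ℤ) L := eventually_all.2 fun i => hmem _
  have h3 : ∀ᶠ L : ℕ in atTop, ∀ i, lam < ‖b L (t i) - b L (s i)‖ := eventually_all.2 fun i =>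
    ((h (t i)).sub (h (s i))).norm.eventually_const_lt (hj i)
  filter_upwards [h1, h2, h3] with L h1 h2 h3
  exact le_iSup_of_le J <| le_iSup_of_le s <| le_iSup_of_le t <|
    le_iSup_of_le (fun i => Finset.mem_coe.2 (h1 i)) <|
    le_iSup_of_le (fun i => Finset.mem_coe.2 (h2 i)) <|
    le_iSup_of_le hst <| le_iSup_of_le hts <| le_iSup_of_le h3 le_rfl

lemma allLp_schwartz (f : SchwartzMap (Rn n) ℂ) : AllLp (⇑f) := fun q _ _ => f.memLp q volume

end Final

end JumpNonosc

open JumpNonosc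

/-- Lemma 4.1: the jump inequality for the non-oscillatory parts. -/
theorem jump_inequality_nonosc (n : ℕ) (hn : 2 ≤ n) (Γ : ℝ → ℝ) (hΓ : IsGammaU Γ)
    (K : Rn n → ℝ) (hK : IsHomCZKernel n K) (ψ : ℝ → ℝ) (hψ : IsLPCutoff ψ)
    (p : ℝ) (hp : 1 < p) :
    ∃ C > (0 : ℝ), ∀ f : SchwartzMap (Rn n) ℂ, ∀ lam > (0 : ℝ),
      lpNormENN p (fun x => ENNReal.ofReal lam *
        jumpCount lam (Set.univ : Set ℤ) (fun k => Hkno Γ K ψ k (⇑f) x) ^ (1/2 : ℝ)) volume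
      ≤ ENNReal.ofReal C * eLpNorm (⇑f) (ENNReal.ofReal p) volume := by
  have : NeZero n := ⟨by omega⟩
  obtain ⟨Ω, h1, h2, h3, h4⟩ := hK
  have hK : HomKer K Ω := ⟨h1, h2, h3, h4⟩
  obtain ⟨A, φ, η, hadm⟩ := exists_admissible hΓ hK hψ
  obtain ⟨C, hC, hjump⟩ := exists_jump_bound (n := n) A hp
  have hp0 : 0 < p := by linarith
  have hCtop : C ^ (1 / p) ≠ ⊤ := ENNReal.rpow_ne_top_of_nonneg (by positivity) hC
  refine ⟨(C ^ (1 / p)).toReal + 1, by positivity, fun f lam hlam => ?_⟩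
  obtain ⟨B, hB⟩ := exists_bddLip f
  choose W hW hWj using fun L : ℕ => hjump _ _ _ _ _ hadm (Finset.Icc (-L : ℤ) L)
    (Finset.Icc (-L : ℤ) L) f (allLp_schwartz f) lam hlam
  set F : ℝ≥0∞ → ℝ≥0∞ := fun y => (ENNReal.ofReal lam * y ^ (1 / 2 : ℝ)) ^ p with hF
  have hFm : Monotone F := fun y z hyz => by simp only [hF]; gcongr
  have hFc : Continuous F := (ENNReal.continuous_rpow_const).comp
    ((ENNReal.continuous_const_mul ENNReal.ofReal_ne_top).comp ENNReal.continuous_rpow_const)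
  have hF' : ∀ y, F y = (ENNReal.ofReal (lam ^ 2) * y) ^ (p / 2) := fun y => by
    simp only [hF]
    rw [ENNReal.mul_rpow_of_nonneg _ _ hp0.le, ENNReal.mul_rpow_of_nonneg _ _ (by positivity),
      ← ENNReal.rpow_mul, ENNReal.ofReal_pow hlam.le, ← ENNReal.rpow_natCast, ← ENNReal.rpow_mul]
    congr 2 <;> push_cast <;> ring
  have hpt : ∀ x, F (jumpCount lam univ fun k => Hkno Γ K ψ k f x) ≤
      liminf (fun L => ENNReal.ofReal (W L x ^ (p / 2))) atTop := fun x => by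
    refine (hFm (jumpCount_le_liminf fun k => tendsto_truncSum hΓ hK hψ k hB x)).trans ?_
    rw [hFm.map_liminf_of_continuousAt _ hFc.continuousAt]
    refine liminf_le_liminf (.of_forall fun L => ?_)
    simp only [Function.comp_apply]
    rw [hF', ← ENNReal.ofReal_rpow_of_nonneg ((hW L).nonneg x) (by positivity)]
    exact ENNReal.rpow_le_rpow (hWj L x) (by positivity)
  have hint : ∫⁻ x, F (jumpCount lam univ fun k => Hkno Γ K ψ k f x) ≤
      C * eLpNorm f (ENNReal.ofReal p) volume ^ p := by
    refine (lintegral_mono hpt).trans ((lintegral_liminf_le' fun L =>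
      ((hW L).meas.pow_const _).ennreal_ofReal).trans ?_)
    exact liminf_le_of_le (by isBoundedDefault) fun b hb => by
      obtain ⟨L, hL⟩ := hb.exists
      exact hL.trans (hW L).le
  calc lpNormENN p (fun x => ENNReal.ofReal lam *
        jumpCount lam (Set.univ : Set ℤ) (fun k => Hkno Γ K ψ k (⇑f) x) ^ (1/2 : ℝ)) volume
      ≤ (C * eLpNorm f (ENNReal.ofReal p) volume ^ p) ^ (1 / p) :=
        ENNReal.rpow_le_rpow hint (by positivity)
    _ = C ^ (1 / p) * eLpNorm f (ENNReal.ofReal p) volume := by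
        rw [ENNReal.mul_rpow_of_nonneg _ _ (by positivity), ← ENNReal.rpow_mul,
          mul_one_div_cancel hp0.ne', ENNReal.rpow_one]
    _ ≤ _ := by
        gcongr
        rw [← ENNReal.ofReal_toReal hCtop]
        exact ENNReal.ofReal_le_ofReal (by simp)
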